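/- Every planar simple finite graph that contains at most one cycle of length at most 4 is 3-choosable. -/

import Mathlib

open SimpleGraph

/-- A plane embedding (drawing without crossings) of a simple graph `G`:
vertices are mapped to distinct points of the plane, each edge to a simple arc
joining the images of its endpoints, such that distinct edges meet only in
common endpoints and arcs pass through no other vertex images. -/
structure PlaneEmbedding {V : Type} (G : SimpleGraph V) : Type where
  pos : V → ℝ × ℝ
  pos_inj : Function.Injective pos
  arc : ∀ ⦃u v : V⦄, G.Adj u v → ℝ → ℝ × ℝ
  arc_continuousOn : ∀ ⦃u v : V⦄ (h : G.Adj u v), ContinuousOn (arc h) (Set.Icc 0 1)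
  arc_injOn : ∀ ⦃u v : V⦄ (h : G.Adj u v), Set.InjOn (arc h) (Set.Icc 0 1)
  arc_zero : ∀ ⦃u v : V⦄ (h : G.Adj u v), arc h 0 = pos u
  arc_one : ∀ ⦃u v : V⦄ (h : G.Adj u v), arc h 1 = pos v
  arc_symm : ∀ ⦃u v : V⦄ (h : G.Adj u v),
    arc h.symm '' Set.Icc 0 1 = arc h '' Set.Icc 0 1
  arc_inter : ∀ ⦃u v x y : V⦄ (h₁ : G.Adj u v) (h₂ : G.Adj x y),
    s(u, v) ≠ s(x, y) →
    (arc h₁ '' Set.Icc 0 1) ∩ (arc h₂ '' Set.Icc 0 1) ⊆ pos '' ({u, v} ∩ {x, y})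
  arc_vertex : ∀ ⦃u v : V⦄ (h : G.Adj u v) (w : V),
    pos w ∈ arc h '' Set.Icc 0 1 → w = u ∨ w = v

/-- The point set of the drawing: all vertex images and all edge arcs. -/
def PlaneEmbedding.drawing {V : Type} {G : SimpleGraph V}
    (emb : PlaneEmbedding G) : Set (ℝ × ℝ) :=
  Set.range emb.pos ∪ ⋃ (u : V) (v : V) (h : G.Adj u v), emb.arc h '' Set.Icc 0 1

/-- The outer (unbounded) face of a plane embedding: points not on the drawing
whose connected component in the complement of the drawing is unbounded. -/
def PlaneEmbedding.outerFace {V : Type} {G : SimpleGraph V}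
    (emb : PlaneEmbedding G) : Set (ℝ × ℝ) :=
  {p | p ∉ emb.drawing ∧ ¬ Bornology.IsBounded (connectedComponentIn emb.drawingᶜ p)}

/-- A vertex is incident with the outer face if its image lies on the closure of
the outer face. -/
def PlaneEmbedding.OuterVertex {V : Type} {G : SimpleGraph V}
    (emb : PlaneEmbedding G) (v : V) : Prop :=
  emb.pos v ∈ closure emb.outerFace

/-- `φ` is a proper `L`-coloring of `G`. -/
def IsLColoring {V : Type} (G : SimpleGraph V) (L : V → Finset ℕ) (φ : V → ℕ) : Prop :=
  (∀ v, φ v ∈ L v) ∧ ∀ ⦃u v : V⦄, G.Adj u v → φ u ≠ φ v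

/-- `G` is `L`-colorable. -/
def LColorable {V : Type} (G : SimpleGraph V) (L : V → Finset ℕ) : Prop :=
  ∃ φ, IsLColoring G L φ

/-- `G` is `k`-choosable. -/
def Choosable {V : Type} (G : SimpleGraph V) (k : ℕ) : Prop :=
  ∀ L : V → Finset ℕ, (∀ v, k ≤ (L v).card) → LColorable G L

/-- Any two distinct cycles of length at most `4` in `G` are at distance at least `d`:
for any two such cycles (distinct as subgraphs, i.e. with different edge sets), every
walk from a vertex of one to a vertex of the other has length at least `d`. -/
def CyclesFarApart {V : Type} [DecidableEq V] (G : SimpleGraph V) (d : ℕ) : Prop :=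
  ∀ ⦃a b : V⦄ (c₁ : G.Walk a a) (c₂ : G.Walk b b),
    c₁.IsCycle → c₂.IsCycle → c₁.length ≤ 4 → c₂.length ≤ 4 →
    c₁.edges.toFinset ≠ c₂.edges.toFinset →
    ∀ x ∈ c₁.support, ∀ y ∈ c₂.support, ∀ p : G.Walk x y, d ≤ p.length

set_option linter.unusedSectionVars false


/-! ### Continuous logarithms and winding numbers -/

theorem exists_continuous_log {A : Type*} [TopologicalSpace A] [Inhabited A]
    [SimplyConnectedSpace A] [LocallyPathConnectedSpace A] (f : A → ℂ) (hf : Continuous f)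
    (h0 : ∀ a, f a ≠ 0) : ∃ g : A → ℂ, Continuous g ∧ ∀ a, Complex.exp (g a) = f a := by
  obtain ⟨F, ⟨-, hF⟩, -⟩ := Complex.isCoveringMapOn_exp.existsUnique_continuousMap_lifts
    (⟨f, hf⟩ : C(A, ℂ)) (a₀ := default) (Complex.exp_log (h0 default)) (fun a => h0 a)
  exact ⟨F, F.continuous, fun a => congrFun hF a⟩

/-- `n` is the integer by which the total variation of the argument along `γ` on `[0, 1]` differs
from the difference of the principal arguments of the endpoints. -/
def Winds (γ : ℝ → ℂ) (n : ℤ) : Prop :=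
  ∃ l : ℝ → ℂ, Continuous l ∧ (∀ t, Complex.exp (l t) = γ t) ∧
    (l 1).im - (l 0).im = 2 * Real.pi * n + (γ 1).arg - (γ 0).arg

theorem exists_im_eq_arg_add {w z : ℂ} (h : Complex.exp w = z) :
    ∃ n : ℤ, w.im = z.arg + 2 * Real.pi * n := by
  have hz : z ≠ 0 := h ▸ Complex.exp_ne_zero w
  have h1 : Complex.exp w = Complex.exp (Complex.log z) := by rw [Complex.exp_log hz, h]
  obtain ⟨n, hn⟩ := Complex.exp_eq_exp_iff_exists_int.1 h1
  refine ⟨n, ?_⟩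
  rw [hn]
  simp [Complex.log_im]
  ring

theorem winds_of_log {γ l : ℝ → ℂ} (hl : Continuous l) (h : ∀ t, Complex.exp (l t) = γ t) :
    ∃ n, Winds γ n ∧ (l 1).im - (l 0).im = 2 * Real.pi * n + (γ 1).arg - (γ 0).arg := by
  obtain ⟨n, hn⟩ := exists_im_eq_arg_add (h 1)
  obtain ⟨m, hm⟩ := exists_im_eq_arg_add (h 0)
  have : (l 1).im - (l 0).im = 2 * Real.pi * (n - m : ℤ) + (γ 1).arg - (γ 0).arg := by
    rw [hn, hm]; push_cast; ring
  exact ⟨n - m, ⟨l, hl, h, this⟩, this⟩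

theorem exists_winds {γ : ℝ → ℂ} (hc : Continuous γ) (h0 : ∀ t, γ t ≠ 0) : ∃ n, Winds γ n := by
  obtain ⟨l, hl, h⟩ := exists_continuous_log γ hc h0
  obtain ⟨n, hn, -⟩ := winds_of_log hl h
  exact ⟨n, hn⟩

theorem Winds.unique {γ : ℝ → ℂ} {n m : ℤ} (hn : Winds γ n) (hm : Winds γ m) : n = m := by
  obtain ⟨l, hl, h, e⟩ := hn
  obtain ⟨k, hk, h', e'⟩ := hm
  have key : ∀ t, ∃ j : ℤ, (l t).im - (k t).im = 2 * Real.pi * j := by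
    intro t
    obtain ⟨i, hi⟩ := exists_im_eq_arg_add (h t)
    obtain ⟨j, hj⟩ := exists_im_eq_arg_add (h' t)
    exact ⟨i - j, by rw [hi, hj]; push_cast; ring⟩
  choose j hj using key
  have hpi := Real.pi_pos
  have hjc : Continuous j := by
    rw [Int.isClosedEmbedding_coe_real.isInducing.continuous_iff]
    have : ((fun i : ℤ => (i : ℝ)) ∘ j) = fun t => ((l t).im - (k t).im) / (2 * Real.pi) := by
      funext t
      rw [hj t]
      simp only [Function.comp]
      field_simp
    change Continuous ((fun i : ℤ => (i : ℝ)) ∘ j)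
    rw [this]
    fun_prop
  have hcon : j 1 = j 0 := PreconnectedSpace.constant inferInstance hjc
  have h1 := hj 1
  have h2 := hj 0
  rw [hcon] at h1
  have : 2 * Real.pi * (n : ℝ) = 2 * Real.pi * m := by linarith
  have : (n : ℝ) = m := by
    apply mul_left_cancel₀ (by positivity) this
  exact_mod_cast this

theorem exists_arg_neg (p : ℂ) (hp : p ≠ 0) :
    ∃ k : ℤ, (-p).arg = p.arg + Real.pi * (2 * k - 1) := by
  have h := Complex.arg_neg_coe_angle hp
  rw [← Real.Angle.coe_add, Real.Angle.angle_eq_iff_two_pi_dvd_sub] at h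
  obtain ⟨k, hk⟩ := h
  exact ⟨k + 1, by push_cast; linarith⟩

theorem winds_square {e f : ℝ → ℂ} (he : Continuous e) (hf : Continuous f)
    (hd : ∀ s t, e s ≠ f t) {n₁ n₂ n₃ n₄ : ℤ}
    (h₁ : Winds (fun s => e s - f 0) n₁) (h₂ : Winds (fun s => e s - f 1) n₂)
    (h₃ : Winds (fun t => f t - e 0) n₃) (h₄ : Winds (fun t => f t - e 1) n₄)
    {s : ℂ → ℤ} (hs : ∀ p ≠ 0, (-p).arg = p.arg + Real.pi * (2 * s p - 1)) :
    n₁ - n₂ - n₃ + n₄ + (s (e 0 - f 0) + s (e 1 - f 1) - s (e 1 - f 0) - s (e 0 - f 1)) = 0 := by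
  obtain ⟨g, hg, hg'⟩ := exists_continuous_log (A := ℝ × ℝ) (fun p => e p.1 - f p.2)
    (by fun_prop) (fun p => sub_ne_zero.2 (hd _ _))
  obtain ⟨m₁, hm₁, e₁⟩ := winds_of_log (l := fun s => g (s, 0)) (γ := fun s => e s - f 0)
    (by fun_prop) (fun t => hg' _)
  obtain ⟨m₂, hm₂, e₂⟩ := winds_of_log (l := fun s => g (s, 1)) (γ := fun s => e s - f 1)
    (by fun_prop) (fun t => hg' _)
  have hneg : ∀ a b, Complex.exp (g (a, b) + Real.pi * Complex.I) = f b - e a := by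
    intro a b
    rw [Complex.exp_add, hg', Complex.exp_pi_mul_I]
    ring
  obtain ⟨m₃, hm₃, e₃⟩ := winds_of_log (l := fun t => g (0, t) + Real.pi * Complex.I)
    (γ := fun t => f t - e 0) (by fun_prop) (fun t => hneg _ _)
  obtain ⟨m₄, hm₄, e₄⟩ := winds_of_log (l := fun t => g (1, t) + Real.pi * Complex.I)
    (γ := fun t => f t - e 1) (by fun_prop) (fun t => hneg _ _)
  rw [h₁.unique hm₁, h₂.unique hm₂, h₃.unique hm₃, h₄.unique hm₄]
  have a1 := hs _ (sub_ne_zero.2 (hd 0 0))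
  have a2 := hs _ (sub_ne_zero.2 (hd 1 1))
  have a3 := hs _ (sub_ne_zero.2 (hd 1 0))
  have a4 := hs _ (sub_ne_zero.2 (hd 0 1))
  simp only [neg_sub, Complex.add_im] at a1 a2 a3 a4 e₁ e₂ e₃ e₄
  have hpi := Real.pi_pos
  have : 2 * Real.pi * ((m₁ - m₂ - m₃ + m₄ + (s (e 0 - f 0) + s (e 1 - f 1) - s (e 1 - f 0)
      - s (e 0 - f 1)) : ℤ) : ℝ) = 0 := by
    push_cast
    linarith
  have := (mul_eq_zero.1 this).resolve_left (by positivity)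
  exact_mod_cast this

/-! ### Algebraic planarity -/

/-- An algebraic certificate of planarity modulo two for the relation `E`: `s` records the sides
of pairs of points and `x a b c` the parity with which the edge `ab` winds around `c`. -/
structure PD {V : Type} (E : V → V → Prop) (s : V → V → ZMod 2) (x : V → V → V → ZMod 2) :
    Prop where
  anti : ∀ a b, a ≠ b → s a b + s b a = 1
  symm : ∀ a b c, x a b c = x b a c
  eqn : ∀ a b c d, E a b → E c d → a ≠ c → a ≠ d → b ≠ c → b ≠ d →
    x a b c + x a b d + x c d a + x c d b = s a c + s a d + s b c + s b d

/-- A relation is (algebraically) planar if it has a certificate. -/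
def Planar {V : Type} (E : V → V → Prop) : Prop := ∃ s x, PD E s x

theorem PlaneEmbedding.planar {V : Type} {G : SimpleGraph V} (emb : PlaneEmbedding G) :
    Planar G.Adj := by
  classical
  let P : V → ℂ := fun v => Complex.equivRealProd.symm (emb.pos v)
  have hP : Function.Injective P := Complex.equivRealProd.symm.injective.comp emb.pos_inj
  let γ : ∀ {u v : V}, G.Adj u v → ℝ → ℂ := fun h t =>
    Complex.equivRealProdCLM.symm (emb.arc h (Set.projIcc (0 : ℝ) 1 zero_le_one t))
  have hγc : ∀ {u v : V} (h : G.Adj u v), Continuous (γ h) := by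
    intro u v h
    refine Complex.equivRealProdCLM.symm.continuous.comp ?_
    exact (emb.arc_continuousOn h).comp_continuous
      (continuous_subtype_val.comp continuous_projIcc) (fun t => Subtype.prop _)
  have hγ0 : ∀ {u v : V} (h : G.Adj u v), γ h 0 = P u := by
    intro u v h
    simp only [γ, P, Set.projIcc_left, emb.arc_zero]
    rfl
  have hγ1 : ∀ {u v : V} (h : G.Adj u v), γ h 1 = P v := by
    intro u v h
    simp only [γ, P, Set.projIcc_right, emb.arc_one]
    rfl
  have hγv : ∀ {u v : V} (h : G.Adj u v) (w : V) (t : ℝ), w ≠ u → w ≠ v → γ h t - P w ≠ 0 := by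
    intro u v h w t hu hv e
    have e' : emb.arc h (Set.projIcc (0 : ℝ) 1 zero_le_one t) = emb.pos w :=
      Complex.equivRealProdCLM.symm.injective (sub_eq_zero.1 e)
    rcases emb.arc_vertex h w ⟨_, Subtype.prop _, e'⟩ with h | h
    · exact hu h
    · exact hv h
  have hγd : ∀ {u v a b : V} (h : G.Adj u v) (k : G.Adj a b) (t r : ℝ), u ≠ a → u ≠ b → v ≠ a →
      v ≠ b → γ h t ≠ γ k r := by
    intro u v a b h k t r h1 h2 h3 h4 e
    have e' := Complex.equivRealProdCLM.symm.injective e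
    have hne : s(u, v) ≠ s(a, b) := by
      intro h
      simp only [Sym2.eq_iff] at h
      tauto
    obtain ⟨w, ⟨hw1, hw2⟩, -⟩ := emb.arc_inter h k hne
      ⟨⟨_, Subtype.prop _, rfl⟩, ⟨_, Subtype.prop _, e'.symm⟩⟩
    simp only [Set.mem_insert_iff, Set.mem_singleton_iff] at hw1 hw2
    rcases hw1 with rfl | rfl <;> tauto
  have hS : ∀ p : ℂ, ∃ k : ℤ, p ≠ 0 → (-p).arg = p.arg + Real.pi * (2 * k - 1) := by
    intro p
    by_cases hp : p = 0
    · exact ⟨0, fun h => absurd hp h⟩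
    · obtain ⟨k, hk⟩ := exists_arg_neg p hp
      exact ⟨k, fun _ => hk⟩
  choose S hS using hS
  have hN : ∀ (q : V × V) (w : V), ∃ n : ℤ, ∀ h : G.Adj q.1 q.2, w ≠ q.1 → w ≠ q.2 →
      Winds (fun t => γ h t - P w) n := by
    intro q w
    by_cases h : G.Adj q.1 q.2 ∧ w ≠ q.1 ∧ w ≠ q.2
    · obtain ⟨n, hn⟩ := exists_winds (γ := fun t => γ h.1 t - P w) ((hγc h.1).sub continuous_const)
        (fun t => hγv h.1 w t h.2.1 h.2.2)
      exact ⟨n, fun _ _ _ => hn⟩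
    · exact ⟨0, fun a b c => absurd ⟨a, b, c⟩ h⟩
  choose N hN using hN
  have hanti : ∀ a b, a ≠ b →
      ((S (P a - P b) : ℤ) : ZMod 2) + ((S (P b - P a) : ℤ) : ZMod 2) = 1 := by
    intro a b hab
    have h1 := hS _ (sub_ne_zero.2 (hP.ne hab))
    have h2 := hS _ (sub_ne_zero.2 (hP.ne hab.symm))
    rw [neg_sub] at h1 h2
    have h3 : Real.pi * ((S (P a - P b) : ℝ) + S (P b - P a)) = Real.pi * 1 := by linarith
    have h4 := mul_left_cancel₀ Real.pi_ne_zero h3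
    have h5 : S (P a - P b) + S (P b - P a) = 1 := by exact_mod_cast h4
    exact_mod_cast congrArg (fun i : ℤ => (i : ZMod 2)) h5
  have key : ∀ a b c d, G.Adj a b → G.Adj c d → a ≠ c → a ≠ d → b ≠ c → b ≠ d →
      ((N (a, b) c : ℤ) : ZMod 2) + (N (a, b) d : ℤ) + (N (c, d) a : ℤ) + (N (c, d) b : ℤ) =
      (S (P a - P c) : ℤ) + (S (P a - P d) : ℤ) + (S (P b - P c) : ℤ) + (S (P b - P d) : ℤ) := by
    intro a b c d hab hcd hac had hbc hbd
    have h := winds_square (hγc hab) (hγc hcd) (fun t r => hγd hab hcd t r hac had hbc hbd)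
      (by rw [hγ0 hcd]; exact hN (a, b) c hab hac.symm hbc.symm)
      (by rw [hγ1 hcd]; exact hN (a, b) d hab had.symm hbd.symm)
      (by rw [hγ0 hab]; exact hN (c, d) a hcd hac had)
      (by rw [hγ1 hab]; exact hN (c, d) b hcd hbc hbd) hS
    rw [hγ0, hγ1, hγ0, hγ1] at h
    have h' := congrArg (fun i : ℤ => (i : ZMod 2)) h
    push_cast at h'
    simp only [CharTwo.sub_eq_add] at h'
    rw [← CharTwo.add_eq_zero, ← h']
    ring
  refine ⟨fun a b => S (P a - P b), fun a b c => N (s(a, b).out) c, hanti, ?_, ?_⟩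
  · intro a b c
    rw [Sym2.eq_swap]
  · have hout : ∀ a b : V, s(a, b).out = (a, b) ∨ s(a, b).out = (b, a) := by
      intro a b
      have : s((s(a, b).out).1, (s(a, b).out).2) = s(a, b) := Quot.out_eq s(a, b)
      rcases Sym2.eq_iff.1 this with ⟨h1, h2⟩ | ⟨h1, h2⟩
      · exact Or.inl (Prod.ext h1 h2)
      · exact Or.inr (Prod.ext h1 h2)
    intro a b c d hab hcd hac had hbc hbd
    rcases hout a b with h1 | h1 <;> rcases hout c d with h2 | h2 <;> rw [h1, h2]
    · exact key a b c d hab hcd hac had hbc hbd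
    · linear_combination key a b d c hab hcd.symm had hac hbd hbc
    · linear_combination key b a c d hab.symm hcd hbc hbd hac had
    · linear_combination key b a d c hab.symm hcd.symm hbd hbc had hac

section Parity

variable {V : Type} {E : V → V → Prop} {s : V → V → ZMod 2} {x : V → V → V → ZMod 2}

theorem Planar.mono {E' : V → V → Prop} (h : Planar E) (hE : ∀ a b, E' a b → E a b) :
    Planar E' := by
  obtain ⟨s, x, h⟩ := h
  exact ⟨s, x, h.anti, h.symm, fun a b c d hab hcd => h.eqn a b c d (hE _ _ hab) (hE _ _ hcd)⟩

/-- The parity with which the walk `l` winds around `w`. -/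
def winding (x : V → V → V → ZMod 2) : List V → V → ZMod 2
  | [], _ => 0
  | [_], _ => 0
  | a :: b :: l, w => x a b w + winding x (b :: l) w

theorem winding_add_winding (h : PD E s x) {c d : V} (hcd : E c d) (a : V) (l : List V)
    (hl : List.IsChain E (a :: l)) (hc : c ∉ a :: l) (hd : d ∉ a :: l) :
    winding x (a :: l) c + winding x (a :: l) d =
      (x c d a + s a c + s a d) + (x c d ((a :: l).getLast (by simp)) +
        s ((a :: l).getLast (by simp)) c + s ((a :: l).getLast (by simp)) d) := by
  induction l generalizing a with
  | nil => simp [winding]; grind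
  | cons b l ih =>
    rw [List.isChain_cons_cons] at hl
    simp only [List.mem_cons, not_or] at hc hd
    have := ih b hl.2 (by simp [hc]) (by simp [hd])
    have e := h.eqn a b c d hl.1 hcd (Ne.symm hc.1) (Ne.symm hd.1) (Ne.symm hc.2.1)
      (Ne.symm hd.2.1)
    simp only [winding]
    rw [List.getLast_cons (by simp)]
    grind

theorem winding_eq_of_adj (h : PD E s x) {c d : V} (hcd : E c d) (a : V) (l : List V)
    (hl : List.IsChain E (a :: l)) (hc : c ∉ a :: l) (hd : d ∉ a :: l)
    (hcl : (a :: l).getLast (by simp) = a) :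
    winding x (a :: l) c = winding x (a :: l) d := by
  have := winding_add_winding h hcd a l hl hc hd
  rw [hcl] at this
  grind

theorem PD.exists_add_star (h : PD E s x) (z : V) (N : V → Prop) (y : V → V → ZMod 2)
    (hN : ¬ N z)
    (hy : ∀ b, N b → ∀ c d, E c d → z ≠ c → z ≠ d → b ≠ c → b ≠ d →
      y b c + y b d + x c d z + x c d b = s z c + s z d + s b c + s b d) :
    ∃ x', PD (fun a b => E a b ∨ (a = z ∧ N b) ∨ (b = z ∧ N a)) s x' ∧
      (∀ a b w, ¬ (a = z ∧ N b) → ¬ (b = z ∧ N a) → x' a b w = x a b w) ∧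
      ∀ b w, N b → x' z b w = y b w := by
  classical
  refine ⟨fun a b w => if a = z ∧ N b then y b w else if b = z ∧ N a then y a w else x a b w,
    ⟨h.anti, ?_, ?_⟩, ?_, ?_⟩
  · intro a b c
    have := h.symm a b c
    grind
  · have main : ∀ b c d, N b → E c d → z ≠ c → z ≠ d → b ≠ c → b ≠ d →
        y b c + y b d + x c d z + x c d b = s z c + s z d + s b c + s b d := by
      intro b c d hb hcd
      exact hy b hb c d hcd
    intro a b c d hab hcd hac had hbc hbd
    by_cases h1 : a = z ∧ N b
    · obtain ⟨rfl, hb⟩ := h1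
      have hcd' : E c d := by grind
      have := main b c d hb hcd' hac had hbc hbd
      grind
    by_cases h2 : b = z ∧ N a
    · obtain ⟨rfl, ha⟩ := h2
      have hcd' : E c d := by grind
      have := main a c d ha hcd' hbc hbd hac had
      grind
    have hab' : E a b := by grind
    by_cases h3 : c = z ∧ N d
    · obtain ⟨rfl, hd⟩ := h3
      have := main d a b hd hab' hac.symm hbc.symm had.symm hbd.symm
      have := h.anti a c hac
      have := h.anti b c hbc
      have := h.anti a d had
      have := h.anti b d hbd
      grind
    by_cases h4 : d = z ∧ N c
    · obtain ⟨rfl, hc⟩ := h4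
      have := main c a b hc hab' had.symm hbd.symm hac.symm hbc.symm
      have := h.anti a c hac
      have := h.anti b c hbc
      have := h.anti a d had
      have := h.anti b d hbd
      grind
    have hcd' : E c d := by grind
    have := h.eqn a b c d hab' hcd' hac had hbc hbd
    grind
  · grind
  · grind

/-- Contracting an edge. -/
theorem Planar.contract (h : Planar E) {z v : V} (hzv : E z v) :
    Planar (fun a b => (a ≠ v ∧ b ≠ v ∧ E a b) ∨ (a = z ∧ b ≠ z ∧ b ≠ v ∧ E v b) ∨
      (b = z ∧ a ≠ z ∧ a ≠ v ∧ E v a)) := by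
  obtain ⟨s, x, h⟩ := h
  have h1 : PD (fun a b => a ≠ v ∧ b ≠ v ∧ E a b) s x :=
    ⟨h.anti, h.symm, fun a b c d hab hcd => h.eqn a b c d hab.2.2 hcd.2.2⟩
  obtain ⟨x', hx', -, -⟩ := h1.exists_add_star z (fun b => b ≠ z ∧ b ≠ v ∧ E v b)
    (fun b w => x z v w + x v b w) (by simp) (by
      rintro b ⟨hbz, hbv, hvb⟩ c d ⟨hc, hd, hcd⟩ h1 h2 h3 h4
      have e1 := h.eqn z v c d hzv hcd h1 h2 hc.symm hd.symm
      have e2 := h.eqn v b c d hvb hcd hc.symm hd.symm h3 h4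
      grind)
  exact ⟨s, x', hx'⟩

/-- Adding a chord that cuts off the corner `z a b` of a cycle with an empty side. -/
theorem PD.exists_add_chord (h : PD E s x) (hirr : ∀ a, ¬ E a a)
    (hsym : ∀ a b, E a b → E b a)
    {z a b : V} {R : List V} {ω : ZMod 2} (hza : E z a) (hab : E a b)
    (hR : List.IsChain E (b :: R)) (hlast : (b :: R).getLast (by simp) = z)
    (ha : a ∉ b :: R) (hzb : z ≠ b)
    (hN : ∀ d, E a d → d ∈ b :: R → d = z ∨ d = b)
    (hW : ∀ d, E a d → d ∉ b :: R → x z a d + x a b d + winding x (b :: R) d = ω) :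
    ∃ x', PD (fun u v => E u v ∨ (u = z ∧ v = b) ∨ (v = z ∧ u = b)) s x' ∧
      (∀ u v w, ¬ (u = z ∧ v = b) → ¬ (v = z ∧ u = b) → x' u v w = x u v w) ∧
      (∀ w, w ≠ a → x' z b w = x z a w + x a b w) ∧
      x' z b a = ω + winding x (b :: R) a := by
  classical
  obtain ⟨x', h1, h2, h3⟩ := h.exists_add_star z (fun v => v = b)
    (fun _ w => if w = a then ω + winding x (b :: R) a else x z a w + x a b w) (by simpa) (by
      intro b' hb'
      have hb'' := hb'.symm
      subst hb''
      have haz : z ≠ a := by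
        rintro rfl
        exact ha (hlast ▸ List.getLast_mem _)
      have hab' : b ≠ a := by
        rintro rfl
        exact ha (by simp)
      have main : ∀ d, E a d → z ≠ d → b ≠ d →
          (ω + winding x (b :: R) a) + (x z a d + x a b d) + x a d z + x a d b =
            s z a + s z d + s b a + s b d := by
        intro d had hzd hbd
        have hd : d ∉ b :: R := fun hd => by
          rcases hN d had hd with h | h
          · exact hzd h.symm
          · exact hbd h.symm
        have e1 := hW d had hd
        have e2 := winding_add_winding h had b R hR ha hd
        rw [hlast] at e2
        grind
      intro c d hcd h1 h2 h3 h4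
      by_cases hca : c = a
      · subst hca
        have hdc : d ≠ c := by
          rintro rfl
          exact hirr _ hcd
        have := main d hcd h2 h4
        grind
      by_cases hda : d = a
      · subst hda
        simp only [hca, if_false, if_true]
        have := main c (hsym _ _ hcd) h1 h3
        have := h.symm c d
        grind
      have e1 := h.eqn z a c d hza hcd h1 h2 (Ne.symm hca) (Ne.symm hda)
      have e2 := h.eqn a b c d hab hcd (Ne.symm hca) (Ne.symm hda) h3 h4
      grind)
  refine ⟨x', h1, h2, ?_, ?_⟩
  · intro w hw
    simp [h3 b w rfl, hw]
  · simp [h3 b a rfl]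

/-- If one side of the cycle `z q₀ q₁ q₂` is empty, the diagonal `z q₁` can be added there. -/
theorem PD.fan_four (h : PD E s x) (hirr : ∀ a, ¬ E a a) (hsym : ∀ a b, E a b → E b a)
    {z q₀ q₁ q₂ : V} {ω : ZMod 2} (nd : [z, q₀, q₁, q₂].Nodup) (h₀ : E z q₀) (h₁ : E q₀ q₁)
    (h₂ : E q₁ q₂) (h₃ : E q₂ z) (n₀₂ : ¬ E q₀ q₂)
    (hW : ∀ c d, E c d → d ∉ [z, q₀, q₁, q₂] → winding x [z, q₀, q₁, q₂, z] d = ω) :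
    Planar (fun u v => E u v ∨ (u = z ∧ v = q₁) ∨ (v = z ∧ u = q₁)) := by
  simp only [List.nodup_cons, List.mem_cons, List.not_mem_nil, or_false, not_or] at nd
  obtain ⟨x', hx', -, -, -⟩ := h.exists_add_chord (R := [q₂, z]) (ω := ω) hirr hsym h₀ h₁
    (by simp [h₂, h₃]) (by simp) (by simp; grind) (by grind)
    (by
      intro d hd hd'
      simp only [List.mem_cons, List.not_mem_nil, or_false] at hd'
      rcases hd' with rfl | rfl | rfl
      · exact Or.inr rfl
      · exact absurd hd n₀₂
      · exact Or.inl rfl)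
    (by
      intro d hd hd'
      rw [← hW q₀ d hd]
      · simp only [winding]; ring
      · have : d ≠ q₀ := fun h => hirr q₀ (h ▸ hd)
        simp only [List.mem_cons, List.not_mem_nil, or_false] at hd' ⊢
        tauto)
  exact ⟨s, x', hx'⟩

/-- If one side of the cycle `z q₀ q₁ q₂ q₃` is empty, the diagonals `z q₁` and `z q₂` can be
added there. -/
theorem PD.fan_five (h : PD E s x) (hirr : ∀ a, ¬ E a a) (hsym : ∀ a b, E a b → E b a)
    {z q₀ q₁ q₂ q₃ : V} {ω : ZMod 2} (nd : [z, q₀, q₁, q₂, q₃].Nodup) (h₀ : E z q₀)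
    (h₁ : E q₀ q₁) (h₂ : E q₁ q₂) (h₃ : E q₂ q₃) (h₄ : E q₃ z) (n₀₂ : ¬ E q₀ q₂)
    (n₀₃ : ¬ E q₀ q₃) (n₁₃ : ¬ E q₁ q₃)
    (hW : ∀ c d, E c d → d ∉ [z, q₀, q₁, q₂, q₃] → winding x [z, q₀, q₁, q₂, q₃, z] d = ω) :
    Planar (fun u v => E u v ∨ (u = z ∧ (v = q₁ ∨ v = q₂)) ∨ (v = z ∧ (u = q₁ ∨ u = q₂))) := by
  simp only [List.nodup_cons, List.mem_cons, List.not_mem_nil, or_false, not_or] at nd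
  obtain ⟨x', hx', g1, g2, g3⟩ := h.exists_add_chord (R := [q₂, q₃, z]) (ω := ω) hirr hsym h₀ h₁
    (by simp [h₂, h₃, h₄]) (by simp) (by simp; grind) (by grind)
    (by
      intro d hd hd'
      simp only [List.mem_cons, List.not_mem_nil, or_false] at hd'
      rcases hd' with rfl | rfl | rfl | rfl
      · exact Or.inr rfl
      · exact absurd hd n₀₂
      · exact absurd hd n₀₃
      · exact Or.inl rfl)
    (by
      intro d hd hd'
      rw [← hW q₀ d hd]
      · simp only [winding]; ring
      · have : d ≠ q₀ := fun h => hirr q₀ (h ▸ hd)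
        simp only [List.mem_cons, List.not_mem_nil, or_false] at hd' ⊢
        tauto)
  have k1 : ∀ d, x' q₁ q₂ d = x q₁ q₂ d := fun d => g1 _ _ d (by grind) (by grind)
  have k2 : ∀ d, x' q₂ q₃ d = x q₂ q₃ d := fun d => g1 _ _ d (by grind) (by grind)
  have k3 : ∀ d, x' q₃ z d = x q₃ z d := fun d => g1 _ _ d (by grind) (by grind)
  obtain ⟨x'', hx'', -, -, -⟩ := hx'.exists_add_chord (z := z) (a := q₁) (b := q₂)
    (R := [q₃, z]) (ω := ω)
    (by
      rintro a (h | h | h)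
      · exact hirr a h
      · grind
      · grind)
    (by
      rintro a b (h | h | h)
      · exact Or.inl (hsym _ _ h)
      · grind
      · grind)
    (by simp) (by simp [h₂]) (by simp [h₃, h₄]) (by simp) (by simp; grind) (by grind)
    (by
      intro d hd hd'
      simp only [List.mem_cons, List.not_mem_nil, or_false] at hd'
      rcases hd' with rfl | rfl | rfl
      · exact Or.inr rfl
      · grind
      · exact Or.inl rfl)
    (by
      intro d hd hd'
      simp only [List.mem_cons, List.not_mem_nil, or_false] at hd'
      have hd1 : E q₁ d := by grind
      have hdq : d ≠ q₁ := fun h => hirr q₁ (h ▸ hd1)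
      by_cases hdq0 : d = q₀
      · subst hdq0
        simp only [winding] at g3 ⊢
        rw [g3, k1, k2, k3]
        grind
      · have := hW q₁ d hd1 (by simp; tauto)
        simp only [winding] at this ⊢
        rw [g2 d hdq0, k1, k2, k3]
        grind)
  refine Planar.mono ⟨s, x'', hx''⟩ ?_
  intro a b hab
  grind

/-- Among three common neighbours of two adjacent vertices, one triangle separates the other
two. -/
theorem PD.triple_winding (h : PD E s x) {z v y1 y2 y3 : V} (h1 : E v y1) (h2 : E v y2)
    (h3 : E v y3) (k1 : E z y1) (k2 : E z y2) (k3 : E z y3) (nd : [z, v, y1, y2, y3].Nodup) :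
    winding x [z, v, y1, z] y2 + winding x [z, v, y1, z] y3 + winding x [z, v, y2, z] y1 +
      winding x [z, v, y2, z] y3 + winding x [z, v, y3, z] y1 + winding x [z, v, y3, z] y2 = 1 := by
  simp only [List.nodup_cons, List.mem_cons, List.not_mem_nil, or_false, not_or] at nd
  have e12 := h.eqn v y1 z y2
  have e13 := h.eqn v y1 z y3
  have e21 := h.eqn v y2 z y1
  have e23 := h.eqn v y2 z y3
  have e31 := h.eqn v y3 z y1
  have e32 := h.eqn v y3 z y2
  have a1 := h.anti y1 y2
  have a2 := h.anti y1 y3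
  have a3 := h.anti y2 y3
  simp only [winding, h.symm _ z]
  grind

/-- In a theta graph with poles `p`, `r` and paths `p a r`, `p b b' r`, `p c c' r`, one of the
three cycles separates the third path. -/
theorem PD.theta_winding (h : PD E s x) {p r a b b' c c' : V} (nd : [p, r, a, b, b', c, c'].Nodup)
    (pa : E p a) (ar : E a r) (pb : E p b) (bb : E b b') (br : E b' r) (pc : E p c)
    (cc : E c c') (cr : E c' r) :
    winding x [p, b, b', r, c', c, p] a + winding x [p, a, r, b', b, p] c +
      winding x [p, a, r, c', c, p] b = 1 := by
  simp only [List.nodup_cons, List.mem_cons, List.not_mem_nil, or_false, not_or] at nd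
  have e1 := h.eqn p c b' r pc br
  have e2 := h.eqn p b a r pb ar
  have e3 := h.eqn p c a r pc ar
  have e4 := h.eqn p c b b' pc bb
  have e5 := h.eqn p a b' r pa br
  have e6 := h.eqn p a c' r pa cr
  have e7 := h.eqn p a b b' pa bb
  have e8 := h.eqn p a c c' pa cc
  have e9 := h.eqn p b c' r pb cr
  have e10 := h.eqn p b c c' pb cc
  have a1 := h.anti a b
  have a2 := h.anti a c
  have a3 := h.anti b c
  have a4 := h.anti p r
  have a5 := h.anti p b'
  have a6 := h.anti p c'
  have a7 := h.anti a r
  have a8 := h.anti a b'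
  have a9 := h.anti a c'
  have a10 := h.anti b r
  have a11 := h.anti c r
  have a12 := h.anti b c'
  have a13 := h.anti c b'
  simp only [winding, h.symm _ p, h.symm r, h.symm b' b, h.symm c' c] at *
  grind

theorem winding_theta_add (h : PD E s x) (p r a b b' c c' w : V) :
    winding x [p, b, b', r, c', c, p] w + winding x [p, a, r, b', b, p] w +
      winding x [p, a, r, c', c, p] w = 0 := by
  simp only [winding]
  have := h.symm
  grind

end Parity

section Discs

variable {V : Type} [DecidableEq V] {Γ : SimpleGraph V} {z : V} {S B : Finset V}
  {s : V → V → ZMod 2} {x : V → V → V → ZMod 2}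

/-- There are no cycles of length three or four. -/
structure GirthFive (Γ : SimpleGraph V) : Prop where
  no_three : ∀ a b c, Γ.Adj a b → Γ.Adj b c → Γ.Adj c a → False
  no_four : ∀ a b c d, Γ.Adj a b → Γ.Adj b c → Γ.Adj c d → Γ.Adj d a → a = c ∨ b = d

/-- The graph induced on `S` together with an apex `z` joined to all of `B`. -/
def Apex (Γ : SimpleGraph V) (z : V) (S B : Finset V) (a b : V) : Prop :=
  (a ∈ S ∧ b ∈ S ∧ Γ.Adj a b) ∨ (a = z ∧ b ∈ B) ∨ (b = z ∧ a ∈ B)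

/-- `Γ` induced on `S` can be drawn in a disc with `B` on the boundary; the apex `z` stands for
the outside of the disc. -/
structure Disc (Γ : SimpleGraph V) (z : V) (S B : Finset V) : Prop where
  planar : Planar (Apex Γ z S B)
  apex : z ∉ S
  sub : B ⊆ S

theorem apex_symm (a b : V) (h : Apex Γ z S B a b) : Apex Γ z S B b a := by
  unfold Apex at *
  have := Γ.adj_comm a b
  tauto

theorem apex_irrefl (hz : z ∉ B) (a : V) : ¬ Apex Γ z S B a a := by
  rintro (h | h | h)
  · exact Γ.irrefl h.2.2
  · exact hz (h.1 ▸ h.2)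
  · exact hz (h.1 ▸ h.2)

theorem Disc.apex_notMem (h : Disc Γ z S B) : z ∉ B := fun hz => h.apex (h.sub hz)

theorem Disc.mono (h : Disc Γ z S B) {S' B' : Finset V} (hS : S' ⊆ S) (hB : B' ⊆ B)
    (hBS : B' ⊆ S') : Disc Γ z S' B' := by
  refine ⟨h.planar.mono ?_, fun hz => h.apex (hS hz), hBS⟩
  intro a b hab
  have h1 := @hS
  have h2 := @hB
  unfold Apex at *
  grind

theorem Disc.contract (h : Disc Γ z S B) {v : V} (hv : v ∈ B) {S' B' : Finset V}
    (hS : S' ⊆ S.erase v) (hB : B' ⊆ S') (hN : ∀ u ∈ B', u ∈ B ∨ Γ.Adj v u) :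
    Disc Γ z S' B' := by
  have hzv : z ≠ v := fun e => h.apex_notMem (e ▸ hv)
  refine ⟨(h.planar.contract (z := z) (v := v) (Or.inr (Or.inl ⟨rfl, hv⟩))).mono ?_, ?_, hB⟩
  · intro a b hab
    have h1 := @hS
    have h2 := @hB
    have h3 := Γ.adj_comm a b
    have h4 := h.apex
    have h5 := h.sub hv
    unfold Apex at *
    grind
  · intro hz
    exact h.apex (Finset.mem_of_mem_erase (hS hz))

/-- A path of the disc with both ends on the boundary. -/
structure Chord (Γ : SimpleGraph V) (S B : Finset V) (Q : List V) : Prop where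
  ne : Q ≠ []
  nd : Q.Nodup
  chain : Q.IsChain Γ.Adj
  sub : ∀ q ∈ Q, q ∈ S
  head : ∀ q ∈ Q.head?, q ∈ B
  last : ∀ q ∈ Q.getLast?, q ∈ B

/-- The side of the chord `Q` on which a vertex lies. -/
def side (x : V → V → V → ZMod 2) (z : V) (Q : List V) (d : V) : ZMod 2 :=
  winding x (z :: (Q ++ [z])) d

theorem Chord.isChain {Q : List V} (h : Chord Γ S B Q) :
    (z :: (Q ++ [z])).IsChain (Apex Γ z S B) := by
  rw [List.isChain_cons, List.isChain_append]
  refine ⟨?_, ?_, by simp, ?_⟩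
  · intro y hy
    rw [List.head?_append_of_ne_nil _ h.ne] at hy
    exact Or.inr (Or.inl ⟨rfl, h.head y hy⟩)
  · exact h.chain.imp_of_mem_imp fun a b ha hb hab => Or.inl ⟨h.sub a ha, h.sub b hb, hab⟩
  · intro y hy w hw
    simp only [List.head?_cons, Option.mem_def, Option.some.injEq] at hw
    exact Or.inr (Or.inr ⟨hw.symm, h.last y hy⟩)

theorem Chord.side_eq {Q : List V} (hx : PD (Apex Γ z S B) s x) (hz : z ∉ S)
    (h : Chord Γ S B Q) {c d : V} (hcd : Γ.Adj c d) (hc : c ∈ S) (hd : d ∈ S) (hcQ : c ∉ Q)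
    (hdQ : d ∉ Q) : side x z Q c = side x z Q d := by
  have h1 : c ≠ z := fun e => hz (e ▸ hc)
  have h2 : d ≠ z := fun e => hz (e ▸ hd)
  refine winding_eq_of_adj hx (Or.inl ⟨hc, hd, hcd⟩) z _ h.isChain ?_ ?_ ?_
  · simp [h1, hcQ]
  · simp [h2, hdQ]
  · simp

theorem Chord.side_eq_of_chain {Q : List V} (hx : PD (Apex Γ z S B) s x) (hz : z ∉ S)
    (h : Chord Γ S B Q) {l : List V} (hl : l.IsChain Γ.Adj) (hS : ∀ v ∈ l, v ∈ S)
    (hQ : ∀ v ∈ l, v ∉ Q) : ∀ u ∈ l, ∀ v ∈ l, side x z Q u = side x z Q v := by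
  induction l with
  | nil => simp
  | cons a l ih =>
    cases l with
    | nil => simp
    | cons b l =>
      rw [List.isChain_cons_cons] at hl
      have ih' := ih hl.2 (fun v hv => hS v (by simp [hv])) (fun v hv => hQ v (by simp [hv]))
      have hab := h.side_eq hx hz hl.1 (hS a (by simp)) (hS b (by simp)) (hQ a (by simp))
        (hQ b (by simp))
      intro u hu v hv
      have h1 : ∀ w ∈ a :: b :: l, side x z Q w = side x z Q b := by
        intro w hw
        rcases List.mem_cons.1 hw with rfl | hw
        · exact hab
        · exact ih' _ hw _ (by simp)
      rw [h1 u hu, h1 v hv]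

/-- Cutting a disc along a short chord. -/
theorem Chord.disc {Q : List V} (hΓ : GirthFive Γ) (hD : Disc Γ z S B)
    (hx : PD (Apex Γ z S B) s x) (h : Chord Γ S B Q) (hlen : 2 ≤ Q.length) (hlen' : Q.length ≤ 4)
    {ω : ZMod 2} {S' B' : Finset V} (hS : S' ⊆ S) (hQ : ∀ q ∈ Q, q ∈ S')
    (hω : ∀ d ∈ S', d ∉ Q → side x z Q d = ω) (hB : ∀ b ∈ B', b ∈ B ∨ b ∈ Q) (hBS : B' ⊆ S') :
    Disc Γ z S' B' := by
  refine ⟨?_, fun hz => hD.apex (hS hz), hBS⟩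
  have hzB := hD.apex_notMem
  have hz := hD.apex
  have hz' : z ∉ S' := fun h => hz (hS h)
  have hmono : ∀ a b, Apex Γ z S' (B ∩ S') a b → Apex Γ z S B a b := by
    intro a b hab
    have h1 := @hS
    unfold Apex at *
    grind
  have hx' : PD (Apex Γ z S' (B ∩ S')) s x :=
    ⟨hx.anti, hx.symm, fun a b c d hab hcd => hx.eqn a b c d (hmono _ _ hab) (hmono _ _ hcd)⟩
  have hirr := apex_irrefl (Γ := Γ) (z := z) (S := S') (B := B ∩ S') (by simp [hzB])
  have hsym := apex_symm (Γ := Γ) (z := z) (S := S') (B := B ∩ S')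
  have hsub := h.sub
  have hmem : ∀ c d, Apex Γ z S' (B ∩ S') c d → d ∈ S' ∨ d = z := by
    intro c d hcd
    unfold Apex at hcd
    grind
  match Q, h, hlen, hlen' with
  | [u, w], h, _, _ =>
    have := h.head
    have := h.last
    exact (hD.mono hS (B' := B') (by intro b hb; have := hB b hb; simp at *; grind) hBS).planar
  | [q₀, q₁, q₂], h, _, _ =>
    have hc := h.chain
    have nd := h.nd
    have e0 := h.head q₀ rfl
    have e2 := h.last q₂ rfl
    simp only [List.mem_cons, List.not_mem_nil, or_false, forall_eq_or_imp, forall_eq] at hQ hsub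
    simp only [List.isChain_cons_cons, List.isChain_singleton, and_true] at hc
    have nz : ∀ q ∈ [q₀, q₁, q₂], z ≠ q := by
      intro q hq e
      exact hz (e ▸ h.sub q hq)
    refine (hx'.fan_four (z := z) (q₀ := q₀) (q₁ := q₁) (q₂ := q₂) (ω := ω) hirr hsym
      ?_ ?_ ?_ ?_ ?_ ?_
      ?_).mono ?_
    · simp only [List.nodup_cons, List.mem_cons] at nd nz ⊢
      grind
    · exact Or.inr (Or.inl ⟨rfl, by simp [e0, hQ]⟩)
    · exact Or.inl ⟨hQ.1, hQ.2.1, hc.1⟩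
    · exact Or.inl ⟨hQ.2.1, hQ.2.2, hc.2⟩
    · exact Or.inr (Or.inr ⟨rfl, by simp [e2, hQ]⟩)
    · rintro (h | h | h)
      · exact hΓ.no_three _ _ _ hc.1 hc.2 h.2.2.symm
      · exact nz q₀ (by simp) h.1.symm
      · exact nz q₂ (by simp) h.1.symm
    · intro c d hcd hd
      simp only [List.mem_cons, not_or] at hd
      refine hω d ?_ (by simp; tauto)
      have := hmem c d hcd
      tauto
    · intro a b hab
      have h1 := @hBS
      simp only [List.mem_cons, List.not_mem_nil, or_false] at hB
      unfold Apex at *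
      grind
  | [q₀, q₁, q₂, q₃], h, _, _ =>
    have hc := h.chain
    have nd := h.nd
    have e0 := h.head q₀ rfl
    have e3 := h.last q₃ rfl
    simp only [List.mem_cons, List.not_mem_nil, or_false, forall_eq_or_imp, forall_eq] at hQ hsub
    simp only [List.isChain_cons_cons, List.isChain_singleton, and_true] at hc
    have nz : ∀ q ∈ [q₀, q₁, q₂, q₃], z ≠ q := by
      intro q hq e
      exact hz (e ▸ h.sub q hq)
    refine (hx'.fan_five (z := z) (q₀ := q₀) (q₁ := q₁) (q₂ := q₂) (q₃ := q₃) (ω := ω) hirr hsym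
      ?_ ?_ ?_ ?_ ?_ ?_ ?_ ?_ ?_ ?_).mono ?_
    · simp only [List.nodup_cons, List.mem_cons] at nd nz ⊢
      grind
    · exact Or.inr (Or.inl ⟨rfl, by simp [e0, hQ]⟩)
    · exact Or.inl ⟨hQ.1, hQ.2.1, hc.1⟩
    · exact Or.inl ⟨hQ.2.1, hQ.2.2.1, hc.2.1⟩
    · exact Or.inl ⟨hQ.2.2.1, hQ.2.2.2, hc.2.2⟩
    · exact Or.inr (Or.inr ⟨rfl, by simp [e3, hQ]⟩)
    · rintro (h | h | h)
      · exact hΓ.no_three _ _ _ hc.1 hc.2.1 h.2.2.symm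
      · exact nz q₀ (by simp) h.1.symm
      · exact nz q₂ (by simp) h.1.symm
    · rintro (h | h | h)
      · rcases hΓ.no_four _ _ _ _ hc.1 hc.2.1 hc.2.2 h.2.2.symm with e | e
        · simp [e] at nd
        · simp [e] at nd
      · exact nz q₀ (by simp) h.1.symm
      · exact nz q₃ (by simp) h.1.symm
    · rintro (h | h | h)
      · exact hΓ.no_three _ _ _ hc.2.1 hc.2.2 h.2.2.symm
      · exact nz q₁ (by simp) h.1.symm
      · exact nz q₃ (by simp) h.1.symm
    · intro c d hcd hd
      simp only [List.mem_cons, not_or] at hd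
      refine hω d ?_ (by simp; tauto)
      have := hmem c d hcd
      tauto
    · intro a b hab
      have h1 := @hBS
      simp only [List.mem_cons, List.not_mem_nil, or_false] at hB
      unfold Apex at *
      grind

/-- Cutting along a five-cycle of the disc and declaring one of its vertices the new outside. -/
theorem PD.disc_of_pentagon (hΓ : GirthFive Γ) (hx : PD (Apex Γ z S B) s x)
    {c₀ c₁ c₂ c₃ c₄ : V} (nd : [c₀, c₁, c₂, c₃, c₄].Nodup)
    (hS : ∀ c ∈ [c₀, c₁, c₂, c₃, c₄], c ∈ S) (h₀ : Γ.Adj c₀ c₁) (h₁ : Γ.Adj c₁ c₂)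
    (h₂ : Γ.Adj c₂ c₃) (h₃ : Γ.Adj c₃ c₄) (h₄ : Γ.Adj c₄ c₀) {ω : ZMod 2} {S' B' : Finset V}
    (hS' : S' ⊆ S.erase c₀) (hω : ∀ d ∈ S', d ∉ [c₀, c₁, c₂, c₃, c₄] →
      winding x [c₀, c₁, c₂, c₃, c₄, c₀] d = ω)
    (hB : ∀ b ∈ B', Γ.Adj c₀ b ∨ b = c₂ ∨ b = c₃) (hBS : B' ⊆ S') :
    Disc Γ c₀ S' B' := by
  refine ⟨?_, fun hz => by simpa using hS' hz, hBS⟩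
  let E : V → V → Prop := fun a b => Γ.Adj a b ∧ (a ∈ S' ∨ a ∈ [c₀, c₁, c₂, c₃, c₄]) ∧
    (b ∈ S' ∨ b ∈ [c₀, c₁, c₂, c₃, c₄])
  have hmono : ∀ a b, E a b → Apex Γ z S B a b := by
    rintro a b ⟨h, ha, hb⟩
    refine Or.inl ⟨?_, ?_, h⟩
    · exact ha.elim (fun h => Finset.mem_of_mem_erase (hS' h)) (hS a)
    · exact hb.elim (fun h => Finset.mem_of_mem_erase (hS' h)) (hS b)
  have hx' : PD E s x :=
    ⟨hx.anti, hx.symm, fun a b c d hab hcd => hx.eqn a b c d (hmono _ _ hab) (hmono _ _ hcd)⟩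
  refine (hx'.fan_five (z := c₀) (q₀ := c₁) (q₁ := c₂) (q₂ := c₃) (q₃ := c₄) (ω := ω)
    (fun a h => Γ.irrefl h.1) (fun a b h => ⟨h.1.symm, h.2.2, h.2.1⟩) nd
    ⟨h₀, by simp, by simp⟩ ⟨h₁, by simp, by simp⟩ ⟨h₂, by simp, by simp⟩ ⟨h₃, by simp, by simp⟩
    ⟨h₄, by simp, by simp⟩ ?_ ?_ ?_ ?_).mono ?_
  · exact fun h => hΓ.no_three _ _ _ h₁ h₂ h.1.symm
  · exact fun h => hΓ.no_three _ _ _ h₀ h.1 h₄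
  · exact fun h => hΓ.no_three _ _ _ h₂ h₃ h.1.symm
  · rintro c d ⟨-, -, hd⟩ hd'
    exact hω d (hd.resolve_right hd') hd'
  · intro a b hab
    have h1 := @hBS
    have h2 := Γ.adj_comm a b
    simp only [E]
    unfold Apex at hab
    simp only [List.mem_cons, List.not_mem_nil, or_false]
    grind

end Discs

section Configurations

variable {V : Type} [DecidableEq V] {Γ : SimpleGraph V} {z : V} {S B : Finset V}
  {L : V → Finset ℕ} {p : List V} {φ : V → ℕ}
  {s : V → V → ZMod 2} {x : V → V → V → ZMod 2}

/-- The vertices outside the precoloured path with fewer than three colours. -/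
def Two (S : Finset V) (L : V → Finset ℕ) (p : List V) (v : V) : Prop :=
  v ∈ S ∧ v ∉ p ∧ (L v).card < 3

/-- The end `o` of a path has no neighbour satisfying `T`. -/
def FreeEnd (Γ : SimpleGraph V) (T : V → Prop) (o : Option V) : Prop :=
  ∀ u ∈ o, ∀ v, T v → ¬ Γ.Adj u v

/-- The bound on the number of vertices of a precoloured path. -/
def Weight (Γ : SimpleGraph V) (T : V → Prop) (p : List V) : Prop :=
  p.length ≤ 4 ∨ (p.length ≤ 5 ∧ (FreeEnd Γ T p.head? ∨ FreeEnd Γ T p.getLast?)) ∨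
    (p.length ≤ 6 ∧ FreeEnd Γ T p.head? ∧ FreeEnd Γ T p.getLast?)

theorem FreeEnd.mono {T T' : V → Prop} {o : Option V} (h : FreeEnd Γ T o)
    (hT : ∀ v, T' v → T v) : FreeEnd Γ T' o :=
  fun u hu v hv => h u hu v (hT v hv)

theorem Weight.mono {T T' : V → Prop} (h : Weight Γ T p) (hT : ∀ v, T' v → T v) :
    Weight Γ T' p := by
  rcases h with h | ⟨h, h'⟩ | ⟨h, h', h''⟩
  · exact Or.inl h
  · exact Or.inr (Or.inl ⟨h, h'.imp (·.mono hT) (·.mono hT)⟩)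
  · exact Or.inr (Or.inr ⟨h, h'.mono hT, h''.mono hT⟩)

theorem Weight.reverse {T : V → Prop} (h : Weight Γ T p) : Weight Γ T p.reverse := by
  unfold Weight at *
  simp only [List.length_reverse, List.head?_reverse, List.getLast?_reverse]
  tauto

theorem Weight.length_le {T : V → Prop} (h : Weight Γ T p) : p.length ≤ 6 := by
  unfold Weight at h
  omega

theorem Weight.of_append {T : V → Prop} {l₁ l₂ : List V} (h : Weight Γ T (l₁ ++ l₂)) :
    Weight Γ T l₁ := by
  by_cases h2 : l₂ = []
  · simpa [h2] using h
  by_cases h1 : l₁ = []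
  · simp [h1, Weight]
  have : 0 < l₂.length := List.length_pos_iff.2 h2
  unfold Weight at *
  rw [List.head?_append_of_ne_nil _ h1, List.length_append] at h
  by_cases h5 : l₁.length ≤ 4
  · exact Or.inl h5
  · exact Or.inr (Or.inl ⟨by omega, Or.inl (by
      rcases h with h | h | h
      · omega
      · omega
      · exact h.2.1)⟩)

theorem Weight.suffix {T : V → Prop} {l₁ l₂ : List V} (h : Weight Γ T (l₁ ++ l₂)) :
    Weight Γ T l₂ := by
  have := h.reverse
  rw [List.reverse_append] at this
  simpa using this.of_append.reverse

/-- The configurations of the induction: a plane graph in a disc whose boundary carries a short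
precoloured path and an independent set of vertices with two colours. -/
structure Cfg (Γ : SimpleGraph V) (z : V) (S B : Finset V) (L : V → Finset ℕ) (p : List V)
    (φ : V → ℕ) : Prop where
  disc : Disc Γ z S B
  sub : ∀ v ∈ p, v ∈ B
  nodup : p.Nodup
  chain : p.IsChain Γ.Adj
  proper : ∀ u ∈ p, ∀ v ∈ p, Γ.Adj u v → φ u ≠ φ v
  two_le : ∀ v ∈ S, v ∉ p → 2 ≤ (L v).card
  three_le : ∀ v ∈ S, v ∉ B → 3 ≤ (L v).card
  indep : ∀ u v, Two S L p u → Two S L p v → ¬ Γ.Adj u v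
  avail : ∀ v, Two S L p v → ∃ c ∈ L v, ∀ u ∈ p, Γ.Adj v u → c ≠ φ u
  weight : Weight Γ (Two S L p) p

/-- The precolouring `φ` of `p` extends to a list colouring on `S`. -/
def Extends (Γ : SimpleGraph V) (S : Finset V) (L : V → Finset ℕ) (p : List V) (φ : V → ℕ) :
    Prop :=
  ∃ ψ : V → ℕ, (∀ v ∈ p, ψ v = φ v) ∧ (∀ v ∈ S, v ∉ p → ψ v ∈ L v) ∧
    ∀ u ∈ S, ∀ v ∈ S, Γ.Adj u v → ψ u ≠ ψ v

theorem Cfg.reverse (h : Cfg Γ z S B L p φ) : Cfg Γ z S B L p.reverse φ where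
  disc := h.disc
  sub := by simpa using h.sub
  nodup := List.nodup_reverse.2 h.nodup
  chain := by
    rw [List.isChain_reverse]
    exact h.chain.imp fun a b hab => hab.symm
  proper := by simpa using h.proper
  two_le := by simpa using h.two_le
  three_le := h.three_le
  indep := by simpa [Two] using h.indep
  avail := by simpa [Two] using h.avail
  weight := h.weight.reverse.mono (by simp [Two])

/-- A configuration that does not extend, minimal with respect to the number of vertices and
then the number of vertices off the path and off the boundary. -/
structure MinCE (Γ : SimpleGraph V) (z : V) (S B : Finset V) (L : V → Finset ℕ) (p : List V)
    (φ : V → ℕ) : Prop extends Cfg Γ z S B L p φ where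
  girth : GirthFive Γ
  smaller : ∀ z' S' B' L' p' φ', S'.card < S.card → Cfg Γ z' S' B' L' p' φ' →
    Extends Γ S' L' p' φ'
  finer : ∀ B' p' φ', (S.filter (· ∉ B')).card + (S.filter (· ∉ p')).card <
    (S.filter (· ∉ B)).card + (S.filter (· ∉ p)).card → Cfg Γ z S B' L p' φ' →
    Extends Γ S L p' φ'
  not_extends : ¬ Extends Γ S L p φ

theorem MinCE.reverse (M : MinCE Γ z S B L p φ) : MinCE Γ z S B L p.reverse φ where
  toCfg := M.toCfg.reverse
  girth := M.girth
  smaller := M.smaller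
  finer := by simpa using M.finer
  not_extends := by simpa [Extends] using M.not_extends

theorem Two.mem_boundary (M : MinCE Γ z S B L p φ) {v : V} (h : Two S L p v) : v ∈ B := by
  by_contra hv
  have := M.three_le v h.1 hv
  have := h.2.2
  omega

theorem MinCE.mem_S (M : MinCE Γ z S B L p φ) {v : V} (h : v ∈ p) : v ∈ S :=
  M.disc.sub (M.sub v h)

/-- Colouring first one side of a chord and then the other. -/
theorem MinCE.split (M : MinCE Γ z S B L p φ) (hx : PD (Apex Γ z S B) s x) {Q : List V}
    (hQ : Chord Γ S B Q) (hlen : 2 ≤ Q.length) (hlen' : Q.length ≤ 4) (ω : ZMod 2)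
    {p₁ p₂ : List V} (m₁ : ∀ v, v ∈ p₁ ↔ v ∈ p ∧ (v ∈ Q ∨ side x z Q v = ω)) (nd₁ : p₁.Nodup)
    (ch₁ : p₁.IsChain Γ.Adj) (w₁ : Weight Γ (Two S L p) p₁)
    (m₂ : ∀ v, v ∈ p₂ ↔ v ∈ Q ∨ (v ∈ p ∧ side x z Q v ≠ ω)) (nd₂ : p₂.Nodup)
    (ch₂ : p₂.IsChain Γ.Adj) (w₂ : Weight Γ (Two S L p) p₂)
    (cross : ∀ u ∈ Q, u ∉ p → ∀ v ∈ p, v ∉ Q → side x z Q v ≠ ω → ¬ Γ.Adj u v)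
    (avail : ∀ v, Two S L p v → v ∉ Q → side x z Q v ≠ ω →
      (∀ u ∈ Q, u ∉ p → ¬ Γ.Adj v u) ∨ ∃ q, ∀ u ∈ p₂, Γ.Adj v u → u = q)
    (ne₁ : ∃ d ∈ S, d ∉ Q ∧ side x z Q d = ω) (ne₂ : ∃ d ∈ S, d ∉ Q ∧ side x z Q d ≠ ω) :
    False := by
  classical
  let S₁ := S.filter (fun d => d ∈ Q ∨ side x z Q d = ω)
  let S₂ := S.filter (fun d => d ∈ Q ∨ side x z Q d ≠ ω)
  have hS₁ : ∀ v, v ∈ S₁ ↔ v ∈ S ∧ (v ∈ Q ∨ side x z Q v = ω) := by simp [S₁]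
  have hS₂ : ∀ v, v ∈ S₂ ↔ v ∈ S ∧ (v ∈ Q ∨ side x z Q v ≠ ω) := by simp [S₂]
  have hc₁ : S₁.card < S.card := by
    refine Finset.card_lt_card ⟨Finset.filter_subset _ _, ?_⟩
    obtain ⟨d, hd, h1, h2⟩ := ne₂
    intro h
    have := (hS₁ d).1 (h hd)
    tauto
  have hc₂ : S₂.card < S.card := by
    refine Finset.card_lt_card ⟨Finset.filter_subset _ _, ?_⟩
    obtain ⟨d, hd, h1, h2⟩ := ne₁
    intro h
    have := (hS₂ d).1 (h hd)
    tauto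
  have hpS : ∀ v ∈ p, v ∈ S := fun v hv => M.mem_S hv
  have t₁ : ∀ v, Two S₁ L p₁ v → Two S L p v := by
    rintro v ⟨h1, h2, h3⟩
    rw [hS₁] at h1
    rw [m₁] at h2
    exact ⟨h1.1, fun h => h2 ⟨h, h1.2⟩, h3⟩
  have e₁ : Extends Γ S₁ L p₁ φ := by
    refine M.smaller z S₁ ((B ∪ Q.toFinset) ∩ S₁) L p₁ φ hc₁ ⟨?_, ?_, nd₁, ch₁, ?_, ?_, ?_, ?_,
      ?_, w₁.mono t₁⟩
    · refine hQ.disc M.girth M.disc hx hlen hlen' (ω := ω) (Finset.filter_subset _ _) ?_ ?_ ?_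
        Finset.inter_subset_right
      · exact fun q hq => (hS₁ q).2 ⟨hQ.sub q hq, Or.inl hq⟩
      · exact fun d hd hdQ => ((hS₁ d).1 hd).2.resolve_left hdQ
      · intro b hb
        simpa using (Finset.mem_inter.1 hb).1
    · intro v hv
      have := (m₁ v).1 hv
      simp [hS₁, M.sub v this.1, hpS v this.1, this.2]
    · exact fun u hu v hv => M.proper u ((m₁ u).1 hu).1 v ((m₁ v).1 hv).1
    · intro v hv hv'
      rw [hS₁] at hv
      exact M.two_le v hv.1 fun h => hv' ((m₁ v).2 ⟨h, hv.2⟩)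
    · intro v hv hv'
      exact M.three_le v ((hS₁ v).1 hv).1 fun h => hv' (by simp [h, hv])
    · exact fun u v hu hv => M.indep u v (t₁ u hu) (t₁ v hv)
    · intro v hv
      obtain ⟨c, hc, h⟩ := M.avail v (t₁ v hv)
      exact ⟨c, hc, fun u hu => h u ((m₁ u).1 hu).1⟩
  obtain ⟨ψ₁, a1, a2, a3⟩ := e₁
  let φ₂ : V → ℕ := fun v => if v ∈ Q then ψ₁ v else φ v
  have hφ₂ : ∀ v ∈ p, φ₂ v = φ v := by
    intro v hv
    by_cases h : v ∈ Q
    · simp only [φ₂, h, if_true]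
      exact a1 v ((m₁ v).2 ⟨hv, Or.inl h⟩)
    · simp [φ₂, h]
  have t₂ : ∀ v, Two S₂ L p₂ v → Two S L p v ∧ v ∉ Q ∧ side x z Q v ≠ ω := by
    rintro v ⟨h1, h2, h3⟩
    rw [hS₂] at h1
    rw [m₂] at h2
    have hvQ : v ∉ Q := fun h => h2 (Or.inl h)
    have := h1.2.resolve_left hvQ
    exact ⟨⟨h1.1, fun h => h2 (Or.inr ⟨h, this⟩), h3⟩, hvQ, this⟩
  have hQS₁ : ∀ q ∈ Q, q ∈ S₁ := fun q hq => (hS₁ q).2 ⟨hQ.sub q hq, Or.inl hq⟩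
  have e₂ : Extends Γ S₂ L p₂ φ₂ := by
    refine M.smaller z S₂ ((B ∪ Q.toFinset) ∩ S₂) L p₂ φ₂ hc₂ ⟨?_, ?_, nd₂, ch₂, ?_, ?_, ?_, ?_,
      ?_, w₂.mono fun v hv => (t₂ v hv).1⟩
    · refine hQ.disc M.girth M.disc hx hlen hlen' (ω := ω + 1) (Finset.filter_subset _ _) ?_ ?_ ?_
        Finset.inter_subset_right
      · exact fun q hq => (hS₂ q).2 ⟨hQ.sub q hq, Or.inl hq⟩
      · intro d hd hdQ
        have := ((hS₂ d).1 hd).2.resolve_left hdQ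
        generalize side x z Q d = y at *
        revert this
        clear * -
        revert y ω
        decide
      · intro b hb
        simpa using (Finset.mem_inter.1 hb).1
    · intro v hv
      rcases (m₂ v).1 hv with h | h
      · simp [hS₂, h, hQ.sub v h]
      · simp [hS₂, M.sub v h.1, hpS v h.1, h.2]
    · intro u hu v hv huv
      by_cases huQ : u ∈ Q
      · by_cases hvQ : v ∈ Q
        · simp only [φ₂, huQ, hvQ, if_true]
          exact a3 u (hQS₁ u huQ) v (hQS₁ v hvQ) huv
        · have hv' := ((m₂ v).1 hv).resolve_left hvQ
          by_cases hup : u ∈ p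
          · rw [hφ₂ u hup, hφ₂ v hv'.1]
            exact M.proper u hup v hv'.1 huv
          · exact absurd huv (cross u huQ hup v hv'.1 hvQ hv'.2)
      · have hu' := ((m₂ u).1 hu).resolve_left huQ
        by_cases hvp : v ∈ p
        · rw [hφ₂ u hu'.1, hφ₂ v hvp]
          exact M.proper u hu'.1 v hvp huv
        · have hvQ : v ∈ Q := by
            rcases (m₂ v).1 hv with h | h
            · exact h
            · exact absurd h.1 hvp
          exact absurd huv.symm (cross v hvQ hvp u hu'.1 huQ hu'.2)
    · intro v hv hv'
      rw [hS₂] at hv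
      refine M.two_le v hv.1 fun h => hv' ((m₂ v).2 ?_)
      have := hv.2
      tauto
    · intro v hv hv'
      exact M.three_le v ((hS₂ v).1 hv).1 fun h => hv' (by simp [h, hv])
    · exact fun u v hu hv => M.indep u v (t₂ u hu).1 (t₂ v hv).1
    · intro v hv
      obtain ⟨h1, h2, h3⟩ := t₂ v hv
      rcases avail v h1 h2 h3 with h | ⟨q, hq⟩
      · obtain ⟨c, hc, hc'⟩ := M.avail v h1
        refine ⟨c, hc, fun u hu huv => ?_⟩
        have hup : u ∈ p := by
          by_contra hup
          rcases (m₂ u).1 hu with h' | h'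
          · exact h u h' hup huv
          · exact hup h'.1
        rw [hφ₂ u hup]
        exact hc' u hup huv
      · have h4 := M.two_le v h1.1 h1.2.1
        obtain ⟨c, hc⟩ : ((L v).erase (φ₂ q)).Nonempty := by
          rw [← Finset.card_pos]
          have := Finset.pred_card_le_card_erase (s := L v) (a := φ₂ q)
          omega
        refine ⟨c, Finset.mem_of_mem_erase hc, fun u hu huv => ?_⟩
        rw [hq u hu huv]
        exact Finset.ne_of_mem_erase hc
  obtain ⟨ψ₂, b1, b2, b3⟩ := e₂
  have hQ₂ : ∀ q ∈ Q, ψ₂ q = ψ₁ q := by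
    intro q hq
    rw [b1 q ((m₂ q).2 (Or.inl hq))]
    simp [φ₂, hq]
  refine M.not_extends ⟨fun v => if v ∈ S₁ then ψ₁ v else ψ₂ v, ?_, ?_, ?_⟩
  · intro v hv
    by_cases h : v ∈ S₁
    · simp only [h, if_true]
      exact a1 v ((m₁ v).2 ⟨hv, ((hS₁ v).1 h).2⟩)
    · simp only [h, if_false]
      have : v ∈ p₂ := by
        have h' := hS₁ v
        rw [m₂]
        have := hpS v hv
        tauto
      rw [b1 v this, hφ₂ v hv]
  · intro v hv hvp
    by_cases h : v ∈ S₁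
    · simp only [h, if_true]
      exact a2 v h fun h' => hvp ((m₁ v).1 h').1
    · simp only [h, if_false]
      have h' := hS₁ v
      refine b2 v ((hS₂ v).2 ⟨hv, by tauto⟩) fun h'' => ?_
      rw [m₂] at h''
      tauto
  · have main : ∀ u ∈ S, ∀ v ∈ S, Γ.Adj u v → u ∈ S₁ → v ∉ S₁ → ψ₁ u ≠ ψ₂ v := by
      intro u hu v hv huv hu1 hv1
      have hv' : v ∉ Q ∧ side x z Q v ≠ ω := by
        have := hS₁ v
        tauto
      have huQ : u ∈ Q := by
        by_contra huQ
        have h1 := ((hS₁ u).1 hu1).2.resolve_left huQ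
        have h2 := hQ.side_eq hx M.disc.apex huv hu hv huQ hv'.1
        exact hv'.2 (h2 ▸ h1)
      rw [← hQ₂ u huQ]
      exact b3 u ((hS₂ u).2 ⟨hu, Or.inl huQ⟩) v ((hS₂ v).2 ⟨hv, Or.inr hv'.2⟩) huv
    intro u hu v hv huv
    by_cases h1 : u ∈ S₁ <;> by_cases h2 : v ∈ S₁ <;> simp only [h1, h2, if_true, if_false]
    · exact a3 u h1 v h2 huv
    · exact main u hu v hv huv h1 h2
    · exact (main v hv u hu huv.symm h2 h1).symm
    · have h3 := hS₁ u
      have h4 := hS₁ v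
      exact b3 u ((hS₂ u).2 ⟨hu, by tauto⟩) v ((hS₂ v).2 ⟨hv, by tauto⟩) huv

end Configurations

theorem winding_append_pair {V : Type} (x : V → V → V → ZMod 2) (l : List V) (a b d : V) :
    winding x (l ++ [a, b]) d = winding x (l ++ [a]) d + x a b d := by
  induction l with
  | nil => simp [winding]
  | cons c l ih =>
    cases l with
    | nil => simp [winding]
    | cons e l =>
      simp only [List.cons_append, winding] at ih ⊢
      rw [ih, add_assoc]

theorem winding_reverse {V : Type} {x : V → V → V → ZMod 2} (hx : ∀ a b c, x a b c = x b a c)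
    (l : List V) (d : V) : winding x l.reverse d = winding x l d := by
  induction l with
  | nil => rfl
  | cons a l ih =>
    cases l with
    | nil => rfl
    | cons b l =>
      simp only [List.reverse_cons, List.append_assoc, List.cons_append, List.nil_append] at ih ⊢
      rw [winding_append_pair, ih, winding, hx b a d, add_comm]

theorem side_reverse {V : Type} {x : V → V → V → ZMod 2} (hx : ∀ a b c, x a b c = x b a c)
    (z : V) (Q : List V) (d : V) : side x z Q.reverse d = side x z Q d := by
  unfold side
  rw [← winding_reverse hx]
  simp

section Configurations

variable {V : Type} [DecidableEq V] {Γ : SimpleGraph V} {z : V} {S B : Finset V}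
  {L : V → Finset ℕ} {p : List V} {φ : V → ℕ}
  {s : V → V → ZMod 2} {x : V → V → V → ZMod 2}

/-- All vertices off `Q` lie on the same side of `Q`. -/
def Undivided (S : Finset V) (x : V → V → V → ZMod 2) (z : V) (Q : List V) : Prop :=
  ∀ d ∈ S, d ∉ Q → ∀ d' ∈ S, d' ∉ Q → side x z Q d = side x z Q d'

theorem Undivided.reverse (hx : PD (Apex Γ z S B) s x) {Q : List V} (h : Undivided S x z Q) :
    Undivided S x z Q.reverse := by
  intro d hd hdQ d' hd' hdQ'
  rw [side_reverse hx.symm, side_reverse hx.symm]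
  exact h d hd (by simpa using hdQ) d' hd' (by simpa using hdQ')

theorem exists_sides {Q : List V} (h : ¬ Undivided S x z Q) (ω : ZMod 2) :
    (∃ d ∈ S, d ∉ Q ∧ side x z Q d = ω) ∧ ∃ d ∈ S, d ∉ Q ∧ side x z Q d ≠ ω := by
  unfold Undivided at h
  push Not at h
  obtain ⟨d, hd, hdQ, d', hd', hdQ', hne⟩ := h
  by_cases h1 : side x z Q d = ω
  · exact ⟨⟨d, hd, hdQ, h1⟩, ⟨d', hd', hdQ', fun h2 => hne (h1.trans h2.symm)⟩⟩
  · refine ⟨⟨d', hd', hdQ', ?_⟩, ⟨d, hd, hdQ, h1⟩⟩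
    generalize side x z Q d = a at *
    generalize side x z Q d' = b at *
    clear * - hne h1
    revert a b ω
    decide

theorem Chord.exists_side {Q : List V} (h : Chord Γ S B Q) (hx : PD (Apex Γ z S B) s x)
    (hz : z ∉ S) {l : List V} (hl : l.IsChain Γ.Adj) (hS : ∀ v ∈ l, v ∈ S)
    (hQ : ∀ v ∈ l, v ∉ Q) : ∃ ω, ∀ v ∈ l, side x z Q v = ω := by
  cases l with
  | nil => exact ⟨0, by simp⟩
  | cons a l => exact ⟨_, fun v hv => h.side_eq_of_chain hx hz hl hS hQ v hv a (by simp)⟩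

/-- A short chord with all of the precoloured path on one side has nothing on the other side. -/
theorem MinCE.undivided (M : MinCE Γ z S B L p φ) (hx : PD (Apex Γ z S B) s x) {Q : List V}
    (hQ : Chord Γ S B Q) (hlen : 2 ≤ Q.length) (hlen' : Q.length ≤ 4)
    (hp : ∃ ω, ∀ v ∈ p, v ∉ Q → side x z Q v = ω)
    (avail : ∀ v, Two S L p v → v ∉ Q → ∀ a ∈ Q, ∀ b ∈ Q, Γ.Adj v a → Γ.Adj v b → a = b) :
    Undivided S x z Q := by
  by_contra hU
  obtain ⟨ω, hω⟩ := hp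
  obtain ⟨h1, h2⟩ := exists_sides hU ω
  refine M.split hx hQ hlen hlen' ω (p₁ := p) (p₂ := Q) ?_ M.nodup M.chain M.weight ?_ hQ.nd
    hQ.chain (Or.inl hlen') ?_ ?_ h1 h2
  · intro v
    have := hω v
    tauto
  · intro v
    have := hω v
    tauto
  · intro u _ _ v hv hvQ hne
    exact absurd (hω v hv hvQ) hne
  · intro v hv hvQ _
    right
    by_cases h : ∃ a ∈ Q, Γ.Adj v a
    · obtain ⟨a, ha, hva⟩ := h
      exact ⟨a, fun u hu huv => avail v hv hvQ u hu a ha huv hva⟩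
    · exact ⟨z, fun u hu huv => absurd ⟨u, hu, huv⟩ h⟩

/-- An undivided chord lies on the boundary. -/
theorem MinCE.mem_boundary (M : MinCE Γ z S B L p φ) (hx : PD (Apex Γ z S B) s x) {Q : List V}
    (hQ : Chord Γ S B Q) (hlen : 2 ≤ Q.length) (hlen' : Q.length ≤ 4)
    (hU : Undivided S x z Q) {q : V} (hq : q ∈ Q) : q ∈ B := by
  by_contra hqB
  have hω : ∃ ω, ∀ d ∈ S, d ∉ Q → side x z Q d = ω := by
    by_cases h : ∃ d ∈ S, d ∉ Q
    · obtain ⟨d, hd, hdQ⟩ := h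
      exact ⟨_, fun e he heQ => hU e he heQ d hd hdQ⟩
    · exact ⟨0, fun d hd hdQ => absurd ⟨d, hd, hdQ⟩ h⟩
  obtain ⟨ω, hω⟩ := hω
  have hqS := hQ.sub q hq
  refine M.not_extends (M.finer (insert q B) p φ ?_ ⟨?_, ?_, M.nodup, M.chain, M.proper, M.two_le,
    ?_, M.indep, M.avail, M.weight⟩)
  · refine Nat.add_lt_add_right (Finset.card_lt_card ⟨?_, ?_⟩) _
    · intro v
      simp only [Finset.mem_filter, Finset.mem_insert]
      tauto
    · intro h
      have := h (by simp [hqB, hqS] : q ∈ S.filter (· ∉ B))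
      simp at this
  · refine hQ.disc M.girth M.disc hx hlen hlen' (ω := ω) subset_rfl hQ.sub hω ?_ ?_
    · intro b hb
      rcases Finset.mem_insert.1 hb with rfl | hb
      · exact Or.inr hq
      · exact Or.inl hb
    · exact Finset.insert_subset hqS M.disc.sub
  · exact fun v hv => Finset.mem_insert_of_mem (M.sub v hv)
  · exact fun v hv hvB => M.three_le v hv fun h => hvB (Finset.mem_insert_of_mem h)

theorem Chord.pair (hD : Disc Γ z S B) {u w : V} (huw : Γ.Adj u w) (hu : u ∈ B) (hw : w ∈ B) :
    Chord Γ S B [u, w] where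
  ne := by simp
  nd := by simpa using huw.ne
  chain := by simpa using huw
  sub := by simp [hD.sub hu, hD.sub hw]
  head := by simpa using hu
  last := by simpa using hw

theorem MinCE.avail_pair (M : MinCE Γ z S B L p φ) {u w : V} (huw : Γ.Adj u w) :
    ∀ v, Two S L p v → v ∉ [u, w] → ∀ a ∈ [u, w], ∀ b ∈ [u, w], Γ.Adj v a → Γ.Adj v b →
      a = b := by
  intro v _ _ a ha b hb hva hvb
  simp only [List.mem_cons, List.not_mem_nil, or_false] at ha hb
  rcases ha with rfl | rfl <;> rcases hb with rfl | rfl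
  · rfl
  · exact (M.girth.no_three _ _ _ hva huw hvb.symm).elim
  · exact (M.girth.no_three _ _ _ hvb huw hva.symm).elim
  · rfl

theorem MinCE.undivided_of_consecutive (M : MinCE Γ z S B L p φ) (hx : PD (Apex Γ z S B) s x)
    {l₁ l₂ : List V} {y v : V} (hp : p = l₁ ++ y :: v :: l₂) : Undivided S x z [y, v] := by
  have hch := M.chain
  have nd := M.nodup
  rw [hp] at hch nd
  have hyv : Γ.Adj y v := by
    have := (List.isChain_append.1 hch).2.1
    rw [List.isChain_cons_cons] at this
    exact this.1
  have hQ := Chord.pair M.disc hyv (M.sub y (by simp [hp])) (M.sub v (by simp [hp]))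
  have hS : ∀ v ∈ p, v ∈ S := fun v => M.mem_S
  have nd' := nd
  simp only [List.nodup_append, List.nodup_cons, List.mem_cons] at nd'
  obtain ⟨ω₁, h₁⟩ := hQ.exists_side hx M.disc.apex (l := l₁) (List.isChain_append.1 hch).1
    (fun v hv => hS v (by simp [hp, hv])) (by simp; grind)
  obtain ⟨ω₂, h₂⟩ := hQ.exists_side hx M.disc.apex (l := l₂)
    ((List.isChain_append.1 hch).2.1.tail.tail)
    (fun v hv => hS v (by simp [hp, hv])) (by simp; grind)
  by_cases hω : ω₁ = ω₂
  · refine M.undivided hx hQ (by simp) (by simp) ⟨ω₁, ?_⟩ (M.avail_pair hyv)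
    intro w hw hwQ
    simp only [hp, List.mem_append, List.mem_cons] at hw
    simp only [List.mem_cons, List.not_mem_nil, or_false, not_or] at hwQ
    grind
  · by_contra hU
    obtain ⟨k1, k2⟩ := exists_sides hU ω₁
    refine M.split hx hQ (by simp) (by simp) ω₁ (p₁ := l₁ ++ [y, v]) (p₂ := y :: v :: l₂)
      ?_ ?_ ?_ ?_ ?_ ?_ ?_ ?_ ?_ ?_ k1 k2
    · intro w
      simp only [hp, List.mem_append, List.mem_cons, List.not_mem_nil, or_false]
      grind
    · exact nd.sublist (by simp)
    · have : l₁ ++ y :: v :: l₂ = (l₁ ++ [y, v]) ++ l₂ := by simp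
      rw [this] at hch
      exact hch.left_of_append
    · have h := M.weight
      have e : p = (l₁ ++ [y, v]) ++ l₂ := by simp [hp]
      generalize Two S L p = T at h
      rw [e] at h
      exact h.of_append
    · intro w
      simp only [hp, List.mem_append, List.mem_cons, List.not_mem_nil, or_false]
      grind
    · exact nd.sublist (by simp)
    · exact (List.isChain_append.1 hch).2.1
    · have h := M.weight
      generalize Two S L p = T at h
      rw [hp] at h
      exact h.suffix
    · intro u hu hup
      simp only [List.mem_cons, List.not_mem_nil, or_false] at hu
      simp only [hp, List.mem_append, List.mem_cons] at hup
      tauto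
    · intro w _ _ _
      left
      intro u hu hup
      simp only [List.mem_cons, List.not_mem_nil, or_false] at hu
      simp only [hp, List.mem_append, List.mem_cons] at hup
      tauto

theorem MinCE.undivided_of_mem_aux (M : MinCE Γ z S B L p φ) (hx : PD (Apex Γ z S B) s x)
    {l₁ l₂ : List V} {a v : V} (hp : p = l₁ ++ v :: l₂) (hl : l₂.length ≤ 2) (ha : a ∈ B)
    (hap : a ∉ p) (hav : Γ.Adj a v)
    (H : ∀ w, Two S L p w → Γ.Adj w a → ∀ u ∈ p, ¬ Γ.Adj w u) : Undivided S x z [a, v] := by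
  have hch := M.chain
  have nd := M.nodup
  rw [hp] at hch nd
  have hQ := Chord.pair M.disc hav ha (M.sub v (by simp [hp]))
  have hS : ∀ v ∈ p, v ∈ S := fun v => M.mem_S
  have nd' := nd
  simp only [List.nodup_append, List.nodup_cons, List.mem_cons] at nd'
  have hap' := hap
  simp only [hp, List.mem_append, List.mem_cons] at hap'
  obtain ⟨ω₁, h₁⟩ := hQ.exists_side hx M.disc.apex (l := l₁) (List.isChain_append.1 hch).1
    (fun v hv => hS v (by simp [hp, hv])) (by simp; grind)
  obtain ⟨ω₂, h₂⟩ := hQ.exists_side hx M.disc.apex (l := l₂)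
    ((List.isChain_append.1 hch).2.1.tail)
    (fun v hv => hS v (by simp [hp, hv])) (by simp; grind)
  have hcross : ∀ w ∈ l₂, ¬ Γ.Adj a w := by
    have hc := (List.isChain_append.1 hch).2.1
    match l₂, hl with
    | [], _ => simp
    | [b], _ =>
      simp only [List.isChain_cons_cons, List.isChain_singleton, and_true] at hc
      simp only [List.mem_singleton, forall_eq]
      exact fun h => M.girth.no_three _ _ _ hav hc h.symm
    | [b, c], _ =>
      simp only [List.isChain_cons_cons, List.isChain_singleton, and_true] at hc
      simp only [List.mem_cons, List.not_mem_nil, or_false, forall_eq_or_imp, forall_eq]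
      refine ⟨fun h => M.girth.no_three _ _ _ hav hc.1 h.symm, fun h => ?_⟩
      rcases M.girth.no_four _ _ _ _ hav hc.1 hc.2 h.symm with e | e
      · exact hap' (by simp [e])
      · simp [e] at nd'
  by_cases hω : ω₁ = ω₂
  · refine M.undivided hx hQ (by simp) (by simp) ⟨ω₁, ?_⟩ (M.avail_pair hav)
    intro w hw hwQ
    simp only [hp, List.mem_append, List.mem_cons] at hw
    simp only [List.mem_cons, List.not_mem_nil, or_false, not_or] at hwQ
    grind
  · by_contra hU
    obtain ⟨k1, k2⟩ := exists_sides hU ω₁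
    refine M.split hx hQ (by simp) (by simp) ω₁ (p₁ := l₁ ++ [v]) (p₂ := a :: v :: l₂)
      ?_ ?_ ?_ ?_ ?_ ?_ ?_ ?_ ?_ ?_ k1 k2
    · intro w
      simp only [hp, List.mem_append, List.mem_cons, List.not_mem_nil, or_false]
      grind
    · exact nd.sublist (by simp)
    · have : l₁ ++ v :: l₂ = (l₁ ++ [v]) ++ l₂ := by simp
      rw [this] at hch
      exact hch.left_of_append
    · have h := M.weight
      have e : p = (l₁ ++ [v]) ++ l₂ := by simp [hp]
      generalize Two S L p = T at h
      rw [e] at h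
      exact h.of_append
    · intro w
      simp only [hp, List.mem_append, List.mem_cons, List.not_mem_nil, or_false]
      grind
    · rw [List.nodup_cons]
      refine ⟨by simp; tauto, nd.sublist (by simp)⟩
    · rw [List.isChain_cons_cons]
      exact ⟨hav, (List.isChain_append.1 hch).2.1⟩
    · left
      simp only [List.length_cons]
      omega
    · intro u hu hup w hw hwQ hne
      simp only [List.mem_cons, List.not_mem_nil, or_false] at hu hwQ
      simp only [hp, List.mem_append, List.mem_cons] at hw hup
      have : w ∈ l₂ := by grind
      have : u = a := by tauto
      subst this
      exact hcross w ‹_›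
    · intro w hw _ _
      by_cases hwa : Γ.Adj w a
      · right
        refine ⟨a, fun u hu huv => ?_⟩
        rcases List.mem_cons.1 hu with h | h
        · exact h
        · exact absurd huv (H w hw hwa u (by simp only [hp, List.mem_append]; exact Or.inr h))
      · left
        intro u hu hup
        simp only [List.mem_cons, List.not_mem_nil, or_false] at hu
        have : u = a := by
          rcases hu with h | h
          · exact h
          · exact absurd (by simp [hp, h]) hup
        rwa [this]

/-- A chord with exactly one end on the precoloured path is undivided. -/
theorem MinCE.undivided_of_mem (M : MinCE Γ z S B L p φ) (hx : PD (Apex Γ z S B) s x)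
    {a v : V} (hv : v ∈ p) (ha : a ∈ B) (hap : a ∉ p) (hav : Γ.Adj a v)
    (H : ∀ w, Two S L p w → Γ.Adj w a → ∀ u ∈ p, ¬ Γ.Adj w u) : Undivided S x z [a, v] := by
  obtain ⟨l₁, l₂, hp⟩ := List.append_of_mem hv
  by_cases hl : l₂.length ≤ 2
  · exact M.undivided_of_mem_aux hx hp hl ha hap hav H
  · have hlen := M.weight.length_le
    rw [hp, List.length_append, List.length_cons] at hlen
    refine M.reverse.undivided_of_mem_aux hx (l₁ := l₂.reverse) (l₂ := l₁.reverse)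
      (by simp [hp]) ?_ ha (by simpa using hap) hav (by simpa [Two] using H)
    rw [List.length_reverse]
    omega

/-- A chord with no end on the precoloured path is undivided. -/
theorem MinCE.undivided_of_notMem (M : MinCE Γ z S B L p φ) (hx : PD (Apex Γ z S B) s x)
    {a b : V} (ha : a ∈ B) (hap : a ∉ p) (hb : b ∈ B) (hbp : b ∉ p) (hab : Γ.Adj a b) :
    Undivided S x z [a, b] := by
  have hQ := Chord.pair M.disc hab ha hb
  refine M.undivided hx hQ (by simp) (by simp) ?_ (M.avail_pair hab)
  obtain ⟨ω, hω⟩ := hQ.exists_side hx M.disc.apex M.chain (fun v hv => M.mem_S hv) (by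
    intro v hv
    simp only [List.mem_cons, List.not_mem_nil, or_false, not_or]
    exact ⟨fun e => hap (e ▸ hv), fun e => hbp (e ▸ hv)⟩)
  exact ⟨ω, fun v hv _ => hω v hv⟩

/-- A boundary vertex does not have three neighbours along undivided chords. -/
theorem Disc.not_three (hD : Disc Γ z S B) (hx : PD (Apex Γ z S B) s x) {v y₁ y₂ y₃ : V}
    (hv : v ∈ B) (h₁ : y₁ ∈ B) (h₂ : y₂ ∈ B) (h₃ : y₃ ∈ B) (a₁ : Γ.Adj v y₁) (a₂ : Γ.Adj v y₂)
    (a₃ : Γ.Adj v y₃) (n₁₂ : y₁ ≠ y₂) (n₁₃ : y₁ ≠ y₃) (n₂₃ : y₂ ≠ y₃)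
    (u₁ : Undivided S x z [v, y₁]) (u₂ : Undivided S x z [v, y₂])
    (u₃ : Undivided S x z [v, y₃]) : False := by
  have hz : ∀ b ∈ B, z ≠ b := fun b hb e => hD.apex_notMem (e ▸ hb)
  have hS := hD.sub
  have := hx.triple_winding (z := z) (v := v) (y1 := y₁) (y2 := y₂) (y3 := y₃)
    (Or.inl ⟨hS hv, hS h₁, a₁⟩) (Or.inl ⟨hS hv, hS h₂, a₂⟩) (Or.inl ⟨hS hv, hS h₃, a₃⟩)
    (Or.inr (Or.inl ⟨rfl, h₁⟩)) (Or.inr (Or.inl ⟨rfl, h₂⟩)) (Or.inr (Or.inl ⟨rfl, h₃⟩))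
    (by
      have := a₁.ne
      have := a₂.ne
      have := a₃.ne
      have := hz v hv
      have := hz y₁ h₁
      have := hz y₂ h₂
      have := hz y₃ h₃
      simp
      tauto)
  have e1 := u₁ y₂ (hS h₂) (by simp [a₂.ne', n₁₂.symm]) y₃ (hS h₃) (by simp [a₃.ne', n₁₃.symm])
  have e2 := u₂ y₁ (hS h₁) (by simp [a₁.ne', n₁₂]) y₃ (hS h₃) (by simp [a₃.ne', n₂₃.symm])
  have e3 := u₃ y₁ (hS h₁) (by simp [a₁.ne', n₁₃]) y₂ (hS h₂) (by simp [a₂.ne', n₂₃])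
  simp only [side, List.cons_append, List.nil_append] at e1 e2 e3
  rw [e1, e2, e3] at this
  grind

theorem MinCE.no_two_at_head (M : MinCE Γ z S B L p φ) {v a : V} {l : List V} (hp : p = v :: l)
    (ha : Two S L p a) (hav : Γ.Adj a v) : False := by
  obtain ⟨c, hc, hc'⟩ := M.avail a ha
  have hsub : ∀ w, Two S L (a :: p) w → Two S L p w := by
    rintro w ⟨h1, h2, h3⟩
    exact ⟨h1, fun h => h2 (by simp [h]), h3⟩
  have hfree : FreeEnd Γ (Two S L (a :: p)) (some a) := by
    intro u hu w hw
    simp only [Option.mem_def, Option.some.injEq] at hu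
    exact hu ▸ M.indep a w ha (hsub w hw)
  have hφ : ∀ u ∈ p, Function.update φ a c u = φ u := by
    intro u hu
    have : u ≠ a := by
      rintro rfl
      exact ha.2.1 hu
    exact Function.update_of_ne this _ _
  have hE : Extends Γ S L (a :: p) (Function.update φ a c) := by
    refine M.finer B (a :: p) (Function.update φ a c) ?_ ⟨M.disc, ?_, ?_, ?_, ?_, ?_, M.three_le,
      fun u w hu hw => M.indep u w (hsub u hu) (hsub w hw), ?_, ?_⟩
    · refine Nat.add_lt_add_left (Finset.card_lt_card ⟨?_, ?_⟩) _
      · intro v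
        simp only [Finset.mem_filter, List.mem_cons]
        tauto
      · intro h
        have := h (by simp [ha.1, ha.2.1] : a ∈ S.filter (· ∉ p))
        simp at this
    · intro u hu
      rcases List.mem_cons.1 hu with rfl | hu
      · exact ha.mem_boundary M
      · exact M.sub u hu
    · exact List.nodup_cons.2 ⟨ha.2.1, M.nodup⟩
    · rw [hp, List.isChain_cons_cons]
      exact ⟨hav, hp ▸ M.chain⟩
    · intro u hu w hw huw
      rcases List.mem_cons.1 hu with e | hu' <;> rcases List.mem_cons.1 hw with e' | hw'
      · rw [e, e'] at huw
        exact absurd huw Γ.irrefl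
      · rw [hφ w hw', e, Function.update_self]
        exact hc' w hw' (e ▸ huw)
      · rw [hφ u hu', e', Function.update_self]
        exact (hc' u hu' (e' ▸ huw.symm)).symm
      · rw [hφ u hu', hφ w hw']
        exact M.proper u hu' w hw' huw
    · exact fun w hw hw' => M.two_le w hw fun h => hw' (by simp [h])
    · intro w hw
      obtain ⟨d, hd, hd'⟩ := M.avail w (hsub w hw)
      refine ⟨d, hd, fun u hu huw => ?_⟩
      rcases List.mem_cons.1 hu with rfl | hu
      · exact absurd huw (M.indep w u (hsub w hw) ha)
      · rw [hφ u hu]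
        exact hd' u hu huw
    · have hw := M.weight
      have hbad : ¬ FreeEnd Γ (Two S L p) p.head? := by
        intro h
        exact h v (by simp [hp]) a ha hav.symm
      have hlast : (a :: p).getLast? = p.getLast? := by simp [hp]
      unfold Weight at hw ⊢
      rw [List.head?_cons, hlast, List.length_cons]
      rcases hw with h | ⟨h, h'⟩ | h
      · by_cases h4 : p.length ≤ 3
        · left
          omega
        · right
          left
          exact ⟨by omega, Or.inl hfree⟩
      · right
        right
        exact ⟨by omega, hfree, (h'.resolve_left hbad).mono hsub⟩
      · exact absurd h.2.1 hbad
  obtain ⟨ψ, h1, h2, h3⟩ := hE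
  refine M.not_extends ⟨ψ, fun w hw => ?_, fun w hw hwp => ?_, h3⟩
  · rw [h1 w (by simp [hw]), hφ w hw]
  · by_cases hwa : w = a
    · subst hwa
      rw [h1 w (by simp), Function.update_self]
      exact hc
    · exact h2 w hw (by simp [hwa, hwp])

theorem MinCE.two_not_adj (M : MinCE Γ z S B L p φ) {a v : V}
    (ha : Two S L p a) (hv : v ∈ p) : ¬ Γ.Adj a v := by
  intro hav
  obtain ⟨s, x, hx⟩ := M.disc.planar
  obtain ⟨l₁, l₂, hp⟩ := List.append_of_mem hv
  rcases List.eq_nil_or_concat l₁ with rfl | ⟨l₁, y₁, rfl⟩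
  · exact M.no_two_at_head hp ha hav
  cases l₂ with
  | nil =>
    exact M.reverse.no_two_at_head (v := v) (l := (l₁.concat y₁).reverse) (by simp [hp])
      (by simpa [Two] using ha) hav
  | cons y₂ l₂ =>
    rw [List.concat_eq_append] at hp
    have nd := M.nodup
    have hch := M.chain
    have hap := ha.2.1
    have hp1 : p = l₁ ++ y₁ :: v :: (y₂ :: l₂) := by simp [hp]
    have u1 := (M.undivided_of_consecutive hx hp1).reverse hx
    have u2 := M.undivided_of_consecutive hx hp
    have u3 := (M.undivided_of_mem hx hv (ha.mem_boundary M) hap hav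
      (fun w hw hwa => absurd hwa (M.indep w a hw ha))).reverse hx
    have m1 : y₁ ∈ p := by simp [hp1]
    have m2 : y₂ ∈ p := by simp [hp1]
    rw [hp1] at nd hch
    have hc := (List.isChain_append.1 hch).2.1
    simp only [List.isChain_cons_cons] at hc
    refine M.disc.not_three hx (M.sub v hv) (M.sub y₁ m1) (M.sub y₂ m2) (ha.mem_boundary M)
      hc.1.symm hc.2.1 hav.symm ?_ ?_ ?_ u1 u2 u3
    · rintro rfl
      simp [List.nodup_append] at nd
    · rintro rfl
      exact hap m1
    · rintro rfl
      exact hap m2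

/-- The vertex `u` is not an inner vertex of the path `p`. -/
def Outer (p : List V) (u : V) : Prop := u ∈ p → p.head? = some u ∨ p.getLast? = some u

theorem outer_of_notMem {u : V} (h : u ∉ p) : Outer p u := fun h' => absurd h' h

theorem exists_chain_avoiding (hp : p.IsChain Γ.Adj) (nd : p.Nodup) {Q : List V}
    (hQ : ∀ q ∈ Q, Outer p q) :
    ∃ l : List V, l.IsChain Γ.Adj ∧ ∀ v, v ∈ l ↔ v ∈ p ∧ v ∉ Q := by
  cases p with
  | nil => exact ⟨[], by simp⟩
  | cons a m =>
    rcases List.eq_nil_or_concat m with rfl | ⟨m, b, rfl⟩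
    · by_cases ha : a ∈ Q
      · exact ⟨[], by simp, by simp; grind⟩
      · exact ⟨[a], by simp, by simp; grind⟩
    rw [List.concat_eq_append] at *
    have hm : ∀ v ∈ m, v ∉ Q := by
      intro v hv hvQ
      have h := hQ v hvQ (by simp [hv])
      simp only [List.nodup_cons, List.nodup_append, List.mem_append, List.mem_singleton] at nd
      simp only [Option.some.injEq, ← List.cons_append,
        List.getLast?_append, List.getLast?_singleton, Option.some_or] at h
      grind
    by_cases ha : a ∈ Q <;> by_cases hb : b ∈ Q
    · refine ⟨m, hp.tail.left_of_append, fun v => ?_⟩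
      simp
      grind
    · refine ⟨m ++ [b], hp.tail, fun v => ?_⟩
      simp
      grind
    · refine ⟨a :: m, (show ((a :: m) ++ [b]).IsChain Γ.Adj from hp).left_of_append, fun v => ?_⟩
      simp
      grind
    · refine ⟨a :: (m ++ [b]), hp, fun v => ?_⟩
      simp
      grind

theorem MinCE.mem_boundary_of_outer (M : MinCE Γ z S B L p φ) (hx : PD (Apex Γ z S B) s x)
    {Q : List V} (hQ : Chord Γ S B Q) (hlen : 2 ≤ Q.length) (hlen' : Q.length ≤ 4)
    (ho : ∀ q ∈ Q, Outer p q)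
    (avail : ∀ v, Two S L p v → v ∉ Q → ∀ a ∈ Q, ∀ b ∈ Q, Γ.Adj v a → Γ.Adj v b → a = b) :
    Undivided S x z Q ∧ ∀ q ∈ Q, q ∈ B := by
  obtain ⟨l, hl, hl'⟩ := exists_chain_avoiding M.chain M.nodup ho
  obtain ⟨ω, hω⟩ := hQ.exists_side hx M.disc.apex hl (fun v hv => M.mem_S ((hl' v).1 hv).1)
    fun v hv => ((hl' v).1 hv).2
  have hU := M.undivided hx hQ hlen hlen' ⟨ω, fun v hv hvQ => hω v ((hl' v).2 ⟨hv, hvQ⟩)⟩ avail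
  exact ⟨hU, fun q hq => M.mem_boundary hx hQ hlen hlen' hU hq⟩

theorem MinCE.undivided_pair (M : MinCE Γ z S B L p φ) (hx : PD (Apex Γ z S B) s x)
    {a b : V} (ha : a ∈ B) (hap : a ∉ p) (hb : b ∈ B) (hab : Γ.Adj a b) :
    Undivided S x z [a, b] := by
  by_cases hbp : b ∈ p
  · exact M.undivided_of_mem hx hbp ha hap hab fun w hw _ u hu => M.two_not_adj hw hu
  · exact M.undivided_of_notMem hx ha hap hb hbp hab

/-- A boundary vertex off the path has at most two neighbours on the boundary. -/
theorem MinCE.eq_or_eq (M : MinCE Γ z S B L p φ) {v a b c : V} (hv : v ∈ B) (hvp : v ∉ p)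
    (ha : a ∈ B) (hb : b ∈ B) (hc : c ∈ B) (va : Γ.Adj v a) (vb : Γ.Adj v b) (vc : Γ.Adj v c)
    (hab : a ≠ b) : c = a ∨ c = b := by
  by_contra! h
  obtain ⟨s, x, hx⟩ := M.disc.planar
  exact M.disc.not_three hx hv ha hb hc va vb vc hab h.1.symm h.2.symm
    (M.undivided_pair hx hv hvp ha va) (M.undivided_pair hx hv hvp hb vb)
    (M.undivided_pair hx hv hvp hc vc)

/-- A vertex joined to two boundary vertices that are not inside the path is on the boundary. -/
theorem MinCE.mem_of_two_chord (M : MinCE Γ z S B L p φ) {u y w : V} (hu : u ∈ B) (hw : w ∈ B)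
    (huw : u ≠ w) (hy : y ∈ S) (hyp : y ∉ p) (uy : Γ.Adj u y) (yw : Γ.Adj y w)
    (ou : Outer p u) (ow : Outer p w) : y ∈ B := by
  obtain ⟨s, x, hx⟩ := M.disc.planar
  have hS := M.disc.sub
  refine (M.mem_boundary_of_outer hx (Q := [u, y, w]) ⟨by simp, ?_, by simp [uy, yw], ?_, ?_, ?_⟩
    (by simp) (by simp) ?_ ?_).2 y (by simp)
  · simp [uy.ne, yw.ne, huw]
  · simp [hS hu, hS hw, hy]
  · simpa using hu
  · simpa using hw
  · simp [ou, ow, outer_of_notMem hyp]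
  · intro v _ hvQ a ha b hb va vb
    have g := M.girth.no_three
    have g' := M.girth.no_four v u y w
    simp only [List.mem_cons, List.not_mem_nil, or_false, not_or] at ha hb hvQ
    have := Γ.adj_comm
    grind

/-- The three-edge analogue of `MinCE.mem_of_two_chord`. -/
theorem MinCE.mem_of_three_chord (M : MinCE Γ z S B L p φ) {u y y' w : V} (hu : u ∈ B)
    (hw : w ∈ B) (hy : y ∈ S) (hyp : y ∉ p) (hy' : y' ∈ S) (hyp' : y' ∉ p) (uy : Γ.Adj u y)
    (yy : Γ.Adj y y') (yw : Γ.Adj y' w) (huy : u ≠ y') (hyw : y ≠ w) (ou : Outer p u)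
    (ow : Outer p w) (hw' : ∀ v, Two S L p v → ¬ Γ.Adj v w) : y ∈ B := by
  obtain ⟨s, x, hx⟩ := M.disc.planar
  have hS := M.disc.sub
  have g := M.girth.no_three
  have huw : u ≠ w := by
    rintro rfl
    exact g _ _ _ uy yy yw
  refine (M.mem_boundary_of_outer hx (Q := [u, y, y', w])
    ⟨by simp, ?_, by simp [uy, yy, yw], ?_, ?_, ?_⟩ (by simp) (by simp) ?_ ?_).2 y (by simp)
  · simp [uy.ne, yw.ne, yy.ne, huw, huy, hyw]
  · simp [hS hu, hS hw, hy, hy']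
  · simpa using hu
  · simpa using hw
  · simp [ou, ow, outer_of_notMem hyp, outer_of_notMem hyp']
  · intro v hv hvQ a ha b hb va vb
    have g' := M.girth.no_four v u y y'
    have := hw' v hv
    simp only [List.mem_cons, List.not_mem_nil, or_false, not_or] at ha hb hvQ
    have := Γ.adj_comm
    grind

/-- A vertex off the path has at least as many neighbours as colours. -/
theorem MinCE.exists_adj_notMem (M : MinCE Γ z S B L p φ) {v : V} (hv : v ∈ S) (hvp : v ∉ p)
    (F : Finset V) (hF : F.card < (L v).card) : ∃ w ∈ S, Γ.Adj v w ∧ w ∉ F := by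
  by_contra! h
  have hT : ∀ w, Two (S.erase v) L p w → Two S L p w :=
    fun w hw => ⟨Finset.mem_of_mem_erase hw.1, hw.2⟩
  obtain ⟨ψ, h1, h2, h3⟩ := M.smaller z (S.erase v) (B.erase v) L p φ
    (Finset.card_erase_lt_of_mem hv)
    ⟨M.disc.mono (Finset.erase_subset _ _) (Finset.erase_subset _ _)
      (Finset.erase_subset_erase _ M.disc.sub),
    fun w hw => Finset.mem_erase.2 ⟨fun e => hvp (e ▸ hw), M.sub w hw⟩, M.nodup, M.chain, M.proper,
    fun w hw => M.two_le w (Finset.mem_of_mem_erase hw),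
    fun w hw hwB => M.three_le w (Finset.mem_of_mem_erase hw) fun h =>
      hwB (Finset.mem_erase.2 ⟨Finset.ne_of_mem_erase hw, h⟩),
    fun u w hu hw => M.indep u w (hT u hu) (hT w hw), fun w hw => M.avail w (hT w hw),
    M.weight.mono hT⟩
  obtain ⟨c, hc, hc'⟩ := Finset.exists_mem_notMem_of_card_lt_card
    (Finset.card_image_le.trans_lt hF : (F.image ψ).card < (L v).card)
  have hne : ∀ w ∈ S, Γ.Adj v w → c ≠ ψ w := fun w hw hvw e =>
    hc' (Finset.mem_image.2 ⟨w, h w hw hvw, e.symm⟩)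
  refine M.not_extends ⟨fun w => if w = v then c else ψ w, ?_, ?_, ?_⟩
  · intro w hw
    have : w ≠ v := fun e => hvp (e ▸ hw)
    simp [this, h1 w hw]
  · intro w hw hwp
    by_cases e : w = v
    · simpa [e] using hc
    · simpa [e] using h2 w (Finset.mem_erase.2 ⟨e, hw⟩) hwp
  · intro a ha b hb hab
    by_cases e : a = v <;> by_cases e' : b = v
    · exact absurd (e.trans e'.symm) hab.ne
    · simpa [e, e'] using hne b hb (e ▸ hab)
    · simpa [e, e'] using (hne a ha (e' ▸ hab.symm)).symm
    · simpa [e, e'] using h3 a (Finset.mem_erase.2 ⟨e, ha⟩) b (Finset.mem_erase.2 ⟨e', hb⟩) hab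

/-- A chord `Q ++ [v]` meeting the path only in `v`, near an end of the path, is undivided. -/
theorem MinCE.mem_of_chord_near_end (M : MinCE Γ z S B L p φ) {Q l₁ l₂ : List V} {v : V}
    (hp : p = l₁ ++ v :: l₂) (hQ : Chord Γ S B (Q ++ [v])) (hQp : ∀ q ∈ Q, q ∉ p)
    (hne : Q ≠ []) (hlen' : Q.length ≤ 3) (hl : Q.length + l₂.length ≤ 4)
    (cross : ∀ q ∈ Q, ∀ w ∈ l₂, ¬ Γ.Adj q w)
    (avail : ∀ t, Two S L p t → t ∉ Q → ∀ a ∈ Q, ∀ b ∈ Q, Γ.Adj t a → Γ.Adj t b → a = b) :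
    ∀ q ∈ Q, q ∈ B := by
  obtain ⟨s, x, hx⟩ := M.disc.planar
  have hch := M.chain
  have nd := M.nodup
  rw [hp] at hch nd
  have hS : ∀ v ∈ p, v ∈ S := fun v => M.mem_S
  have nd' := nd
  have hlen : 2 ≤ (Q ++ [v]).length := by
    have := List.length_pos_iff.2 hne
    simp
    omega
  simp only [List.nodup_append, List.nodup_cons, List.mem_cons] at nd'
  have hQp' := hQp
  simp only [hp, List.mem_append, List.mem_cons] at hQp'
  have avail' : ∀ t, Two S L p t → t ∉ Q ++ [v] → ∀ a ∈ Q ++ [v], ∀ b ∈ Q ++ [v], Γ.Adj t a →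
      Γ.Adj t b → a = b := by
    intro t ht htQ a ha b hb hta htb
    have := M.two_not_adj ht (v := v) (by simp [hp])
    have := avail t ht
    simp only [List.mem_append, List.mem_singleton] at ha hb htQ
    grind
  suffices hU : Undivided S x z (Q ++ [v]) from fun q hq =>
    M.mem_boundary hx hQ hlen (by simp; omega) hU (by simp [hq])
  obtain ⟨ω₁, h₁⟩ := hQ.exists_side hx M.disc.apex (l := l₁) (List.isChain_append.1 hch).1
    (fun v hv => hS v (by simp [hp, hv])) (by simp; grind)
  obtain ⟨ω₂, h₂⟩ := hQ.exists_side hx M.disc.apex (l := l₂)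
    ((List.isChain_append.1 hch).2.1.tail)
    (fun v hv => hS v (by simp [hp, hv])) (by simp; grind)
  by_cases hω : ω₁ = ω₂
  · refine M.undivided hx hQ hlen (by simp; omega) ⟨ω₁, ?_⟩ avail'
    intro w hw hwQ
    simp only [hp, List.mem_append, List.mem_cons] at hw
    simp only [List.mem_append, List.mem_cons, List.not_mem_nil, or_false, not_or] at hwQ
    grind
  · by_contra hU
    obtain ⟨k1, k2⟩ := exists_sides hU ω₁
    refine M.split hx hQ hlen (by simp; omega) ω₁ (p₁ := l₁ ++ [v]) (p₂ := Q ++ v :: l₂)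
      ?_ ?_ ?_ ?_ ?_ ?_ ?_ ?_ ?_ ?_ k1 k2
    · intro w
      simp only [hp, List.mem_append, List.mem_cons, List.not_mem_nil, or_false]
      grind
    · exact nd.sublist (by simp)
    · have : l₁ ++ v :: l₂ = (l₁ ++ [v]) ++ l₂ := by simp
      rw [this] at hch
      exact hch.left_of_append
    · have h := M.weight
      have e : p = (l₁ ++ [v]) ++ l₂ := by simp [hp]
      generalize Two S L p = T at h
      rw [e] at h
      exact h.of_append
    · intro w
      simp only [hp, List.mem_append, List.mem_cons, List.not_mem_nil, or_false]
      grind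
    · rw [List.nodup_append]
      refine ⟨(List.nodup_append.1 hQ.nd).1, nd.sublist (by simp), ?_⟩
      rintro a ha b hb rfl
      have := hQp' a ha
      simp only [List.mem_cons] at hb
      tauto
    · have h1 := hQ.chain
      rw [List.isChain_append] at h1 ⊢
      exact ⟨h1.1, (List.isChain_append.1 hch).2.1, by simpa using h1.2.2⟩
    · right
      left
      refine ⟨by simp; omega, Or.inr ?_⟩
      intro u hu t ht hut
      rw [List.getLast?_append_of_ne_nil _ (by simp)] at hu
      have : u ∈ p := by
        rw [hp]
        exact List.mem_append_right _ (List.mem_of_getLast? hu)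
      exact M.two_not_adj ht this hut.symm
    · intro u hu hup w hw hwQ hne
      simp only [List.mem_append, List.mem_cons, List.not_mem_nil, or_false] at hu hwQ
      simp only [hp, List.mem_append, List.mem_cons] at hw hup
      exact cross u (by tauto) w (by grind)
    · intro t ht htQ _
      by_cases h : ∃ a ∈ Q, Γ.Adj t a
      · right
        obtain ⟨a, ha, hta⟩ := h
        refine ⟨a, fun u hu hut => ?_⟩
        rcases List.mem_append.1 hu with h | h
        · exact avail t ht (fun h => htQ (by simp [h])) u h a ha hut hta
        · exact absurd hut (M.two_not_adj ht (by rw [hp]; exact List.mem_append_right _ h))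
      · left
        intro u hu hup huv
        simp only [List.mem_append, List.mem_cons, List.not_mem_nil, or_false] at hu
        rcases hu with hu | hu
        · exact h ⟨u, hu, huv⟩
        · exact hup (by simp [hp, hu])

/-- The vertices of a list can be removed one at a time, each from the boundary. -/
def Peelable (Γ : SimpleGraph V) : (V → Prop) → List V → Prop
  | _, [] => True
  | P, v :: l => P v ∧ Peelable Γ (fun w => P w ∨ Γ.Adj v w) l

theorem Peelable.mono {P P' : V → Prop} {X : List V} (h : Peelable Γ P X)
    (hP : ∀ v ∈ X, P v → P' v) : Peelable Γ P' X := by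
  induction X generalizing P P' with
  | nil => trivial
  | cons v X ih =>
    exact ⟨hP v (by simp) h.1, ih h.2 fun w hw => Or.imp_left (hP w (by simp [hw]))⟩

theorem Disc.peel (hD : Disc Γ z S B) {X : List V} (nd : X.Nodup) (hXS : ∀ v ∈ X, v ∈ S)
    (hX : Peelable Γ (· ∈ B) X) {S' B' : Finset V} (hS : ∀ v ∈ S', v ∈ S ∧ v ∉ X)
    (hB : ∀ v ∈ B', v ∈ S' ∧ (v ∈ B ∨ ∃ u ∈ X, Γ.Adj u v)) : Disc Γ z S' B' := by
  classical
  induction X generalizing S B with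
  | nil =>
    exact hD.mono (fun v hv => (hS v hv).1) (fun v hv => by simpa using (hB v hv).2)
      fun v hv => (hB v hv).1
  | cons a X ih =>
    rw [List.nodup_cons] at nd
    have ha : a ∈ B := hX.1
    refine ih (S := S.erase a) (B := (S.erase a).filter fun w => w ∈ B ∨ Γ.Adj a w)
      (hD.contract ha subset_rfl (Finset.filter_subset _ _) (by simp)) nd.2 ?_ ?_ ?_ ?_
    · intro v hv
      exact Finset.mem_erase.2 ⟨fun e => nd.1 (e ▸ hv), hXS v (by simp [hv])⟩
    · refine Peelable.mono hX.2 fun v hv h => ?_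
      simp only [Finset.mem_filter, Finset.mem_erase]
      exact ⟨⟨fun e => nd.1 (e ▸ hv), hXS v (by simp [hv])⟩, h⟩
    · intro v hv
      have := hS v hv
      simp only [List.mem_cons, not_or] at this
      exact ⟨Finset.mem_erase.2 ⟨this.2.1, this.1⟩, this.2.2⟩
    · intro v hv
      have h1 := hB v hv
      have := hS v h1.1
      simp only [List.mem_cons, not_or] at this
      simp only [Finset.mem_filter, Finset.mem_erase]
      refine ⟨h1.1, ?_⟩
      obtain ⟨-, h | ⟨u, hu, huv⟩⟩ := h1
      · exact Or.inl ⟨⟨this.2.1, this.1⟩, Or.inl h⟩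
      · rcases List.mem_cons.1 hu with rfl | hu
        · exact Or.inl ⟨⟨this.2.1, this.1⟩, Or.inr huv⟩
        · exact Or.inr ⟨u, hu, huv⟩

/-- The vertices off the path losing a colour when `X` is coloured by `χ`. -/
def Touched (Γ : SimpleGraph V) (S : Finset V) (L : V → Finset ℕ) (p X : List V) (χ : V → ℕ)
    (t : V) : Prop :=
  t ∈ S ∧ t ∉ X ∧ t ∉ p ∧ ∃ u ∈ X, Γ.Adj u t ∧ χ u ∈ L t

/-- Reducing a configuration by colouring and deleting the vertices of `X`. -/
theorem MinCE.delete (M : MinCE Γ z S B L p φ) {X p' : List V} {χ : V → ℕ} (hXne : X ≠ [])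
    (nd : X.Nodup) (hXS : ∀ v ∈ X, v ∈ S) (hX : Peelable Γ (· ∈ B) X)
    (hp' : ∀ v, v ∈ p' ↔ v ∈ p ∧ v ∉ X) (nd' : p'.Nodup) (ch' : p'.IsChain Γ.Adj)
    (hχ : ∀ v ∈ X, v ∈ p → χ v = φ v) (hχL : ∀ v ∈ X, v ∉ p → χ v ∈ L v)
    (proper : ∀ u ∈ X, ∀ v ∈ X, Γ.Adj u v → χ u ≠ χ v)
    (proper' : ∀ u ∈ X, ∀ v ∈ p', Γ.Adj u v → χ u ≠ φ v)
    (d₁ : ∀ t, Touched Γ S L p X χ t → ∀ u ∈ X, ∀ v ∈ X, Γ.Adj u t → Γ.Adj v t → u = v)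
    (d₂ : ∀ t, Touched Γ S L p X χ t → ¬ Two S L p t)
    (d₃ : ∀ t t', Touched Γ S L p X χ t → Touched Γ S L p X χ t' → ¬ Γ.Adj t t')
    (d₄ : ∀ t b, Touched Γ S L p X χ t → Two S L p b → b ∉ X → ¬ Γ.Adj t b)
    (d₅ : Weight Γ (Touched Γ S L p X χ) p')
    (d₆ : ∀ t, Touched Γ S L p X χ t → ∀ u ∈ p', ∀ v ∈ p', Γ.Adj t u → Γ.Adj t v → u = v) :
    False := by
  classical
  let S' := S.filter (· ∉ X)
  let B' := S'.filter (fun v => v ∈ B ∨ ∃ u ∈ X, Γ.Adj u v)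
  let L' : V → Finset ℕ := fun v => (L v).filter (fun c => ∀ u ∈ X, Γ.Adj u v → χ u ≠ c)
  have hS' : ∀ v, v ∈ S' ↔ v ∈ S ∧ v ∉ X := by simp [S']
  have hB' : ∀ v, v ∈ B' ↔ v ∈ S' ∧ (v ∈ B ∨ ∃ u ∈ X, Γ.Adj u v) := by simp [B']
  have hL' : ∀ v c, c ∈ L' v ↔ c ∈ L v ∧ ∀ u ∈ X, Γ.Adj u v → χ u ≠ c := by simp [L']
  have hp : ∀ v ∈ S', v ∉ p' → v ∉ p := fun v hv h hvp => h ((hp' v).2 ⟨hvp, ((hS' v).1 hv).2⟩)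
  have hun : ∀ v ∈ S', v ∉ p' → ¬ Touched Γ S L p X χ v → L' v = L v := by
    intro v hv hvp ht
    ext c
    rw [hL']
    refine ⟨fun h => h.1, fun h => ⟨h, ?_⟩⟩
    rintro u hu huv rfl
    exact ht ⟨((hS' v).1 hv).1, ((hS' v).1 hv).2, hp v hv hvp, u, hu, huv, h⟩
  have h3 : ∀ v, Touched Γ S L p X χ v → 3 ≤ (L v).card := by
    intro v hv
    by_contra h
    exact d₂ v hv ⟨hv.1, hv.2.2.1, by omega⟩
  have htc : ∀ v, Touched Γ S L p X χ v → 2 ≤ (L' v).card := by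
    intro v hv
    obtain ⟨u, hu, huv, -⟩ := hv.2.2.2
    have : (L v).erase (χ u) ⊆ L' v := by
      intro c hc
      rw [Finset.mem_erase] at hc
      refine (hL' v c).2 ⟨hc.2, fun w hw hwv => ?_⟩
      rw [d₁ v hv w hw u hu hwv huv]
      exact hc.1.symm
    have := Finset.card_le_card this
    have := Finset.pred_card_le_card_erase (s := L v) (a := χ u)
    have := h3 v hv
    omega
  have hTwo : ∀ v, Two S' L' p' v → (Two S L p v ∧ v ∉ X) ∨ Touched Γ S L p X χ v := by
    rintro v ⟨h1, h2, h4⟩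
    by_cases ht : Touched Γ S L p X χ v
    · exact Or.inr ht
    · rw [hun v h1 h2 ht] at h4
      exact Or.inl ⟨⟨((hS' v).1 h1).1, hp v h1 h2, h4⟩, ((hS' v).1 h1).2⟩
  have h2 : ∀ v ∈ S', v ∉ p' → 2 ≤ (L' v).card := by
    intro v hv hvp
    by_cases ht : Touched Γ S L p X χ v
    · exact htc v ht
    · rw [hun v hv hvp ht]
      exact M.two_le v ((hS' v).1 hv).1 (hp v hv hvp)
  have hsub : ∀ v ∈ p', v ∈ p := fun v hv => ((hp' v).1 hv).1
  have hno : ∀ b, Two S L p b → ∀ u ∈ p', ¬ Γ.Adj b u := fun b hb u hu =>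
    M.two_not_adj hb (hsub u hu)
  have hcard : S'.card < S.card := by
    refine Finset.card_lt_card ⟨Finset.filter_subset _ _, fun h => ?_⟩
    obtain ⟨a, ha⟩ := List.exists_mem_of_ne_nil X hXne
    exact ((hS' a).1 (h (hXS a ha))).2 ha
  have hext : Extends Γ S' L' p' φ := by
    refine M.smaller z S' B' L' p' φ hcard
      ⟨M.disc.peel nd hXS hX (fun v hv => (hS' v).1 hv) fun v hv => (hB' v).1 hv,
        ?_, nd', ch', ?_, h2,
        ?_, ?_, ?_, ?_⟩
    · intro v hv
      exact (hB' v).2 ⟨(hS' v).2 ⟨M.mem_S (hsub v hv), ((hp' v).1 hv).2⟩,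
        Or.inl (M.sub v (hsub v hv))⟩
    · exact fun u hu v hv => M.proper u (hsub u hu) v (hsub v hv)
    · intro v hv hvB
      have hvB' : v ∉ B := fun h => hvB ((hB' v).2 ⟨hv, Or.inl h⟩)
      have hvp : v ∉ p' := fun h => hvB' (M.sub v (hsub v h))
      rw [hun v hv hvp]
      · exact M.three_le v ((hS' v).1 hv).1 hvB'
      · rintro ⟨-, -, -, u, hu, huv, -⟩
        exact hvB ((hB' v).2 ⟨hv, Or.inr ⟨u, hu, huv⟩⟩)
    · intro u v hu hv
      rcases hTwo u hu with hu | hu <;> rcases hTwo v hv with hv | hv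
      · exact M.indep u v hu.1 hv.1
      · exact fun h => d₄ v u hv hu.1 hu.2 h.symm
      · exact d₄ u v hu hv.1 hv.2
      · exact d₃ u v hu hv
    · intro v hv
      have hc := h2 v hv.1 hv.2.1
      have hu : ∃ u, ∀ w ∈ p', Γ.Adj v w → w = u := by
        by_cases h : ∃ u ∈ p', Γ.Adj v u
        · obtain ⟨u, hu, hvu⟩ := h
          refine ⟨u, fun w hw hvw => ?_⟩
          rcases hTwo v hv with h | h
          · exact absurd hvu (hno v h.1 u hu)
          · exact d₆ v h w hw u hu hvw hvu
        · push Not at h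
          exact ⟨v, fun w hw hvw => absurd hvw (h w hw)⟩
      obtain ⟨u, hu⟩ := hu
      obtain ⟨c, hc, hcu⟩ := Finset.exists_mem_ne (by omega : 1 < (L' v).card) (φ u)
      exact ⟨c, hc, fun w hw hvw => hu w hw hvw ▸ hcu⟩
    · have hf : ∀ o : Option V, (∀ u ∈ o, u ∈ p') → FreeEnd Γ (Touched Γ S L p X χ) o →
          FreeEnd Γ (Two S' L' p') o := by
        intro o ho h u hu v hv
        rcases hTwo v hv with hv | hv
        · exact fun h => hno v hv.1 u (ho u hu) h.symm
        · exact h u hu v hv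
      have h1 := hf p'.head? fun u hu => List.mem_of_head? hu
      have h2 := hf p'.getLast? fun u hu => List.mem_of_getLast? hu
      rcases d₅ with h | ⟨h, h'⟩ | ⟨h, h', h''⟩
      · exact Or.inl h
      · exact Or.inr (Or.inl ⟨h, h'.imp h1 h2⟩)
      · exact Or.inr (Or.inr ⟨h, h1 h', h2 h''⟩)
  obtain ⟨ψ, e1, e2, e3⟩ := hext
  refine M.not_extends ⟨fun v => if v ∈ X then χ v else ψ v, ?_, ?_, ?_⟩
  · intro v hv
    by_cases hvX : v ∈ X
    · simpa [hvX] using hχ v hvX hv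
    · simpa [hvX] using e1 v ((hp' v).2 ⟨hv, hvX⟩)
  · intro v hv hvp
    by_cases hvX : v ∈ X
    · simpa [hvX] using hχL v hvX hvp
    · simpa [hvX] using ((hL' v _).1
        (e2 v ((hS' v).2 ⟨hv, hvX⟩) fun h => hvp (hsub v h))).1
  · have key : ∀ u ∈ X, ∀ v ∈ S, v ∉ X → Γ.Adj u v → χ u ≠ ψ v := by
      intro u hu v hv hvX huv
      by_cases hvp : v ∈ p'
      · rw [e1 v hvp]
        exact proper' u hu v hvp huv
      · exact ((hL' v _).1 (e2 v ((hS' v).2 ⟨hv, hvX⟩) hvp)).2 u hu huv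
    intro u hu v hv huv
    by_cases hux : u ∈ X <;> by_cases hvX : v ∈ X
    · simpa [hux, hvX] using proper u hux v hvX huv
    · simpa [hux, hvX] using key u hux v hv hvX huv
    · simpa [hux, hvX] using (key v hvX u hu hux huv.symm).symm
    · simpa [hux, hvX] using e3 u ((hS' u).2 ⟨hu, hux⟩) v ((hS' v).2 ⟨hv, hvX⟩) huv

/-- A pentagon has nothing on the side away from the apex. -/
theorem MinCE.pentagon (M : MinCE Γ z S B L p φ) (hx : PD (Apex Γ z S B) s x)
    {c₀ c₁ c₂ c₃ c₄ : V} (nd : [c₀, c₁, c₂, c₃, c₄].Nodup)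
    (hS : ∀ c ∈ [c₀, c₁, c₂, c₃, c₄], c ∈ S) (h₀ : Γ.Adj c₀ c₁) (h₁ : Γ.Adj c₁ c₂)
    (h₂ : Γ.Adj c₂ c₃) (h₃ : Γ.Adj c₃ c₄) (h₄ : Γ.Adj c₄ c₀) :
    ∀ b ∈ S, b ∉ [c₀, c₁, c₂, c₃, c₄] →
      winding x [c₀, c₁, c₂, c₃, c₄, c₀] b = winding x [c₀, c₁, c₂, c₃, c₄, c₀] z := by
  classical
  by_contra! hcon
  obtain ⟨e, heS, heC, hee⟩ := hcon
  have hzS := M.disc.apex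
  have hch : [c₀, c₁, c₂, c₃, c₄, c₀].IsChain (Apex Γ z S B) := by
    simp only [List.mem_cons, List.not_mem_nil, or_false, forall_eq_or_imp, forall_eq] at hS
    simp only [List.isChain_cons_cons, List.isChain_singleton, and_true]
    exact ⟨Or.inl ⟨hS.1, hS.2.1, h₀⟩, Or.inl ⟨hS.2.1, hS.2.2.1, h₁⟩,
      Or.inl ⟨hS.2.2.1, hS.2.2.2.1, h₂⟩, Or.inl ⟨hS.2.2.2.1, hS.2.2.2.2, h₃⟩,
      Or.inl ⟨hS.2.2.2.2, hS.1, h₄⟩⟩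
  have hzC : z ∉ [c₀, c₁, c₂, c₃, c₄] := fun h => hzS (hS z h)
  have hconst : ∀ c d, Apex Γ z S B c d → c ∉ [c₀, c₁, c₂, c₃, c₄] → d ∉ [c₀, c₁, c₂, c₃, c₄] →
      winding x [c₀, c₁, c₂, c₃, c₄, c₀] c = winding x [c₀, c₁, c₂, c₃, c₄, c₀] d := by
    intro c d hcd hc hd
    refine winding_eq_of_adj hx hcd c₀ [c₁, c₂, c₃, c₄, c₀] hch ?_ ?_ ?_
    · simp at hc ⊢
      tauto
    · simp at hd ⊢
      tauto
    · simp
  set W := winding x [c₀, c₁, c₂, c₃, c₄, c₀] with hW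
  let E := S.filter fun b => b ∉ [c₀, c₁, c₂, c₃, c₄] ∧ W b ≠ W z
  have hE : ∀ b, b ∈ E ↔ b ∈ S ∧ b ∉ [c₀, c₁, c₂, c₃, c₄] ∧ W b ≠ W z := by simp [E]
  have hEB : ∀ b ∈ E, b ∉ B := by
    intro b hb hbB
    have := (hE b).1 hb
    exact this.2.2 (hconst b z (Or.inr (Or.inr ⟨rfl, hbB⟩)) this.2.1 hzC)
  have hEp : ∀ b ∈ E, b ∉ p := fun b hb h => hEB b hb (M.sub b h)
  have hS₁ : ∀ v, v ∈ S \ E ↔ v ∈ S ∧ v ∉ E := fun v => Finset.mem_sdiff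
  have hT₁ : ∀ v, Two (S \ E) L p v → Two S L p v := fun v hv => ⟨((hS₁ v).1 hv.1).1, hv.2⟩
  have heE : e ∈ E := (hE e).2 ⟨heS, heC, hee⟩
  obtain ⟨ψ, e1, e2, e3⟩ := M.smaller z (S \ E) B L p φ
    (Finset.card_lt_card ⟨Finset.sdiff_subset, fun h => ((hS₁ e).1 (h heS)).2 heE⟩)
    ⟨M.disc.mono Finset.sdiff_subset subset_rfl
      fun v hv => (hS₁ v).2 ⟨M.disc.sub hv, fun h => hEB v h hv⟩, M.sub, M.nodup, M.chain, M.proper,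
    fun v hv => M.two_le v ((hS₁ v).1 hv).1, fun v hv => M.three_le v ((hS₁ v).1 hv).1,
    fun u v hu hv => M.indep u v (hT₁ u hu) (hT₁ v hv), fun v hv => M.avail v (hT₁ v hv),
    M.weight.mono hT₁⟩
  have hcE : ∀ c ∈ [c₀, c₁, c₂, c₃, c₄], c ∈ S \ E := fun c hc =>
    (hS₁ c).2 ⟨hS c hc, fun h => ((hE c).1 h).2.1 hc⟩
  let S₂ := S.filter fun v => v ∈ E ∨ v ∈ [c₁, c₂, c₃, c₄]
  let B₂ := S.filter fun v => (v ∈ E ∧ Γ.Adj c₀ v) ∨ v ∈ [c₁, c₂, c₃, c₄]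
  let L₂ : V → Finset ℕ := fun v => if Γ.Adj c₀ v then (L v).erase (ψ c₀) else L v
  have hS₂ : ∀ v, v ∈ S₂ ↔ v ∈ S ∧ (v ∈ E ∨ v ∈ [c₁, c₂, c₃, c₄]) := by
    intro v
    simp only [S₂, Finset.mem_filter]
  have hB₂ : ∀ v, v ∈ B₂ ↔ v ∈ S ∧ ((v ∈ E ∧ Γ.Adj c₀ v) ∨ v ∈ [c₁, c₂, c₃, c₄]) := by
    intro v
    simp only [B₂, Finset.mem_filter]
  have hc₀ : c₀ ∉ S₂ := by
    intro h
    rcases ((hS₂ c₀).1 h).2 with h | h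
    · exact ((hE c₀).1 h).2.1 (by simp)
    · exact (List.nodup_cons.1 nd).1 h
  have hmem : ∀ v ∈ S₂, v ∉ [c₁, c₂, c₃, c₄] → v ∈ E := fun v hv h =>
    ((hS₂ v).1 hv).2.resolve_right h
  have h3E : ∀ v ∈ E, 3 ≤ (L v).card := fun v hv => M.three_le v ((hE v).1 hv).1 (hEB v hv)
  have hT₂ : ∀ v, Two S₂ L₂ [c₁, c₂, c₃, c₄] v → v ∈ E ∧ Γ.Adj c₀ v := by
    rintro v ⟨h1, h2, h3⟩
    refine ⟨hmem v h1 h2, ?_⟩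
    by_contra h
    have := h3E v (hmem v h1 h2)
    simp only [L₂, h, if_false] at h3
    omega
  have h2le : ∀ v ∈ S₂, v ∉ [c₁, c₂, c₃, c₄] → 2 ≤ (L₂ v).card := by
    intro v hv hv'
    have := h3E v (hmem v hv hv')
    simp only [L₂]
    split_ifs
    · have := Finset.pred_card_le_card_erase (s := L v) (a := ψ c₀)
      omega
    · omega
  have hmC : ∀ c ∈ [c₁, c₂, c₃, c₄], c ∈ [c₀, c₁, c₂, c₃, c₄] := fun c hc => by simp [hc]
  have hext : Extends Γ S₂ L₂ [c₁, c₂, c₃, c₄] ψ := by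
    refine M.smaller c₀ S₂ B₂ L₂ [c₁, c₂, c₃, c₄] ψ
      (Finset.card_lt_card ⟨Finset.filter_subset _ _, fun h => hc₀ (h (hS c₀ (by simp)))⟩)
      ⟨?_, ?_, (List.nodup_cons.1 nd).2, by simp [h₁, h₂, h₃], ?_, h2le, ?_, ?_, ?_,
        Or.inl (by simp)⟩
    · refine hx.disc_of_pentagon M.girth nd hS h₀ h₁ h₂ h₃ h₄ (ω := W z + 1) ?_ ?_ ?_ ?_
      · intro v hv
        exact Finset.mem_erase.2 ⟨fun e => hc₀ (e ▸ hv), ((hS₂ v).1 hv).1⟩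
      · intro v hv hvC
        have := ((hE v).1 (hmem v hv fun h => hvC (hmC v h))).2.2
        change W v = W z + 1
        generalize W v = a at *
        generalize W z = b at *
        clear * - this
        revert a b
        decide
      · intro b hb
        rcases ((hB₂ b).1 hb).2 with h | h
        · exact Or.inl h.2
        · simp only [List.mem_cons, List.not_mem_nil, or_false] at h
          rcases h with rfl | rfl | rfl | rfl
          · exact Or.inl h₀
          · simp
          · simp
          · exact Or.inl h₄.symm
      · intro v hv
        have := (hB₂ v).1 hv
        exact (hS₂ v).2 ⟨this.1, this.2.imp_left And.left⟩
    · exact fun v hv => (hB₂ v).2 ⟨hS v (hmC v hv), Or.inr hv⟩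
    · exact fun u hu v hv => e3 u (hcE u (hmC u hu)) v (hcE v (hmC v hv))
    · intro v hv hvB
      have hvC : v ∉ [c₁, c₂, c₃, c₄] := fun h => hvB ((hB₂ v).2 ⟨((hS₂ v).1 hv).1, Or.inr h⟩)
      have hvE := hmem v hv hvC
      have : ¬ Γ.Adj c₀ v := fun h => hvB ((hB₂ v).2 ⟨((hS₂ v).1 hv).1, Or.inl ⟨hvE, h⟩⟩)
      simp only [L₂, this, if_false]
      exact h3E v hvE
    · intro u v hu hv huv
      exact M.girth.no_three _ _ _ (hT₂ u hu).2 huv (hT₂ v hv).2.symm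
    · intro v hv
      have hv' := hT₂ v hv
      obtain ⟨c, hc⟩ := Finset.card_pos.1 (lt_of_lt_of_le (by omega) (h2le v hv.1 hv.2.1))
      refine ⟨c, hc, fun u hu hvu => ?_⟩
      exfalso
      have hvC := ((hE v).1 hv'.1).2.1
      have n3 := M.girth.no_three c₀ v u hv'.2 hvu
      have n4 := M.girth.no_four c₀ v u
      simp only [List.mem_cons, List.not_mem_nil, or_false, not_or] at hvC hu
      simp only [List.nodup_cons, List.mem_cons, List.not_mem_nil, or_false, not_or] at nd
      rcases hu with rfl | rfl | rfl | rfl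
      · exact n3 h₀.symm
      · rcases n4 c₁ hv'.2 hvu h₁.symm h₀.symm with h | h <;> tauto
      · rcases n4 c₄ hv'.2 hvu h₃ h₄ with h | h <;> tauto
      · exact n3 h₄
  obtain ⟨ψ₂, g1, g2, g3⟩ := hext
  refine M.not_extends ⟨fun v => if v ∈ E then ψ₂ v else ψ v, ?_, ?_, ?_⟩
  · intro v hv
    have := hEp v
    grind
  · intro v hv hvp
    by_cases hvE : v ∈ E
    · simp only [hvE, if_true]
      have := g2 v ((hS₂ v).2 ⟨hv, Or.inl hvE⟩) fun h => ((hE v).1 hvE).2.1 (hmC v h)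
      simp only [L₂] at this
      split_ifs at this
      · exact Finset.mem_of_mem_erase this
      · exact this
    · simpa [hvE] using e2 v ((hS₁ v).2 ⟨hv, hvE⟩) hvp
  · have key : ∀ u ∈ E, ∀ v ∈ S, v ∉ E → Γ.Adj u v → ψ₂ u ≠ ψ v := by
      intro u hu v hv hvE huv
      have hu' := (hE u).1 hu
      have hu2 : u ∉ [c₁, c₂, c₃, c₄] := fun h => hu'.2.1 (hmC u h)
      by_cases hvC : v ∈ [c₀, c₁, c₂, c₃, c₄]
      · rcases List.mem_cons.1 hvC with rfl | hvC'
        · have := g2 u ((hS₂ u).2 ⟨hu'.1, Or.inl hu⟩) hu2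
          simp only [L₂, huv.symm, if_true] at this
          exact Finset.ne_of_mem_erase this
        · rw [← g1 v hvC']
          exact g3 u ((hS₂ u).2 ⟨hu'.1, Or.inl hu⟩) v ((hS₂ v).2 ⟨hv, Or.inr hvC'⟩) huv
      · refine absurd ((hE v).2 ⟨hv, hvC, ?_⟩) hvE
        rw [← hconst u v (Or.inl ⟨hu'.1, hv, huv⟩) hu'.2.1 hvC]
        exact hu'.2.2
    intro u hu v hv huv
    by_cases hux : u ∈ E <;> by_cases hvX : v ∈ E
    · simpa [hux, hvX] using g3 u ((hS₂ u).2 ⟨hu, Or.inl hux⟩) v ((hS₂ v).2 ⟨hv, Or.inl hvX⟩) huv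
    · simpa [hux, hvX] using key u hux v hv hvX huv
    · simpa [hux, hvX] using (key v hvX u hu hux huv.symm).symm
    · simpa [hux, hvX] using e3 u ((hS₁ u).2 ⟨hu, hux⟩) v ((hS₁ v).2 ⟨hv, hvX⟩) huv

/-- Two pentagons sharing a path of length two do not form a theta graph whose third cycle
separates the shared vertex from the apex. -/
theorem MinCE.theta (M : MinCE Γ z S B L p φ) {r t a b b' c c' : V}
    (nd : [r, t, a, b, b', c, c'].Nodup) (hS : ∀ v ∈ [r, t, a, b, b', c, c'], v ∈ S)
    (ra : Γ.Adj r a) (at' : Γ.Adj a t) (rb : Γ.Adj r b) (bb : Γ.Adj b b') (bt : Γ.Adj b' t)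
    (rc : Γ.Adj r c) (cc : Γ.Adj c c') (ct : Γ.Adj c' t)
    (ha : a ∈ B ∨ ∃ a' ∈ S, Γ.Adj a a' ∧ a' ∉ [r, t, a, b, b', c, c']) : False := by
  obtain ⟨s, x, hx⟩ := M.disc.planar
  have hzS := M.disc.apex
  have hz : ∀ v ∈ S, z ≠ v := fun v hv e => hzS (e ▸ hv)
  have th := hx.theta_winding (p := r) (r := t) (a := a) (b := b) (b' := b') (c := c) (c' := c') nd
  have ad := winding_theta_add hx r t a b b' c c'
  simp only [List.mem_cons, List.not_mem_nil, or_false, forall_eq_or_imp, forall_eq] at hS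
  obtain ⟨sr, st, sa, sb, sb', sc, sc'⟩ := hS
  have th := th (Or.inl ⟨sr, sa, ra⟩) (Or.inl ⟨sa, st, at'⟩) (Or.inl ⟨sr, sb, rb⟩)
    (Or.inl ⟨sb, sb', bb⟩) (Or.inl ⟨sb', st, bt⟩) (Or.inl ⟨sr, sc, rc⟩) (Or.inl ⟨sc, sc', cc⟩)
    (Or.inl ⟨sc', st, ct⟩)
  simp only [List.nodup_cons, List.mem_cons, List.not_mem_nil, or_false, not_or,
    List.nodup_nil, not_false_eq_true, and_true] at nd
  have p1 := M.pentagon hx (c₀ := r) (c₁ := a) (c₂ := t) (c₃ := b') (c₄ := b)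
    (by simp; grind) (by simp; grind) ra at' bt.symm bb.symm rb.symm
  have p2 := M.pentagon hx (c₀ := r) (c₁ := a) (c₂ := t) (c₃ := c') (c₄ := c)
    (by simp; grind) (by simp; grind) ra at' ct.symm cc.symm rc.symm
  have hch : [r, b, b', t, c', c, r].IsChain (Apex Γ z S B) := by
    simp only [List.isChain_cons_cons, List.isChain_singleton, and_true]
    exact ⟨Or.inl ⟨sr, sb, rb⟩, Or.inl ⟨sb, sb', bb⟩, Or.inl ⟨sb', st, bt⟩,
      Or.inl ⟨st, sc', ct.symm⟩, Or.inl ⟨sc', sc, cc.symm⟩, Or.inl ⟨sc, sr, rc.symm⟩⟩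
  have hconst : ∀ d, Apex Γ z S B a d → d ∉ [r, b, b', t, c', c] →
      winding x [r, b, b', t, c', c, r] a = winding x [r, b, b', t, c', c, r] d := by
    intro d hcd hd
    refine winding_eq_of_adj hx hcd r [b, b', t, c', c, r] hch ?_ ?_ ?_
    · simp
      grind
    · simp at hd ⊢
      tauto
    · simp
  have q1 := p1 c sc (by simp; grind)
  have q2 := p2 b sb (by simp; grind)
  rw [q1, q2] at th
  have az := ad z
  rcases ha with ha | ⟨a', sa', haa, ha'⟩
  · rw [hconst z (Or.inr (Or.inr ⟨rfl, ha⟩)) (by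
      have := hz r sr; have := hz t st; have := hz b sb; have := hz b' sb'
      have := hz c sc; have := hz c' sc'
      simp
      tauto)] at th
    rw [az] at th
    exact absurd th (by decide)
  · simp only [List.mem_cons, List.not_mem_nil, or_false, not_or] at ha'
    rw [hconst a' (Or.inl ⟨sa, sa', haa⟩) (by simp; tauto)] at th
    have q3 := p1 a' sa' (by simp; tauto)
    have q4 := p2 a' sa' (by simp; tauto)
    have ad' := ad a'
    rw [← q3, ← q4] at th
    rw [ad'] at th
    exact absurd th (by decide)

/-- A vertex off a path on at most six vertices has two neighbours inside the path only if these
are the second and the fifth vertex. -/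
theorem GirthFive.exists_eq_six (hΓ : GirthFive Γ) (hp : p.IsChain Γ.Adj) (nd : p.Nodup)
    (hlen : p.length ≤ 6) {n u v : V} (hn : n ∉ p) (huv : u ≠ v)
    (nu : Γ.Adj n u) (nv : Γ.Adj n v) (ou : ¬ Outer p u) (ov : ¬ Outer p v) :
    ∃ a b c d e f, p = [a, b, c, d, e, f] ∧ (u = b ∧ v = e ∨ u = e ∧ v = b) := by
  have g3 := hΓ.no_three n u v nu
  have g3' := hΓ.no_three n v u nv
  have g4 := fun w => hΓ.no_four n u w v nu
  unfold Outer at ou ov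
  push Not at ou ov
  have hc := Γ.adj_comm
  match p, hlen with
  | [], _ => simp at ou
  | [a], _ => simp at ou; grind
  | [a, b], _ => simp at ou; grind
  | [a, b, c], _ => simp at ou ov; grind
  | [a, b, c, d], _ => simp at ou ov hp; grind
  | [a, b, c, d, e], _ => simp at ou ov hp nd hn; grind
  | [a, b, c, d, e, f], _ =>
    refine ⟨a, b, c, d, e, f, rfl, ?_⟩
    simp only [List.isChain_cons_cons, List.isChain_singleton, and_true] at hp
    simp only [List.nodup_cons, List.mem_cons, List.not_mem_nil, or_false, not_or] at nd hn
    simp only [List.mem_cons, List.not_mem_nil, or_false, List.head?_cons,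
      List.getLast?_cons_cons, List.getLast?_singleton, ne_eq, Option.some.injEq] at ou ov
    obtain ⟨hu, hua, huf⟩ := ou
    obtain ⟨hv, hva, hvf⟩ := ov
    have gc := g4 c
    have gd := g4 d
    rcases hu with rfl | rfl | rfl | rfl | rfl | rfl <;>
      rcases hv with rfl | rfl | rfl | rfl | rfl | rfl <;> grind

/-- A vertex joined to the last vertex of a path on at most six vertices has at most one more
neighbour on the path. -/
theorem GirthFive.eq_of_adj_last (hΓ : GirthFive Γ) {l : List V} {v n u w : V}
    (hp : (l ++ [v]).IsChain Γ.Adj) (nd : (l ++ [v]).Nodup) (hlen : l.length ≤ 5)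
    (hn : n ∉ l ++ [v]) (hv : Γ.Adj n v) (hu : u ∈ l) (hw : w ∈ l) (nu : Γ.Adj n u)
    (nw : Γ.Adj n w) : u = w := by
  by_contra huw
  have g3 := hΓ.no_three n u w nu
  have g3' := hΓ.no_three n w u nw
  have g4 := fun y => hΓ.no_four n u y w nu
  have k3 := hΓ.no_three n u v nu
  have k4 := fun y => hΓ.no_four n u y v nu
  have k3' := hΓ.no_three n w v nw
  have k4' := fun y => hΓ.no_four n w y v nw
  have hc := Γ.adj_comm
  match l, hlen with
  | [], _ => simp at hu
  | [a], _ => simp at hu hw; grind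
  | [a, b], _ => simp at hu hw hp; grind
  | [a, b, c], _ => simp at hu hw hp nd hn; grind
  | [a, b, c, d], _ =>
    simp at hu hw hp nd hn
    have := k4 d
    have := k4' d
    have := g4 b
    grind
  | [a, b, c, d, e], _ =>
    simp at hu hw hp nd hn
    have := k4 e
    have := k4' e
    have := g4 b
    rcases hu with rfl | rfl | rfl | rfl | rfl <;> grind

theorem MinCE.notMem_path (M : MinCE Γ z S B L p φ) {n : V} (hn : n ∉ B) : n ∉ p :=
  fun h => hn (M.sub n h)

section Neighbour

variable {g n m : V}

theorem MinCE.not_adj_two (M : MinCE Γ z S B L p φ) (hg : g ∈ B) (hgp : g ∉ p) (hn : n ∈ S)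
    (hnB : n ∉ B) (gn : Γ.Adj g n) {b : V} (hb : Two S L p b) (hbg : b ≠ g) : ¬ Γ.Adj n b :=
  fun h => hnB (M.mem_of_two_chord hg (hb.mem_boundary M) hbg.symm hn (M.notMem_path hnB) gn h
    (outer_of_notMem hgp) (outer_of_notMem hb.2.1))

theorem MinCE.not_adj_outer (M : MinCE Γ z S B L p φ) (hg : g ∈ B) (hgp : g ∉ p) (hn : n ∈ S)
    (hnB : n ∉ B) (gn : Γ.Adj g n) {v : V} (hv : v ∈ p) (ho : Outer p v) : ¬ Γ.Adj n v :=
  fun h => hnB (M.mem_of_two_chord hg (M.sub v hv) (fun e => hgp (e ▸ hv)) hn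
    (M.notMem_path hnB) gn h (outer_of_notMem hgp) ho)

theorem MinCE.not_adj_near_end (M : MinCE Γ z S B L p φ) (hg : g ∈ B) (hgp : g ∉ p) (hn : n ∈ S)
    (hnB : n ∉ B) (gn : Γ.Adj g n) {l₁ l₂ : List V} {v : V} (hp : p = l₁ ++ v :: l₂)
    (hl : l₂.length ≤ 2) (h₁ : ∀ w ∈ l₂, ¬ Γ.Adj g w) (h₂ : ∀ w ∈ l₂, ¬ Γ.Adj n w) :
    ¬ Γ.Adj n v := by
  intro nv
  have hnp := M.notMem_path hnB
  have hv : v ∈ p := by simp [hp]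
  refine hnB (M.mem_of_chord_near_end (Q := [g, n]) hp ⟨by simp, ?_, by simp [gn, nv], ?_, ?_, ?_⟩
    (by simp [hgp, hnp]) (by simp) (by simp) (by simp; omega) (by simpa using ⟨h₁, h₂⟩)
    (fun t ht htQ => M.avail_pair gn t ht htQ) n (by simp))
  · simp [gn.ne, nv.ne]
    rintro rfl
    exact hgp hv
  · simp [M.disc.sub hg, hn, M.mem_S hv]
  · simpa using hg
  · simpa using M.sub v hv

theorem MinCE.eq_of_adj_path (M : MinCE Γ z S B L p φ) (hg : g ∈ B) (hgp : g ∉ p) (hn : n ∈ S)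
    (hnB : n ∉ B) (gn : Γ.Adj g n) {u v : V} (hu : u ∈ p) (hv : v ∈ p) (nu : Γ.Adj n u)
    (nv : Γ.Adj n v) : u = v := by
  by_contra huv
  have hnp := M.notMem_path hnB
  obtain ⟨a, b, c, d, e, f, hp, h⟩ := M.girth.exists_eq_six M.chain M.nodup M.weight.length_le
    hnp huv nu nv (fun h => M.not_adj_outer hg hgp hn hnB gn hu h nu)
    (fun h => M.not_adj_outer hg hgp hn hnB gn hv h nv)
  have hch := M.chain
  rw [hp] at hch
  simp only [List.isChain_cons_cons, List.isChain_singleton, and_true] at hch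
  have ne : Γ.Adj n e := by
    rcases h with ⟨rfl, rfl⟩ | ⟨rfl, rfl⟩ <;> assumption
  have nf : ¬ Γ.Adj n f := fun h => M.girth.no_three _ _ _ ne hch.2.2.2.2 h.symm
  refine M.not_adj_near_end hg hgp hn hnB gn (l₁ := [a, b, c, d]) (l₂ := [f]) (by simp [hp])
    (by simp) ?_ (by simpa using nf) ne
  simp only [List.mem_singleton, forall_eq]
  intro gf
  rcases M.girth.no_four _ _ _ _ gn ne hch.2.2.2.2 gf.symm with rfl | rfl
  · simp [hp] at hgp
  · simp [hp] at hnp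

theorem MinCE.not_adj_two_of_two_steps (M : MinCE Γ z S B L p φ) (hg : g ∈ B) (hgp : g ∉ p)
    (hn : n ∈ S) (hnB : n ∉ B) (gn : Γ.Adj g n) (hm : m ∈ S) (hmp : m ∉ p) (hmg : m ≠ g)
    (nm : Γ.Adj n m) {b : V} (hb : Two S L p b) : ¬ Γ.Adj m b :=
  fun h => hnB (M.mem_of_three_chord hg (hb.mem_boundary M) hn (M.notMem_path hnB) hm hmp gn nm h
    hmg.symm (fun e => hnB (e ▸ hb.mem_boundary M)) (outer_of_notMem hgp)
    (outer_of_notMem hb.2.1) fun v hv => M.indep v b hv hb)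

theorem MinCE.not_adj_outer_of_two_steps (M : MinCE Γ z S B L p φ) (hg : g ∈ B) (hgp : g ∉ p)
    (hn : n ∈ S) (hnB : n ∉ B) (gn : Γ.Adj g n) (hm : m ∈ S) (hmp : m ∉ p) (hmg : m ≠ g)
    (nm : Γ.Adj n m) {v : V} (hv : v ∈ p) (ho : Outer p v) : ¬ Γ.Adj m v :=
  fun h => hnB (M.mem_of_three_chord hg (M.sub v hv) hn (M.notMem_path hnB) hm hmp gn nm h
    hmg.symm (fun e => hnB (e ▸ M.sub v hv)) (outer_of_notMem hgp) ho
    fun _ ht => M.two_not_adj ht hv)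

theorem MinCE.false_of_adj_fifth_of_two_steps (M : MinCE Γ z S B L p φ) (hg : g ∈ B) (hgp : g ∉ p)
    (hn : n ∈ S) (hnB : n ∉ B) (gn : Γ.Adj g n) (hm : m ∈ S) (hmp : m ∉ p) (hmg : m ≠ g)
    (nm : Γ.Adj n m) {a b c d e f : V} (hp : p = [a, b, c, d, e, f]) (me : Γ.Adj m e)
    (hgf : ¬ Γ.Adj g f) : False := by
  have hfp : f ∈ p := by simp [hp]
  have hep : e ∈ p := by simp [hp]
  have hf : Outer p f := fun _ => Or.inr (by simp [hp])
  have hnp := M.notMem_path hnB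
  have k1 := M.not_adj_outer hg hgp hn hnB gn hfp hf
  have k2 := M.not_adj_outer_of_two_steps hg hgp hn hnB gn hm hmp hmg nm hfp hf
  refine hnB (M.mem_of_chord_near_end (Q := [g, n, m]) (l₁ := [a, b, c, d]) (v := e) (l₂ := [f])
    (by simp [hp]) ⟨by simp, ?_, by simp [gn, nm, me], ?_, ?_, ?_⟩
    (by simp [hgp, hnp, hmp]) (by simp) (by simp) (by simp) ?_ ?_ n (by simp))
  · simp [gn.ne, nm.ne, me.ne, hmg.symm]
    constructor
    · rintro rfl
      exact hgp hep
    · rintro rfl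
      exact hnp hep
  · simp [M.disc.sub hg, hn, hm, M.mem_S hep]
  · simpa using hg
  · simpa using M.sub e hep
  · simpa using ⟨hgf, k1, k2⟩
  · intro t ht htQ u hu v hv tu tv
    simp only [List.mem_cons, List.not_mem_nil, or_false, not_or] at hu hv htQ
    have k3 := M.not_adj_two hg hgp hn hnB gn ht htQ.1
    have k4 := M.not_adj_two_of_two_steps hg hgp hn hnB gn hm hmp hmg nm ht
    have := Γ.adj_comm
    grind

theorem MinCE.eq_of_adj_path_of_two_steps (M : MinCE Γ z S B L p φ) (hg : g ∈ B) (hgp : g ∉ p)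
    (hn : n ∈ S) (hnB : n ∉ B) (gn : Γ.Adj g n) (hm : m ∈ S) (hmp : m ∉ p) (hmg : m ≠ g)
    (nm : Γ.Adj n m) (hgu : ∀ u ∈ p, ∀ v ∈ p, Γ.Adj g u → Γ.Adj g v → u = v) {u v : V}
    (hu : u ∈ p) (hv : v ∈ p) (mu : Γ.Adj m u) (mv : Γ.Adj m v) : u = v := by
  by_contra huv
  obtain ⟨a, b, c, d, e, f, hp, h⟩ := M.girth.exists_eq_six M.chain M.nodup M.weight.length_le
    hmp huv mu mv
    (fun h => M.not_adj_outer_of_two_steps hg hgp hn hnB gn hm hmp hmg nm hu h mu)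
    (fun h => M.not_adj_outer_of_two_steps hg hgp hn hnB gn hm hmp hmg nm hv h mv)
  have me : Γ.Adj m e ∧ Γ.Adj m b := by
    rcases h with ⟨rfl, rfl⟩ | ⟨rfl, rfl⟩ <;> constructor <;> assumption
  by_cases hgf : Γ.Adj g f
  · have hga : ¬ Γ.Adj g a := by
      intro hga
      have := hgu a (by simp [hp]) f (by simp [hp]) hga hgf
      have nd := M.nodup
      simp [hp, this] at nd
    exact M.reverse.false_of_adj_fifth_of_two_steps hg (by simpa using hgp) hn hnB gn hm
      (by simpa using hmp) hmg nm (a := f) (b := e) (c := d) (d := c) (e := b) (f := a)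
      (by simp [hp]) me.2 hga
  · exact M.false_of_adj_fifth_of_two_steps hg hgp hn hnB gn hm hmp hmg nm hp me.1 hgf

end Neighbour

/-- The end of the path has a boundary neighbour that is joined to a vertex with two colours. -/
theorem MinCE.exists_hook (M : MinCE Γ z S B L p φ) {l : List V} {v : V} (hp : p = l ++ [v]) :
    ∃ x₁ a₁, x₁ ∈ B ∧ x₁ ∉ p ∧ Γ.Adj x₁ v ∧ Two S L p a₁ ∧ Γ.Adj x₁ a₁ := by
  by_contra! hcon
  have nd := M.nodup
  have hch := M.chain
  have hvp : v ∈ p := by simp [hp]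
  have hlen := M.weight.length_le
  have nd' := nd
  have hch' := hch
  rw [hp] at nd' hch'
  have hlen' : l.length ≤ 5 := by
    rw [hp] at hlen
    simp at hlen
    omega
  have hT : ∀ t, Touched Γ S L p [v] φ t → t ∈ S ∧ t ∉ p ∧ Γ.Adj v t := by
    rintro t ⟨h1, -, h2, u, hu, huv, -⟩
    rw [List.mem_singleton.1 hu] at huv
    exact ⟨h1, h2, huv⟩
  have hvl : v ∉ l := by
    rw [List.nodup_append] at nd'
    exact fun h => nd'.2.2 v h v (by simp) rfl
  have hl : ∀ u ∈ l, u ∈ p := fun u hu => by simp [hp, hu]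
  refine M.delete (X := [v]) (p' := l) (χ := φ) (by simp) (by simp) (by simpa using M.mem_S hvp)
    ⟨M.sub v hvp, trivial⟩ ?_ (List.nodup_append.1 nd').1 hch'.left_of_append (fun _ _ _ => rfl)
    (by simp [hvp]) ?_ ?_ ?_ ?_ ?_ ?_ ?_ ?_
  · intro u
    simp only [hp, List.mem_append, List.mem_singleton]
    grind
  · simp
  · simp only [List.mem_singleton, forall_eq]
    exact fun u hu h => M.proper v hvp u (hl u hu) h
  · simp
  · exact fun t ht h => M.two_not_adj h hvp (hT t ht).2.2.symm
  · exact fun t t' ht ht' h => M.girth.no_three _ _ _ (hT t ht).2.2 h (hT t' ht').2.2.symm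
  · intro t b ht hb _ htb
    obtain ⟨h1, h2, h3⟩ := hT t ht
    refine hcon t b (M.mem_of_two_chord (M.sub v hvp) (hb.mem_boundary M) ?_ h1 h2 h3 htb ?_
      (outer_of_notMem hb.2.1)) h2 h3.symm hb htb
    · rintro rfl
      exact hb.2.1 hvp
    · exact fun _ => Or.inr (by simp [hp])
  · refine Or.inr (Or.inl ⟨hlen', Or.inr ?_⟩)
    intro u hu t ht hut
    exact M.girth.no_three _ _ _ ((List.isChain_append.1 hch').2.2 u hu v (by simp)) (hT t ht).2.2
      hut.symm
  · intro t ht u hu w hw tu tw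
    obtain ⟨h1, h2, h3⟩ := hT t ht
    exact M.girth.eq_of_adj_last hch' nd' hlen' (hp ▸ h2) h3.symm hu hw tu tw

/-- After deleting `X`, the list of the vertex `t` may lose one colour. -/
structure Calm (Γ : SimpleGraph V) (S : Finset V) (L : V → Finset ℕ) (p X : List V) (t : V) :
    Prop where
  not_two : ¬ Two S L p t
  not_adj_two : ∀ b, Two S L p b → b ∉ X → ¬ Γ.Adj t b
  eq_of_adj : ∀ u ∈ p, ∀ v ∈ p, Γ.Adj t u → Γ.Adj t v → u = v

theorem MinCE.delete_off_path (M : MinCE Γ z S B L p φ) {X : List V} {χ : V → ℕ} (hXne : X ≠ [])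
    (nd : X.Nodup) (hXS : ∀ v ∈ X, v ∈ S) (hX : Peelable Γ (· ∈ B) X) (hXp : ∀ v ∈ X, v ∉ p)
    (hχL : ∀ v ∈ X, χ v ∈ L v) (proper : ∀ u ∈ X, ∀ v ∈ X, Γ.Adj u v → χ u ≠ χ v)
    (proper' : ∀ u ∈ X, ∀ v ∈ p, Γ.Adj u v → χ u ≠ φ v)
    (d₁ : ∀ t, Touched Γ S L p X χ t → ∀ u ∈ X, ∀ v ∈ X, Γ.Adj u t → Γ.Adj v t → u = v)
    (calm : ∀ t, Touched Γ S L p X χ t → Calm Γ S L p X t)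
    (d₃ : ∀ t t', Touched Γ S L p X χ t → Touched Γ S L p X χ t' → ¬ Γ.Adj t t')
    (d₅ : Weight Γ (Touched Γ S L p X χ) p) : False :=
  M.delete hXne nd hXS hX (fun v => ⟨fun h => ⟨h, fun h' => hXp v h' h⟩, fun h => h.1⟩) M.nodup
    M.chain (fun v hv h => absurd h (hXp v hv)) (fun v hv _ => hχL v hv) proper proper' d₁
    (fun t ht => (calm t ht).not_two) d₃ (fun t b ht => (calm t ht).not_adj_two b) d₅
    (fun t ht => (calm t ht).eq_of_adj)

theorem Weight.of_not_adj {T : V → Prop} (hlen : p.length ≤ 6)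
    (h : ∀ t, T t → ∀ v ∈ p, Outer p v → ¬ Γ.Adj t v) : Weight Γ T p :=
  Or.inr (Or.inr ⟨hlen,
    fun u hu t ht hut => h t ht u (List.mem_of_mem_head? hu) (fun _ => Or.inl hu) hut.symm,
    fun u hu t ht hut => h t ht u (List.mem_of_mem_getLast? hu) (fun _ => Or.inr hu) hut.symm⟩)

section Neighbour

variable {g n m : V}

theorem MinCE.calm (M : MinCE Γ z S B L p φ) {X : List V} (hg : g ∈ B) (hgp : g ∉ p)
    (hgX : g ∈ X) (hn : n ∈ S) (hnB : n ∉ B) (gn : Γ.Adj g n) : Calm Γ S L p X n where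
  not_two h := hnB (h.mem_boundary M)
  not_adj_two _ hb hbX := M.not_adj_two hg hgp hn hnB gn hb fun e => hbX (e ▸ hgX)
  eq_of_adj _ hu _ hv nu nv := M.eq_of_adj_path hg hgp hn hnB gn hu hv nu nv

/-- A boundary vertex cannot be given a colour that is missing from the lists of its boundary
neighbours. -/
theorem MinCE.mem_of_color (M : MinCE Γ z S B L p φ) (hg : g ∈ B) (hgp : g ∉ p) {c : ℕ}
    (hc : c ∈ L g) (hφ : ∀ u ∈ p, Γ.Adj g u → c ≠ φ u) :
    ∃ b ∈ B, b ∉ p ∧ Γ.Adj g b ∧ c ∈ L b := by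
  by_contra! hb
  have hT : ∀ t, Touched Γ S L p [g] (fun _ => c) t → t ∈ S ∧ t ∉ B ∧ Γ.Adj g t := by
    rintro t ⟨h1, h2, h3, u, hu, h4, h5⟩
    rw [List.mem_singleton.1 hu] at h4
    exact ⟨h1, fun h => hb t h h3 h4 h5, h4⟩
  refine M.delete_off_path (X := [g]) (χ := fun _ => c) (by simp) (by simp)
    (by simpa using M.disc.sub hg) ⟨hg, trivial⟩ (by simpa using hgp) (by simpa using hc) (by simp)
    (by simpa using hφ) (by simp) ?_ ?_ ?_
  · exact fun t ht => M.calm hg hgp (by simp) (hT t ht).1 (hT t ht).2.1 (hT t ht).2.2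
  · exact fun t t' ht ht' h => M.girth.no_three _ _ _ (hT t ht).2.2 h (hT t' ht').2.2.symm
  · exact .of_not_adj M.weight.length_le fun t ht v hv ho =>
      M.not_adj_outer hg hgp (hT t ht).1 (hT t ht).2.1 (hT t ht).2.2 hv ho

end Neighbour

/-- `x₁` and `a₁` are the two boundary vertices following the end `v` of the path, and `a₁` has
two colours. -/
structure Hook (Γ : SimpleGraph V) (S B : Finset V) (L : V → Finset ℕ) (p : List V)
    (v x₁ a₁ : V) : Prop where
  last : p.getLast? = some v
  mem : x₁ ∈ B
  notMem : x₁ ∉ p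
  adj : Γ.Adj x₁ v
  two : Two S L p a₁
  adj' : Γ.Adj x₁ a₁

section Hook

variable {v x₁ a₁ : V}

theorem Hook.mem_path (H : Hook Γ S B L p v x₁ a₁) : v ∈ p :=
  List.mem_of_mem_getLast? H.last

theorem Hook.eq_or_eq (H : Hook Γ S B L p v x₁ a₁) (M : MinCE Γ z S B L p φ) {b : V} (hb : b ∈ B)
    (h : Γ.Adj x₁ b) : b = v ∨ b = a₁ :=
  M.eq_or_eq H.mem H.notMem (M.sub v H.mem_path) (H.two.mem_boundary M) hb H.adj H.adj' h
    fun e => H.two.2.1 (e ▸ H.mem_path)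

theorem Hook.eq_of_mem (H : Hook Γ S B L p v x₁ a₁) (M : MinCE Γ z S B L p φ) {b : V} (hb : b ∈ p)
    (h : Γ.Adj x₁ b) : b = v :=
  (H.eq_or_eq M (M.sub b hb) h).resolve_right fun e => H.two.2.1 (e ▸ hb)

theorem Hook.three_le (H : Hook Γ S B L p v x₁ a₁) (M : MinCE Γ z S B L p φ) :
    3 ≤ (L x₁).card := by
  by_contra h
  exact M.two_not_adj ⟨M.disc.sub H.mem, H.notMem, by omega⟩ H.mem_path H.adj

theorem MinCE.card_eq_two (M : MinCE Γ z S B L p φ) {a : V} (ha : Two S L p a) :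
    (L a).card = 2 := by
  have := M.two_le a ha.1 ha.2.1
  have := ha.2.2
  omega

/-- Some neighbour of `a₁` other than `x₁` sees another vertex with two colours, or the other end
of a path on six vertices. -/
theorem Hook.exists_next (H : Hook Γ S B L p v x₁ a₁) (M : MinCE Γ z S B L p φ) :
    ∃ y₁ w, y₁ ∈ S ∧ y₁ ≠ x₁ ∧ Γ.Adj a₁ y₁ ∧ Γ.Adj y₁ w ∧
      ((Two S L p w ∧ w ≠ a₁) ∨ (p.length = 6 ∧ p.head? = some w)) := by
  by_contra! hcon
  have haB := H.two.mem_boundary M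
  have hap := H.two.2.1
  obtain ⟨c, hc, hcv⟩ := Finset.exists_mem_ne (s := L x₁) (by have := H.three_le M; omega) (φ v)
  obtain ⟨d, hd, hdc⟩ := Finset.exists_mem_ne (s := L a₁) (by have := M.card_eq_two H.two; omega) c
  have hxa := H.adj'.ne
  obtain ⟨χ, hχx, hχa⟩ : ∃ χ : V → ℕ, χ x₁ = c ∧ χ a₁ = d :=
    ⟨fun t => if t = x₁ then c else d, by simp, by simp [hxa.symm]⟩
  have hT : ∀ t, Touched Γ S L p [x₁, a₁] χ t → t ∈ S ∧ t ≠ x₁ ∧ t ≠ a₁ ∧ t ∉ p ∧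
      ((t ∉ B ∧ Γ.Adj x₁ t) ∨ Γ.Adj a₁ t) := by
    rintro t ⟨h1, h2, h3, u, hu, h4, -⟩
    simp only [List.mem_cons, List.not_mem_nil, or_false, not_or] at h2 hu
    refine ⟨h1, h2.1, h2.2, h3, ?_⟩
    rcases hu with rfl | rfl
    · refine Or.inl ⟨fun hB => ?_, h4⟩
      rcases H.eq_or_eq M hB h4 with rfl | rfl
      · exact h3 H.mem_path
      · exact h2.2 rfl
    · exact Or.inr h4
  have hcomm := Γ.adj_comm
  have g3 := M.girth.no_three
  have g4 := M.girth.no_four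
  have hxp := H.notMem
  have hlast : ∀ t, Touched Γ S L p [x₁, a₁] χ t → ¬ Γ.Adj t v := by
    intro t ht htv
    obtain ⟨h1, h2, h3, h4, h5⟩ := hT t ht
    rcases h5 with ⟨-, h5⟩ | h5
    · exact g3 _ _ _ h5 htv H.adj.symm
    · rcases g4 _ _ _ _ H.adj' h5 htv H.adj.symm with rfl | rfl
      · exact h2 rfl
      · exact hap H.mem_path
  refine M.delete_off_path (X := [x₁, a₁]) (χ := χ) (by simp) (by simp [hxa])
    (by simp [M.disc.sub H.mem, H.two.1]) ⟨H.mem, Or.inl haB, trivial⟩ (by simp [H.notMem, hap])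
    (by simp [hχx, hχa, hc, hd]) (by simp [hχx, hχa, hdc, hdc.symm]) ?_ ?_ ?_ ?_ ?_
  · simp only [List.mem_cons, List.not_mem_nil, or_false, forall_eq_or_imp, forall_eq]
    refine ⟨fun u hu h => ?_, fun u hu h => absurd h (M.two_not_adj H.two hu)⟩
    rw [H.eq_of_mem M hu h, hχx]
    exact hcv
  · intro t _ u hu v hv ut vt
    simp only [List.mem_cons, List.not_mem_nil, or_false] at hu hv
    have := H.adj'
    grind
  · intro t ht
    obtain ⟨h1, h2, h3, h4, h5⟩ := hT t ht
    rcases h5 with ⟨h5, h6⟩ | h5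
    · exact M.calm H.mem H.notMem (by simp) h1 h5 h6
    by_cases htB : t ∈ B
    · refine ⟨fun h => M.indep _ _ H.two h h5, fun b hb hbX htb => ?_, fun u hu u' hu' tu tu' => ?_⟩
      · obtain rfl := (hcon t b h1 h2 h5 htb).1 hb
        simp at hbX
      · refine ((M.eq_or_eq htB h4 haB (M.sub u hu) (M.sub u' hu') h5.symm tu tu' ?_).resolve_left
          ?_).symm
        · rintro rfl; exact hap hu
        · rintro rfl; exact hap hu'
    · exact M.calm haB hap (by simp) h1 htB h5
  · intro t t' ht ht' htt
    obtain ⟨h1, h2, h3, h4, h5⟩ := hT t ht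
    obtain ⟨k1, k2, k3, k4, k5⟩ := hT t' ht'
    have := H.adj'
    rcases h5 with ⟨-, h5⟩ | h5 <;> rcases k5 with ⟨-, k5⟩ | k5 <;> grind
  · have hlen := M.weight.length_le
    by_cases h6 : p.length = 6
    · refine Or.inr (Or.inr ⟨hlen, ?_, ?_⟩)
      · intro u hu t ht hut
        obtain ⟨h1, h2, h3, h4, h5⟩ := hT t ht
        rcases h5 with ⟨h5, h7⟩ | h5
        · exact M.not_adj_outer H.mem H.notMem h1 h5 h7 (List.mem_of_mem_head? hu)
            (fun _ => Or.inl hu) hut.symm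
        · exact (hcon t u h1 h2 h5 hut.symm).2 h6 hu
      · intro u hu t ht hut
        obtain rfl : v = u := by rw [H.last] at hu; simpa using hu
        exact hlast t ht hut.symm
    · refine Or.inr (Or.inl ⟨by omega, Or.inr ?_⟩)
      intro u hu t ht hut
      obtain rfl : v = u := by rw [H.last] at hu; simpa using hu
      exact hlast t ht hut.symm

end Hook

/-- The boundary vertices `v`, `x₁`, `a₁`, `y₁`, `w` are consecutive, where `v` is the last vertex
of the path, `a₁` has two colours, and `w` has two colours or is the first vertex of the path. -/
structure Ladder (Γ : SimpleGraph V) (S B : Finset V) (L : V → Finset ℕ) (p : List V)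
    (v x₁ a₁ y₁ w : V) : Prop extends Hook Γ S B L p v x₁ a₁ where
  mem_y : y₁ ∈ B
  notMem_y : y₁ ∉ p
  ne : x₁ ≠ y₁
  adj_y : Γ.Adj a₁ y₁
  adj_w : Γ.Adj y₁ w
  mem_w : w ∈ B
  ne_w : w ≠ a₁
  two_or_head : Two S L p w ∨ p.head? = some w

section Ladder

variable {v x₁ a₁ y₁ w : V}

theorem Hook.exists_ladder (H : Hook Γ S B L p v x₁ a₁) (M : MinCE Γ z S B L p φ) :
    ∃ y₁ w, Ladder Γ S B L p v x₁ a₁ y₁ w ∧ (p.length ≤ 5 → Two S L p w) := by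
  obtain ⟨y₁, w, hy, hyx, ay, yw, hw⟩ := H.exists_next M
  have hap := H.two.2.1
  have haB := H.two.mem_boundary M
  have hyp : y₁ ∉ p := fun h => M.two_not_adj H.two h ay
  have hwa : w ∈ B ∧ w ≠ a₁ ∧ Outer p w := by
    rcases hw with ⟨hw, hwa⟩ | ⟨-, hw⟩
    · exact ⟨hw.mem_boundary M, hwa, outer_of_notMem hw.2.1⟩
    · have := List.mem_of_mem_head? hw
      exact ⟨M.sub w this, fun e => hap (e ▸ this), fun _ => Or.inl hw⟩
  have hyB := M.mem_of_two_chord haB hwa.1 hwa.2.1.symm hy hyp ay yw (outer_of_notMem hap) hwa.2.2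
  exact ⟨y₁, w, ⟨H, hyB, hyp, hyx.symm, ay, yw, hwa.1, hwa.2.1, hw.imp And.left And.right⟩,
    fun h => (hw.resolve_right fun h' => by omega).1⟩

theorem Ladder.eq_or_eq_a (H : Ladder Γ S B L p v x₁ a₁ y₁ w) (M : MinCE Γ z S B L p φ) {b : V}
    (hb : b ∈ B) (h : Γ.Adj a₁ b) : b = x₁ ∨ b = y₁ :=
  M.eq_or_eq (H.two.mem_boundary M) H.two.2.1 H.mem H.mem_y hb H.adj'.symm H.adj_y h H.ne

theorem Ladder.eq_or_eq_y (H : Ladder Γ S B L p v x₁ a₁ y₁ w) (M : MinCE Γ z S B L p φ) {b : V}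
    (hb : b ∈ B) (h : Γ.Adj y₁ b) : b = a₁ ∨ b = w :=
  M.eq_or_eq H.mem_y H.notMem_y (H.two.mem_boundary M) H.mem_w hb H.adj_y.symm H.adj_w h
    H.ne_w.symm

theorem Ladder.eq_of_mem_y (H : Ladder Γ S B L p v x₁ a₁ y₁ w) (M : MinCE Γ z S B L p φ) {b : V}
    (hb : b ∈ p) (h : Γ.Adj y₁ b) : b = w ∧ p.head? = some w := by
  have := (H.eq_or_eq_y M (M.sub b hb) h).resolve_left fun e => H.two.2.1 (e ▸ hb)
  exact ⟨this, H.two_or_head.resolve_left fun h => h.2.1 (this ▸ hb)⟩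

theorem Ladder.three_le_y (H : Ladder Γ S B L p v x₁ a₁ y₁ w) (M : MinCE Γ z S B L p φ) :
    3 ≤ (L y₁).card := by
  by_contra h
  exact M.indep _ _ H.two ⟨M.disc.sub H.mem_y, H.notMem_y, by omega⟩ H.adj_y

theorem Ladder.length_eq_six (H : Ladder Γ S B L p v x₁ a₁ y₁ w) (M : MinCE Γ z S B L p φ)
    (hw : p.length ≤ 5 → Two S L p w) : p.length = 6 := by
  by_contra h6
  have hlen : p.length ≤ 5 := by have := M.weight.length_le; omega
  replace hw := hw hlen
  have haB := H.two.mem_boundary M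
  have hap := H.two.2.1
  obtain ⟨c, hc, hcw⟩ := Finset.exists_mem_notMem_of_card_lt_card (s := L w) (t := L y₁)
    (by have := H.three_le_y M; have := hw.2.2; omega)
  obtain ⟨d, hd, hdc⟩ := Finset.exists_mem_ne (s := L a₁) (by have := M.card_eq_two H.two; omega) c
  have hay := H.adj_y.ne
  obtain ⟨χ, hχa, hχy⟩ : ∃ χ : V → ℕ, χ a₁ = d ∧ χ y₁ = c :=
    ⟨fun t => if t = a₁ then d else c, by simp, by simp [hay.symm]⟩
  have hT : ∀ t, Touched Γ S L p [a₁, y₁] χ t → t ∈ S ∧ t ≠ a₁ ∧ t ≠ y₁ ∧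
      (t = x₁ ∨ (t ∉ B ∧ (Γ.Adj a₁ t ∨ Γ.Adj y₁ t))) := by
    rintro t ⟨h1, h2, h3, u, hu, h4, h5⟩
    simp only [List.mem_cons, List.not_mem_nil, or_false, not_or] at h2 hu
    refine ⟨h1, h2.1, h2.2, ?_⟩
    rcases hu with rfl | rfl
    · by_cases hB : t ∈ B
      · exact Or.inl ((H.eq_or_eq_a M hB h4).resolve_right h2.2)
      · exact Or.inr ⟨hB, Or.inl h4⟩
    · refine Or.inr ⟨fun hB => ?_, Or.inr h4⟩
      rcases H.eq_or_eq_y M hB h4 with rfl | rfl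
      · exact h2.1 rfl
      · exact hcw (hχy ▸ h5)
  have hcomm := Γ.adj_comm
  have g3 := M.girth.no_three
  have g4 := M.girth.no_four
  refine M.delete_off_path (X := [a₁, y₁]) (χ := χ) (by simp) (by simp [hay])
    (by simp [M.disc.sub H.mem_y, H.two.1]) ⟨haB, Or.inl H.mem_y, trivial⟩
    (by simp [H.notMem_y, hap])
    (by simp [hχa, hχy, hc, hd]) (by simp [hχa, hχy, hdc, hdc.symm]) ?_ ?_ ?_ ?_ ?_
  · simp only [List.mem_cons, List.not_mem_nil, or_false, forall_eq_or_imp, forall_eq]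
    exact ⟨fun u hu h => absurd h (M.two_not_adj H.two hu),
      fun u hu h => absurd ((H.eq_of_mem_y M hu h).1 ▸ hu) hw.2.1⟩
  · intro t _ u hu v hv ut vt
    simp only [List.mem_cons, List.not_mem_nil, or_false] at hu hv
    have := H.adj_y
    grind
  · intro t ht
    obtain ⟨h1, h2, h3, rfl | ⟨h4, h5 | h5⟩⟩ := hT t ht
    · refine ⟨fun h => ?_, fun b hb hbX htb => ?_, fun u hu u' hu' tu tu' => ?_⟩
      · have := H.three_le M
        have := h.2.2
        omega
      · rcases H.eq_or_eq M (hb.mem_boundary M) htb with rfl | rfl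
        · exact hb.2.1 H.mem_path
        · simp at hbX
      · rw [H.eq_of_mem M hu tu, H.eq_of_mem M hu' tu']
    · exact M.calm haB hap (by simp) h1 h4 h5
    · exact M.calm H.mem_y H.notMem_y (by simp) h1 h4 h5
  · intro t t' ht ht' htt
    obtain ⟨h1, h2, h3, h4⟩ := hT t ht
    obtain ⟨k1, k2, k3, k4⟩ := hT t' ht'
    have := H.adj'
    have := H.adj_y
    have := H.ne
    rcases h4 with h4 | ⟨-, h4 | h4⟩ <;> rcases k4 with k4 | ⟨-, k4 | k4⟩ <;> grind
  · by_cases h5 : p.length ≤ 4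
    · exact Or.inl h5
    refine Or.inr (Or.inl ⟨hlen, Or.inl ?_⟩)
    intro u hu t ht hut
    have hup := List.mem_of_mem_head? hu
    obtain ⟨h1, h2, h3, rfl | ⟨h4, h5 | h5⟩⟩ := hT t ht
    · obtain rfl := H.eq_of_mem M hup hut.symm
      have h6 := H.last
      have nd := M.nodup
      rcases p with _ | ⟨a, _ | ⟨b, l⟩⟩
      · simp at h5
      · simp at h5
      · simp only [List.head?_cons, Option.mem_def, Option.some.injEq] at hu
        subst hu
        rw [List.getLast?_cons_cons] at h6
        exact (List.nodup_cons.1 nd).1 (List.mem_of_mem_getLast? h6)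
    · exact M.not_adj_outer haB hap h1 h4 h5 hup (fun _ => Or.inl hu) hut.symm
    · exact M.not_adj_outer H.mem_y H.notMem_y h1 h4 h5 hup (fun _ => Or.inl hu) hut.symm

/-- The only way to colour `x₁`, `a₁`, `y₁` is by `α`, `β`, `α`. -/
theorem Ladder.exists_colors (H : Ladder Γ S B L p v x₁ a₁ y₁ w) (M : MinCE Γ z S B L p φ) :
    ∃ α β, α ≠ β ∧ α ∈ L x₁ ∧ β ∈ L a₁ ∧ α ∈ L y₁ ∧ (∀ u ∈ p, Γ.Adj x₁ u → α ≠ φ u) ∧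
      (∀ u ∈ p, Γ.Adj y₁ u → α ≠ φ u) ∧ (w ∉ p → α ∉ L w) := by
  have ha := M.card_eq_two H.two
  have hx := H.three_le M
  have hy := H.three_le_y M
  have hxa : (L x₁).erase (φ v) = L a₁ := by
    refine Finset.eq_of_subset_of_card_le (fun c hc => ?_) ?_
    · obtain ⟨hcv, hc⟩ := Finset.mem_erase.1 hc
      obtain ⟨b, hb, hbp, xb, hcb⟩ := M.mem_of_color H.mem H.notMem hc fun u hu h => by
        rwa [H.eq_of_mem M hu h]
      rcases H.eq_or_eq M hb xb with rfl | rfl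
      · exact absurd H.mem_path hbp
      · exact hcb
    · have := Finset.pred_card_le_card_erase (s := L x₁) (a := φ v)
      omega
  obtain ⟨α, hα, hαy, hαw⟩ : ∃ α ∈ L y₁, (∀ u ∈ p, Γ.Adj y₁ u → α ≠ φ u) ∧ (w ∉ p → α ∉ L w) := by
    by_cases hw : w ∈ p
    · obtain ⟨α, hα, h⟩ := Finset.exists_mem_ne (s := L y₁) (by omega) (φ w)
      exact ⟨α, hα, fun u hu h' => (H.eq_of_mem_y M hu h').1 ▸ h, fun h => absurd hw h⟩
    · have h2 := H.two_or_head.resolve_right fun h => hw (List.mem_of_mem_head? h)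
      obtain ⟨α, hα, h⟩ := Finset.exists_mem_notMem_of_card_lt_card (s := L w) (t := L y₁)
        (by have := h2.2.2; omega)
      exact ⟨α, hα, fun u hu h' => absurd ((H.eq_of_mem_y M hu h').1 ▸ hu) hw, fun _ => h⟩
  have hαa : α ∈ L a₁ := by
    obtain ⟨b, hb, hbp, yb, hcb⟩ := M.mem_of_color H.mem_y H.notMem_y hα hαy
    rcases H.eq_or_eq_y M hb yb with rfl | rfl
    · exact hcb
    · exact absurd hcb (hαw hbp)
  obtain ⟨β, hβ, hβα⟩ := Finset.exists_mem_ne (s := L a₁) (by omega) α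
  obtain ⟨h1, h2⟩ := Finset.mem_erase.1 (hxa ▸ hαa)
  exact ⟨α, β, hβα.symm, h2, hβ, hα, fun u hu h => by rwa [H.eq_of_mem M hu h], hαy, hαw⟩

/-- The edges `x₁a₁` and `a₁y₁` lie on a pentagon. -/
theorem Ladder.exists_pentagon (H : Ladder Γ S B L p v x₁ a₁ y₁ w) (M : MinCE Γ z S B L p φ) :
    ∃ u t, u ∈ S ∧ u ∉ B ∧ t ∈ S ∧ t ∉ B ∧ Γ.Adj x₁ u ∧ Γ.Adj u t ∧ Γ.Adj y₁ t := by
  by_contra! hcon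
  obtain ⟨α, β, hαβ, hx, ha, hy, hxp, hyp, hw⟩ := H.exists_colors M
  have haB := H.two.mem_boundary M
  have hap := H.two.2.1
  have hxa := H.adj'.ne
  have hay := H.adj_y.ne
  have hxy := H.ne
  have hnxy : ¬ Γ.Adj x₁ y₁ := fun h => M.girth.no_three _ _ _ H.adj' H.adj_y h.symm
  obtain ⟨χ, hχx, hχa, hχy⟩ : ∃ χ : V → ℕ, χ x₁ = α ∧ χ a₁ = β ∧ χ y₁ = α :=
    ⟨fun t => if t = a₁ then β else α, by simp [hxa], by simp, by simp [hay.symm]⟩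
  have hT : ∀ t, Touched Γ S L p [x₁, a₁, y₁] χ t → t ∈ S ∧ t ∉ B ∧
      (Γ.Adj x₁ t ∨ Γ.Adj a₁ t ∨ Γ.Adj y₁ t) := by
    rintro t ⟨h1, h2, h3, u, hu, h4, h5⟩
    simp only [List.mem_cons, List.not_mem_nil, or_false, not_or] at h2 hu
    refine ⟨h1, fun hB => ?_, by rcases hu with rfl | rfl | rfl <;> simp [h4]⟩
    have k1 := H.eq_or_eq M hB
    have k2 := H.eq_or_eq_a M hB
    have k3 := H.eq_or_eq_y M hB
    have := H.mem_path
    rcases hu with rfl | rfl | rfl <;> grind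
  have hg : ∀ t, Touched Γ S L p [x₁, a₁, y₁] χ t → ∃ g ∈ [x₁, a₁, y₁], g ∈ B ∧ g ∉ p ∧
      Γ.Adj g t := by
    intro t ht
    obtain ⟨-, -, h | h | h⟩ := hT t ht
    · exact ⟨x₁, by simp, H.mem, H.notMem, h⟩
    · exact ⟨a₁, by simp, haB, hap, h⟩
    · exact ⟨y₁, by simp, H.mem_y, H.notMem_y, h⟩
  have hcomm := Γ.adj_comm
  have g3 := M.girth.no_three
  have g4 := M.girth.no_four
  have e1 := H.adj'
  have e2 := H.adj_y
  refine M.delete_off_path (X := [x₁, a₁, y₁]) (χ := χ) (by simp) (by simp [hxa, hay, hxy])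
    (by simp [M.disc.sub H.mem_y, H.two.1, M.disc.sub H.mem])
    ⟨H.mem, Or.inl haB, Or.inl (Or.inl H.mem_y), trivial⟩
    (by simp [H.notMem_y, hap, H.notMem])
    (by simp [hχx, hχa, hχy, hx, ha, hy])
    (by simp [hχx, hχa, hχy, hαβ, hαβ.symm, hnxy, Γ.adj_comm y₁]) ?_ ?_ ?_ ?_ ?_
  · simp only [List.mem_cons, List.not_mem_nil, or_false, forall_eq_or_imp, forall_eq,
      hχx, hχa, hχy]
    exact ⟨hxp, fun u hu h => absurd h (M.two_not_adj H.two hu), hyp⟩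
  · intro t ht u hu v hv ut vt
    have : t ≠ a₁ := by
      rintro rfl
      exact (hT _ ht).2.1 haB
    simp only [List.mem_cons, List.not_mem_nil, or_false] at hu hv
    grind
  · intro t ht
    obtain ⟨g, hgX, hg, hgp, gt⟩ := hg t ht
    exact M.calm hg hgp hgX (hT t ht).1 (hT t ht).2.1 gt
  · intro t t' ht ht' htt
    obtain ⟨h1, h2, h3⟩ := hT t ht
    obtain ⟨k1, k2, k3⟩ := hT t' ht'
    have c1 := hcon t t' h1 h2 k1 k2
    have c2 := hcon t' t k1 k2 h1 h2
    have := H.mem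
    have := H.mem_y
    rcases h3 with h3 | h3 | h3 <;> rcases k3 with k3 | k3 | k3 <;> grind
  · refine .of_not_adj M.weight.length_le fun t ht v hv ho => ?_
    obtain ⟨g, hgX, hg, hgp, gt⟩ := hg t ht
    exact M.not_adj_outer hg hgp (hT t ht).1 (hT t ht).2.1 gt hv ho

end Ladder

section Pentagon

variable {x₁ a₁ y₁ u t : V}

/-- A pentagon with three consecutive vertices on the boundary and the other two inside. -/
structure Pentagon (Γ : SimpleGraph V) (S B : Finset V) (x₁ a₁ y₁ u t : V) : Prop where
  memB : ∀ v ∈ [x₁, a₁, y₁], v ∈ B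
  mem : ∀ v ∈ [u, t], v ∈ S ∧ v ∉ B
  xa : Γ.Adj x₁ a₁
  ay : Γ.Adj a₁ y₁
  xu : Γ.Adj x₁ u
  ut : Γ.Adj u t
  ty : Γ.Adj t y₁
  ne : x₁ ≠ y₁

theorem Pentagon.nodup (P : Pentagon Γ S B x₁ a₁ y₁ u t) : [x₁, a₁, y₁, t, u].Nodup := by
  obtain ⟨h1, h2, e1, e2, e3, e4, e5, h3⟩ := P
  simp only [List.mem_cons, List.not_mem_nil, or_false, forall_eq_or_imp, forall_eq] at h1 h2
  have := e1.ne
  have := e2.ne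
  have := e4.ne
  simp only [List.nodup_cons, List.mem_cons, List.not_mem_nil, or_false, not_or, not_false_eq_true,
    List.nodup_nil, and_true]
  grind

theorem Pentagon.swap (P : Pentagon Γ S B x₁ a₁ y₁ u t) : Pentagon Γ S B y₁ a₁ x₁ t u where
  memB v hv := P.memB v (by simp at hv ⊢; tauto)
  mem v hv := P.mem v (by simp at hv ⊢; tauto)
  xa := P.ay.symm
  ay := P.xa.symm
  xu := P.ty.symm
  ut := P.ut.symm
  ty := P.xu.symm
  ne := P.ne.symm

theorem Pentagon.eq_or_eq (P : Pentagon Γ S B x₁ a₁ y₁ u t) (M : MinCE Γ z S B L p φ)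
    (hx : x₁ ∉ p) (ha : Two S L p a₁) (hy : y₁ ∉ p) {m : V} (hm : m ∈ S) (am : Γ.Adj a₁ m) :
    m = x₁ ∨ m = y₁ := by
  by_contra! hcon
  obtain ⟨s, x, hPD⟩ := M.disc.planar
  have nd := P.nodup
  obtain ⟨h1, h2, e1, e2, e3, e4, e5, h3⟩ := P
  simp only [List.mem_cons, List.not_mem_nil, or_false, forall_eq_or_imp, forall_eq] at h1 h2
  obtain ⟨xB, aB, yB⟩ := h1
  obtain ⟨⟨uS, uB⟩, tS, tB⟩ := h2
  have hsub := M.disc.sub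
  have g3 := M.girth.no_three
  have g4 := M.girth.no_four
  have hcomm := Γ.adj_comm
  have hmQ : m ∉ [x₁, u, t, y₁] := by
    simp only [List.mem_cons, List.not_mem_nil, or_false]
    grind
  have hmQ' : m ∉ [x₁, a₁, y₁] := by
    have := am.ne
    simp only [List.mem_cons, List.not_mem_nil, or_false]
    grind
  have hmC : m ∉ [x₁, a₁, y₁, t, u] := by
    have := am.ne
    simp only [List.mem_cons, List.not_mem_nil, or_false] at hmQ ⊢
    grind
  have haQ : a₁ ∉ [x₁, u, t, y₁] := by
    simp only [List.nodup_cons, List.mem_cons, List.not_mem_nil, or_false] at nd ⊢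
    grind
  have hU := (M.mem_boundary_of_outer hPD (Q := [x₁, a₁, y₁])
    ⟨by simp, by simp [e1.ne, e2.ne, h3], by simp [e1, e2], by simp [hsub xB, hsub aB, hsub yB],
      by simpa using xB, by simpa using yB⟩ (by simp) (by simp)
    (by simp [outer_of_notMem hx, outer_of_notMem ha.2.1, outer_of_notMem hy]) (by
      intro v hv hvQ b hb b' hb' vb vb'
      have := M.indep v a₁ hv ha
      simp only [List.mem_cons, List.not_mem_nil, or_false] at hb hb' hvQ
      grind)).1
  have hC := M.pentagon hPD nd (by simp [hsub xB, hsub aB, hsub yB, uS, tS]) e1 e2 e5.symm e4.symm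
    e3.symm
  have hQ : Chord Γ S B [x₁, u, t, y₁] := by
    refine ⟨by simp, ?_, by simp [e3, e4, e5], by simp [hsub xB, hsub yB, uS, tS],
      by simpa using xB, by simpa using yB⟩
    simp only [List.nodup_cons, List.mem_cons, List.not_mem_nil, or_false] at nd ⊢
    grind
  have hside : ∀ d, side x z [x₁, u, t, y₁] d =
      side x z [x₁, a₁, y₁] d + winding x [x₁, a₁, y₁, t, u, x₁] d := by
    intro d
    simp only [side, winding, List.cons_append, List.nil_append]
    have := hPD.symm y₁ t d
    have := hPD.symm t u d
    have := hPD.symm u x₁ d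
    grind
  obtain ⟨ω, hω⟩ := hQ.exists_side hPD M.disc.apex (l := [a₁, m]) (by simpa using am)
    (by simp [hsub aB, hm]) (by simp only [List.mem_cons, List.not_mem_nil, or_false]; grind)
  have hall : ∀ d ∈ S, d ∉ [x₁, u, t, y₁] → side x z [x₁, u, t, y₁] d = ω := by
    intro d hd hdQ
    by_cases hda : d = a₁
    · exact hω d (by simp [hda])
    rw [← hω m (by simp), hside, hside, hC m hm hmC, hC d hd, hU d hd _ m hm hmQ']
    all_goals
      simp only [List.mem_cons, List.not_mem_nil, or_false] at hdQ ⊢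
      grind
  exact uB (M.mem_boundary hPD hQ (by simp) (by simp)
    (fun d hd hdQ d' hd' hdQ' => (hall d hd hdQ).trans (hall d' hd' hdQ').symm) (by simp))

theorem Pentagon.not_adj (P : Pentagon Γ S B x₁ a₁ y₁ u t) (M : MinCE Γ z S B L p φ) {n n' : V}
    (hn : n ∈ S) (hn' : n' ∈ S) (hnP : n ∉ [x₁, a₁, y₁, t, u]) (hnP' : n' ∉ [x₁, a₁, y₁, t, u])
    (xn : Γ.Adj x₁ n) (yn : Γ.Adj y₁ n') : ¬ Γ.Adj n n' := by
  intro nn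
  have nd := P.nodup
  have hcomm := Γ.adj_comm
  have g3 := M.girth.no_three x₁ y₁ n
  have hsub := M.disc.sub
  obtain ⟨h1, h2, e1, e2, e3, e4, e5, h3⟩ := P
  simp only [List.mem_cons, List.not_mem_nil, or_false, forall_eq_or_imp, forall_eq] at h1 h2
  have hne := nn.ne
  refine M.theta (r := x₁) (t := y₁) (a := a₁) (b := u) (b' := t) (c := n) (c' := n') ?_
    (by simp [hsub h1.1, hsub h1.2.1, hsub h1.2.2, h2, hn, hn']) e1 e2 e3 e4 e5 xn nn yn.symm
    (Or.inl h1.2.1)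
  simp only [List.nodup_cons, List.mem_cons, List.not_mem_nil, or_false, not_or, not_false_eq_true,
    List.nodup_nil, and_true] at *
  grind

theorem Pentagon.not_adj' (P : Pentagon Γ S B x₁ a₁ y₁ u t) (M : MinCE Γ z S B L p φ) {n n' : V}
    (hn : n ∈ S) (hn' : n' ∈ S) (hnP : n ∉ [x₁, a₁, y₁, t, u]) (hnP' : n' ∉ [x₁, a₁, y₁, t, u])
    (xn : Γ.Adj x₁ n) (tn : Γ.Adj t n') : ¬ Γ.Adj n n' := by
  intro nn
  have nd := P.nodup
  have hcomm := Γ.adj_comm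
  have g3 := M.girth.no_three
  have hsub := M.disc.sub
  obtain ⟨h1, h2, e1, e2, e3, e4, e5, h3⟩ := P
  simp only [List.mem_cons, List.not_mem_nil, or_false, forall_eq_or_imp, forall_eq] at h1 h2
  obtain ⟨⟨uS, uB⟩, tS, tB⟩ := h2
  have hne := nn.ne
  obtain ⟨m, hm, um, hmF⟩ := M.exists_adj_notMem uS (M.notMem_path uB) {x₁, t}
    (by have := M.three_le u uS uB; have := Finset.card_le_two (a := x₁) (b := t); omega)
  have := um.ne
  refine M.theta (r := x₁) (t := t) (a := u) (b := a₁) (b' := y₁) (c := n) (c' := n') ?_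
    (by simp [hsub h1.1, hsub h1.2.1, hsub h1.2.2, uS, tS, hn, hn']) e3 e4 e1 e2 e5.symm xn nn
    tn.symm (Or.inr ⟨m, hm, um, ?_⟩)
  · simp only [List.nodup_cons, List.mem_cons, List.not_mem_nil, or_false, not_or,
      not_false_eq_true, List.nodup_nil, and_true] at *
    grind
  · simp only [Finset.mem_insert, Finset.mem_singleton, List.mem_cons, List.not_mem_nil,
      or_false] at *
    grind

end Pentagon

/-- An inner vertex joined to a boundary vertex next to the end of the path sees at most one
particular vertex of the path. -/
theorem MinCE.eq_fourth (M : MinCE Γ z S B L p φ) {a b c d e f g n q : V}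
    (hp : p = [a, b, c, d, e, f]) (hg : g ∈ B) (hgp : g ∉ p) (hn : n ∈ S) (hnB : n ∉ B)
    (gn : Γ.Adj g n) (h : ∀ w ∈ p, Γ.Adj g w → p.getLast? = some w) (hq : q ∈ p)
    (nq : Γ.Adj n q) : q = d := by
  have hnp := M.notMem_path hnB
  have hch := M.chain
  have nd := M.nodup
  have ha : ¬ Γ.Adj n a := M.not_adj_outer hg hgp hn hnB gn (by simp [hp]) fun _ => by simp [hp]
  have hf : ¬ Γ.Adj n f := M.not_adj_outer hg hgp hn hnB gn (by simp [hp]) fun _ => by simp [hp]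
  have hga : ¬ Γ.Adj g a := fun h' => by
    have := h a (by simp [hp]) h'
    simp [hp] at this nd
    tauto
  have hgb : ¬ Γ.Adj g b := fun h' => by
    have := h b (by simp [hp]) h'
    simp [hp] at this nd
    tauto
  have hgp' : g ∉ p.reverse := by simpa using hgp
  have hb : ¬ Γ.Adj n b := M.reverse.not_adj_near_end hg hgp' hn hnB gn (l₁ := [f, e, d, c])
    (l₂ := [a]) (by simp [hp]) (by simp) (by simpa using hga) (by simpa using ha)
  have hc : ¬ Γ.Adj n c := M.reverse.not_adj_near_end hg hgp' hn hnB gn (l₁ := [f, e, d])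
    (l₂ := [b, a]) (by simp [hp]) (by simp) (by simpa using ⟨hgb, hga⟩) (by simpa using ⟨hb, ha⟩)
  have he : ¬ Γ.Adj n e := by
    by_cases hgf : Γ.Adj g f
    · intro ne
      simp [hp] at hch hgp hnp
      rcases M.girth.no_four _ _ _ _ gn ne hch.2.2.2.2 hgf.symm with rfl | rfl
      · simp at hgp
      · simp at hnp
    · exact M.not_adj_near_end hg hgp hn hnB gn (l₁ := [a, b, c, d]) (l₂ := [f]) (by simp [hp])
        (by simp) (by simpa using hgf) (by simpa using hf)
  simp only [hp, List.mem_cons, List.not_mem_nil, or_false] at hq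
  rcases hq with rfl | rfl | rfl | rfl | rfl | rfl
  all_goals first | rfl | contradiction

theorem MinCE.exists_color (M : MinCE Γ z S B L p φ) {g n : V} (hg : g ∈ B) (hgp : g ∉ p)
    (hn : n ∈ S) (hnB : n ∉ B) (gn : Γ.Adj g n) {F : Finset ℕ}
    (hF : F.card ≤ 1 ∨ F.card ≤ 2 ∧ ∀ q ∈ p, ¬ Γ.Adj n q) :
    ∃ c ∈ L n, c ∉ F ∧ ∀ q ∈ p, Γ.Adj n q → c ≠ φ q := by
  have h3 := M.three_le n hn hnB
  by_cases hq : ∃ q ∈ p, Γ.Adj n q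
  · obtain ⟨q, hqp, nq⟩ := hq
    have hF' : F.card ≤ 1 := hF.resolve_right fun h => h.2 q hqp nq
    obtain ⟨c, hc, hcF⟩ := Finset.exists_mem_notMem_of_card_lt_card (s := insert (φ q) F) (t := L n)
      (by have := Finset.card_insert_le (φ q) F; omega)
    rw [Finset.mem_insert, not_or] at hcF
    refine ⟨c, hc, hcF.2, fun q' hq' nq' => ?_⟩
    rw [M.eq_of_adj_path hg hgp hn hnB gn hq' hqp nq' nq]
    exact hcF.1
  · push Not at hq
    obtain ⟨c, hc, hcF⟩ := Finset.exists_mem_notMem_of_card_lt_card (s := F) (t := L n) (by omega)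
    exact ⟨c, hc, hcF, fun q hqp nq => absurd nq (hq q hqp)⟩

/-- A vertex off a pentagon has at most one neighbour on it. -/
theorem Pentagon.eq_of_adj {x₁ a₁ y₁ u t : V} (P : Pentagon Γ S B x₁ a₁ y₁ u t)
    (M : MinCE Γ z S B L p φ) {n q q' : V} (hn : n ∉ [x₁, a₁, y₁, t, u])
    (hq : q ∈ [x₁, a₁, y₁, t, u]) (hq' : q' ∈ [x₁, a₁, y₁, t, u]) (qn : Γ.Adj q n)
    (qn' : Γ.Adj q' n) : q = q' := by
  by_contra hne
  have tri : ¬ Γ.Adj q q' := fun h => M.girth.no_three _ _ _ h qn' qn.symm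
  have sq : ∀ k ∈ [x₁, a₁, y₁, t, u], ¬ (Γ.Adj q k ∧ Γ.Adj k q') := by
    rintro k hk ⟨h, h'⟩
    rcases M.girth.no_four _ _ _ _ h h' qn' qn.symm with e | rfl
    · exact hne e
    · exact hn hk
  obtain ⟨-, -, e1, e2, e3, e4, e5, -⟩ := P
  simp only [List.mem_cons, List.not_mem_nil, or_false, forall_eq_or_imp, forall_eq] at hq hq' sq
  rcases hq with rfl | rfl | rfl | rfl | rfl <;> rcases hq' with rfl | rfl | rfl | rfl | rfl <;>
    simp_all [e1.symm, e2.symm, e3.symm, e4.symm, e5.symm]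

section Ladder

variable {v x₁ a₁ y₁ w u t : V}

theorem Ladder.not_both (H : Ladder Γ S B L p v x₁ a₁ y₁ w) (M : MinCE Γ z S B L p φ)
    (h6 : p.length = 6) (P : Pentagon Γ S B x₁ a₁ y₁ u t) :
    (∀ q ∈ p, ¬ Γ.Adj u q) ∨ ∀ q ∈ p, ¬ Γ.Adj t q := by
  by_contra! hcon
  obtain ⟨⟨q, hq, uq⟩, q', hq', tq⟩ := hcon
  obtain ⟨uS, uB⟩ := P.mem u (by simp)
  obtain ⟨tS, tB⟩ := P.mem t (by simp)
  have hup := M.notMem_path uB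
  have htp := M.notMem_path tB
  have hch := M.chain
  obtain ⟨a, b, c, d, e, f, hp⟩ : ∃ a b c d e f, p = [a, b, c, d, e, f] := by
    match p, h6 with
    | [a, b, c, d, e, f], _ => exact ⟨a, b, c, d, e, f, rfl⟩
  have h1 := M.eq_fourth hp H.mem H.notMem uS uB P.xu
    (fun w hw h => by rw [H.eq_of_mem M hw h, H.last]) hq uq
  have h2 := M.reverse.eq_fourth (a := f) (b := e) (c := d) (d := c) (e := b) (f := a)
    (by simp [hp]) H.mem_y (by simpa using H.notMem_y) tS tB P.ty.symm (fun w hw h => by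
      obtain ⟨rfl, h'⟩ := H.eq_of_mem_y M (by simpa using hw) h
      simpa using h') (by simpa using hq') tq
  subst h1 h2
  simp [hp] at hch
  rcases M.girth.no_four _ _ _ _ P.ut tq hch.2.2.1 uq.symm with rfl | rfl
  · exact hup hq'
  · exact htp hq

theorem Ladder.exists_inner_colors (H : Ladder Γ S B L p v x₁ a₁ y₁ w) (M : MinCE Γ z S B L p φ)
    (h6 : p.length = 6) (P : Pentagon Γ S B x₁ a₁ y₁ u t) (α : ℕ) :
    ∃ cu ct, cu ∈ L u ∧ ct ∈ L t ∧ cu ≠ α ∧ ct ≠ α ∧ cu ≠ ct ∧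
      (∀ q ∈ p, Γ.Adj u q → cu ≠ φ q) ∧ ∀ q ∈ p, Γ.Adj t q → ct ≠ φ q := by
  obtain ⟨uS, uB⟩ := P.mem u (by simp)
  obtain ⟨tS, tB⟩ := P.mem t (by simp)
  rcases H.not_both M h6 P with h | h
  · obtain ⟨ct, h1, h2, h3⟩ := M.exists_color H.mem_y H.notMem_y tS tB P.ty.symm (F := {α})
      (Or.inl (by simp))
    obtain ⟨cu, k1, k2, k3⟩ := M.exists_color H.mem H.notMem uS uB P.xu (F := {α, ct})
      (Or.inr ⟨Finset.card_le_two, h⟩)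
    simp only [Finset.mem_insert, Finset.mem_singleton, not_or] at h2 k2
    exact ⟨cu, ct, k1, h1, k2.1, h2, k2.2, k3, h3⟩
  · obtain ⟨cu, h1, h2, h3⟩ := M.exists_color H.mem H.notMem uS uB P.xu (F := {α})
      (Or.inl (by simp))
    obtain ⟨ct, k1, k2, k3⟩ := M.exists_color H.mem_y H.notMem_y tS tB P.ty.symm (F := {α, cu})
      (Or.inr ⟨Finset.card_le_two, h⟩)
    simp only [Finset.mem_insert, Finset.mem_singleton, not_or] at h2 k2
    exact ⟨cu, ct, h1, k1, h2, k2.1, Ne.symm k2.2, h3, k3⟩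

set_option maxHeartbeats 1000000 in
theorem Ladder.false_of_pentagon (H : Ladder Γ S B L p v x₁ a₁ y₁ w) (M : MinCE Γ z S B L p φ)
    (h6 : p.length = 6) (P : Pentagon Γ S B x₁ a₁ y₁ u t) : False := by
  obtain ⟨α, β, hαβ, hx, ha, hy, hxp, hyp, hw⟩ := H.exists_colors M
  obtain ⟨cu, ct, hu, ht, huα, htα, hut, hup, htp⟩ := H.exists_inner_colors M h6 P α
  have haB := H.two.mem_boundary M
  obtain ⟨uS, uB⟩ := P.mem u (by simp)
  obtain ⟨tS, tB⟩ := P.mem t (by simp)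
  have nd := P.nodup
  have hcomm := Γ.adj_comm
  have g3 := M.girth.no_three
  have g4 := M.girth.no_four
  have hsub := M.disc.sub
  have hthird := fun m hm => P.eq_or_eq M H.notMem H.two H.notMem_y (m := m) hm
  have nd' := nd
  simp only [List.nodup_cons, List.mem_cons, List.not_mem_nil, or_false, not_or, not_false_eq_true,
    List.nodup_nil, and_true] at nd'
  obtain ⟨⟨hxa, hxy, hxt, hxu⟩, ⟨hay, hat, hau⟩, ⟨hyt, hyu⟩, htu⟩ := nd'
  obtain ⟨χ, hχx, hχa, hχy, hχt, hχu⟩ :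
      ∃ χ : V → ℕ, χ x₁ = α ∧ χ a₁ = β ∧ χ y₁ = α ∧ χ t = ct ∧ χ u = cu :=
    ⟨fun q => if q = a₁ then β else if q = t then ct else if q = u then cu else α,
      by simp [hxa, hxt, hxu], by simp, by simp [Ne.symm hay, hyt, hyu], by simp [Ne.symm hat],
      by simp [Ne.symm hau, Ne.symm htu]⟩
  have exa := P.xa
  have eay := P.ay
  have exu := P.xu
  have eut := P.ut
  have ety := P.ty
  have hT : ∀ n, Touched Γ S L p [x₁, a₁, y₁, t, u] χ n → n ∈ S ∧ n ∉ [x₁, a₁, y₁, t, u] ∧ n ∉ p ∧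
      ¬ Γ.Adj a₁ n ∧
      ((n ∉ B ∧ Γ.Adj x₁ n) ∨ (n ∉ B ∧ Γ.Adj y₁ n) ∨ Γ.Adj t n ∨ Γ.Adj u n) := by
    rintro n ⟨h1, h2, h3, q, hq, h4, h5⟩
    have han : ¬ Γ.Adj a₁ n := by
      intro h
      rcases hthird n h1 h with rfl | rfl <;> simp at h2
    refine ⟨h1, h2, h3, han, ?_⟩
    have k1 := H.eq_or_eq M (b := n)
    have k3 := H.eq_or_eq_y M (b := n)
    have := H.mem_path
    simp only [List.mem_cons, List.not_mem_nil, or_false, not_or] at h2 hq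
    rcases hq with rfl | rfl | rfl | rfl | rfl
    · grind
    · exact absurd h4 han
    · grind
    · exact Or.inr (Or.inr (Or.inl h4))
    · exact Or.inr (Or.inr (Or.inr h4))
  have hmem : ∀ n, n ∉ [x₁, a₁, y₁, t, u] → n ≠ x₁ ∧ n ≠ y₁ ∧ n ≠ u ∧ n ≠ t := by
    intro n hn
    simp only [List.mem_cons, List.not_mem_nil, or_false, not_or] at hn
    tauto
  have key : ∀ g ∈ B, g ∉ p → ∀ n ∈ S, n ∉ B → Γ.Adj g n → g ∈ [x₁, a₁, y₁, t, u] →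
      n ∈ [x₁, a₁, y₁, t, u] → (∀ q ∈ p, ∀ q' ∈ p, Γ.Adj g q → Γ.Adj g q' → q = q') →
      ∀ m ∈ S, m ∉ p → m ∉ [x₁, a₁, y₁, t, u] → Γ.Adj n m →
      Calm Γ S L p [x₁, a₁, y₁, t, u] m ∧ ∀ v ∈ p, Outer p v → ¬ Γ.Adj m v := by
    intro g hg hgp n hn hnB gn hgX hnX hgq m hm hmp hmX nm
    have hmg : m ≠ g := fun e => hmX (e ▸ hgX)
    exact ⟨⟨fun h => M.not_adj_two hg hgp hn hnB gn h hmg nm,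
      fun b hb _ => M.not_adj_two_of_two_steps hg hgp hn hnB gn hm hmp hmg nm hb,
      fun q hq q' hq' => M.eq_of_adj_path_of_two_steps hg hgp hn hnB gn hm hmp hmg nm hgq hq hq'⟩,
      fun v hv ho => M.not_adj_outer_of_two_steps hg hgp hn hnB gn hm hmp hmg nm hv ho⟩
  have hcalm : ∀ n, Touched Γ S L p [x₁, a₁, y₁, t, u] χ n →
      Calm Γ S L p [x₁, a₁, y₁, t, u] n ∧ ∀ v ∈ p, Outer p v → ¬ Γ.Adj n v := by
    intro n hn
    obtain ⟨h1, h2, h3, h4, ⟨h5, h6⟩ | ⟨h5, h6⟩ | h5 | h5⟩ := hT n hn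
    · exact ⟨M.calm H.mem H.notMem (by simp) h1 h5 h6,
        fun v hv ho => M.not_adj_outer H.mem H.notMem h1 h5 h6 hv ho⟩
    · exact ⟨M.calm H.mem_y H.notMem_y (by simp) h1 h5 h6,
        fun v hv ho => M.not_adj_outer H.mem_y H.notMem_y h1 h5 h6 hv ho⟩
    · exact key y₁ H.mem_y H.notMem_y t tS tB ety.symm (by simp) (by simp)
        (fun q hq q' hq' h h' => by rw [(H.eq_of_mem_y M hq h).1, (H.eq_of_mem_y M hq' h').1])
        n h1 h3 h2 h5
    · exact key x₁ H.mem H.notMem u uS uB exu (by simp) (by simp)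
        (fun q hq q' hq' h h' => by rw [H.eq_of_mem M hq h, H.eq_of_mem M hq' h'])
        n h1 h3 h2 h5
  refine M.delete_off_path (X := [x₁, a₁, y₁, t, u]) (χ := χ) (by simp) nd
    (by simp [hsub H.mem_y, H.two.1, hsub H.mem, uS, tS])
    ⟨H.mem, Or.inl haB, Or.inl (Or.inl H.mem_y), Or.inr ety.symm, Or.inr eut.symm, trivial⟩
    (by simp [H.notMem_y, H.two.2.1, H.notMem, M.notMem_path uB, M.notMem_path tB])
    (by simp [hχx, hχa, hχy, hχt, hχu, hx, ha, hy, ht, hu]) ?_ ?_ ?_ (fun n hn => (hcalm n hn).1) ?_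
    (.of_not_adj M.weight.length_le fun n hn => (hcalm n hn).2)
  · have n1 : ¬ Γ.Adj x₁ y₁ := fun h => g3 _ _ _ exa eay h.symm
    have n2 : ¬ Γ.Adj x₁ t := fun h => g3 _ _ _ exu eut h.symm
    have n3 : ¬ Γ.Adj y₁ u := fun h => g3 _ _ _ ety.symm eut.symm h.symm
    have n4 : ¬ Γ.Adj a₁ t := fun h => g3 _ _ _ eay ety.symm h.symm
    have n5 : ¬ Γ.Adj a₁ u := fun h => g3 _ _ _ exa.symm exu h.symm
    simp [hχx, hχa, hχy, hχt, hχu, n1, n2, n3, n4, n5, hcomm y₁ x₁, hcomm t x₁, hcomm u y₁,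
      hcomm t a₁, hcomm u a₁, hαβ, hαβ.symm, huα, huα.symm, htα, htα.symm, hut, hut.symm]
  · simp only [List.mem_cons, List.not_mem_nil, or_false, forall_eq_or_imp, forall_eq, hχx, hχa,
      hχy, hχt, hχu]
    exact ⟨hxp, fun q hq h => absurd h (M.two_not_adj H.two hq), hyp, htp, hup⟩
  · intro n hn q hq q' hq' qn qn'
    exact P.eq_of_adj M (hT n hn).2.1 hq hq' qn qn'
  · intro n n' hn hn' nn
    obtain ⟨h1, h2, h3, h4, h5⟩ := hT n hn
    obtain ⟨k1, k2, k3, k4, k5⟩ := hT n' hn'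
    obtain ⟨m1, m2, m3, m4⟩ := hmem n h2
    obtain ⟨l1, l2, l3, l4⟩ := hmem n' k2
    have P' := P.swap
    have h2' : n ∉ [y₁, a₁, x₁, u, t] := by simp at h2 ⊢; tauto
    have k2' : n' ∉ [y₁, a₁, x₁, u, t] := by simp at k2 ⊢; tauto
    have sq : ∀ i j, Γ.Adj i j → Γ.Adj i n → Γ.Adj j n' → i ≠ n' → j ≠ n → False :=
      fun i j ij in' jn h h' => by
        rcases g4 _ _ _ _ ij jn nn.symm in'.symm with e | e
        · exact h e
        · exact h' e
    have tri : ∀ i, Γ.Adj i n → Γ.Adj i n' → False := fun i h h' => g3 _ _ _ h nn h'.symm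
    rcases h5 with ⟨-, h5⟩ | ⟨-, h5⟩ | h5 | h5 <;> rcases k5 with ⟨-, k5⟩ | ⟨-, k5⟩ | k5 | k5
    · exact tri _ h5 k5
    · exact P.not_adj M h1 k1 h2 k2 h5 k5 nn
    · exact P.not_adj' M h1 k1 h2 k2 h5 k5 nn
    · exact sq _ _ exu h5 k5 l1.symm m3.symm
    · exact P.not_adj M k1 h1 k2 h2 k5 h5 nn.symm
    · exact tri _ h5 k5
    · exact sq _ _ ety.symm h5 k5 l2.symm m4.symm
    · exact P'.not_adj' M h1 k1 h2' k2' h5 k5 nn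
    · exact P.not_adj' M k1 h1 k2 h2 k5 h5 nn.symm
    · exact sq _ _ ety h5 k5 l4.symm m2.symm
    · exact tri _ h5 k5
    · exact sq _ _ eut.symm h5 k5 l4.symm m3.symm
    · exact sq _ _ exu.symm h5 k5 l3.symm m1.symm
    · exact P'.not_adj' M k1 h1 k2' h2' k5 h5 nn.symm
    · exact sq _ _ eut h5 k5 l3.symm m4.symm
    · exact tri _ h5 k5

end Ladder

theorem MinCE.eq_nil (M : MinCE Γ z S B L p φ) : p = [] := by
  by_contra hp
  have hl := (List.dropLast_append_getLast hp).symm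
  obtain ⟨x₁, a₁, h1, h2, h3, h4, h5⟩ := M.exists_hook hl
  obtain ⟨y₁, w, H, hw⟩ :=
    Hook.exists_ladder ⟨List.getLast?_eq_some_getLast hp, h1, h2, h3, h4, h5⟩ M
  have haB := H.two.mem_boundary M
  obtain ⟨u, t, uS, uB, tS, tB, xu, ut, yt⟩ := H.exists_pentagon M
  exact H.false_of_pentagon M (H.length_eq_six M hw)
    ⟨by simp [H.mem, H.mem_y, haB], by simp [uS, uB, tS, tB], H.adj', H.adj_y, xu, ut, yt.symm,
      H.ne⟩

section Puncture

variable {G : SimpleGraph V} {t : V} {c : ℕ}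

open Classical in
/-- The lists after `t` has received the colour `c`. -/
noncomputable def puncture (G : SimpleGraph V) (t : V) (c : ℕ) (L : V → Finset ℕ) (u : V) :
    Finset ℕ :=
  if G.Adj t u then (L u).erase c else L u

open Classical in
/-- Removing a vertex whose neighbours are nearly independent yields a configuration. -/
theorem Cfg.of_puncture (ht : t ∈ S) (hG : Planar fun a b => a ∈ S ∧ b ∈ S ∧ G.Adj a b)
    (hΓ : ∀ a b, Γ.Adj a b → G.Adj a b) (hL : ∀ v ∈ S, 3 ≤ (L v).card) (nd : p.Nodup)
    (hch : p.IsChain Γ.Adj) (hlen : p.length ≤ 4) (hp : ∀ v ∈ p, v ∈ S ∧ G.Adj t v)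
    (proper : ∀ u ∈ p, ∀ v ∈ p, Γ.Adj u v → φ u ≠ φ v)
    (htri : ∀ u v, u ∉ p → G.Adj t u → G.Adj t v → ¬ Γ.Adj u v) :
    Cfg Γ t (S.erase t) (S.filter (G.Adj t)) (puncture G t c L) p φ := by
  have hcard : ∀ v ∈ S, 2 ≤ (puncture G t c L v).card := by
    intro v hv
    have := hL v hv
    unfold puncture
    split_ifs
    · have := Finset.pred_card_le_card_erase (s := L v) (a := c)
      omega
    · omega
  have htwo : ∀ v, Two (S.erase t) (puncture G t c L) p v → v ∈ S ∧ v ∉ p ∧ G.Adj t v := by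
    rintro v ⟨h1, h2, h3⟩
    have hv := Finset.mem_of_mem_erase h1
    refine ⟨hv, h2, ?_⟩
    by_contra h
    have := hL v hv
    rw [puncture, if_neg h] at h3
    omega
  have hsub : S.filter (G.Adj t) ⊆ S.erase t := by
    intro v hv
    obtain ⟨h1, h2⟩ := Finset.mem_filter.1 hv
    exact Finset.mem_erase.2 ⟨h2.ne', h1⟩
  refine ⟨⟨hG.mono ?_, by simp, hsub⟩, fun v hv => Finset.mem_filter.2 (hp v hv), nd, hch, proper,
    fun v hv _ => hcard v (Finset.mem_of_mem_erase hv), ?_, ?_, ?_, Or.inl hlen⟩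
  · rintro a b (⟨ha, hb, hab⟩ | ⟨rfl, hb⟩ | ⟨rfl, ha⟩)
    · exact ⟨Finset.mem_of_mem_erase ha, Finset.mem_of_mem_erase hb, hΓ _ _ hab⟩
    · obtain ⟨h1, h2⟩ := Finset.mem_filter.1 hb
      exact ⟨ht, h1, h2⟩
    · obtain ⟨h1, h2⟩ := Finset.mem_filter.1 ha
      exact ⟨h1, ht, h2.symm⟩
  · intro v hv hvB
    have hv := Finset.mem_of_mem_erase hv
    rw [puncture, if_neg fun h => hvB (Finset.mem_filter.2 ⟨hv, h⟩)]
    exact hL v hv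
  · exact fun u v hu hv => htri u v (htwo u hu).2.1 (htwo u hu).2.2 (htwo v hv).2.2
  · intro v hv
    obtain ⟨h1, h2, h3⟩ := htwo v hv
    obtain ⟨d, hd⟩ := Finset.card_pos.1 (two_pos.trans_le (hcard v h1))
    exact ⟨d, hd, fun u hu huv => absurd huv (htri v u h2 h3 (hp u hu).2)⟩

theorem Extends.of_puncture (hΓ : ∀ a b, a ≠ t → b ≠ t → G.Adj a b → Γ.Adj a b)
    (hc : c ∈ L t) (hp : ∀ v ∈ p, φ v ∈ L v ∧ φ v ≠ c)
    (h : Extends Γ (S.erase t) (puncture G t c L) p φ) : Extends G S L [] φ := by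
  obtain ⟨ψ, h1, h2, h3⟩ := h
  have hmem : ∀ v ∈ S, v ≠ t → ψ v ∈ L v ∧ (G.Adj t v → c ≠ ψ v) := by
    intro v hv hvt
    by_cases hvp : v ∈ p
    · rw [h1 v hvp]
      exact ⟨(hp v hvp).1, fun _ => (hp v hvp).2.symm⟩
    · have := h2 v (Finset.mem_erase.2 ⟨hvt, hv⟩) hvp
      unfold puncture at this
      split_ifs at this with h
      · exact ⟨(Finset.mem_erase.1 this).2, fun _ => (Finset.mem_erase.1 this).1.symm⟩
      · exact ⟨this, fun h' => absurd h' h⟩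
  refine ⟨fun v => if v = t then c else ψ v, by simp, ?_, ?_⟩
  · intro v hv _
    dsimp only
    split_ifs with h
    · exact h ▸ hc
    · exact (hmem v hv h).1
  · intro u hu v hv huv
    dsimp only
    split_ifs with h h' h'
    · exact absurd (h.trans h'.symm) huv.ne
    · exact (hmem v hv h').2 (h ▸ huv)
    · exact ((hmem u hu h).2 (h' ▸ huv.symm)).symm
    · exact h3 u (Finset.mem_erase.2 ⟨h, hu⟩) v (Finset.mem_erase.2 ⟨h', hv⟩) (hΓ _ _ h h' huv)

end Puncture

theorem MinCE.false_of_nonempty (M : MinCE Γ z S B L [] φ) {v : V} (hv : v ∈ B)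
    (h : Two S L [] v ∨ ∀ u, ¬ Two S L [] u) : False := by
  have hvS := M.disc.sub hv
  obtain ⟨c, hc⟩ := Finset.card_pos.1 (two_pos.trans_le (M.two_le v hvS (by simp)))
  have hT : ∀ u, Two S L [v] u → Two S L [] u := fun u hu => ⟨hu.1, by simp, hu.2.2⟩
  have hext : Extends Γ S L [v] (fun _ => c) := by
    refine M.finer B [v] (fun _ => c) ?_ ⟨M.disc, by simpa using hv, by simp, by simp, by simp,
      fun u hu _ => M.two_le u hu (by simp), M.three_le,
      fun u w hu hw => M.indep u w (hT u hu) (hT w hw), fun u hu => ?_, Or.inl (by simp)⟩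
    · refine Nat.add_lt_add_left (Finset.card_lt_card ?_) _
      rw [Finset.ssubset_iff_of_subset (fun u => by simp +contextual)]
      exact ⟨v, by simpa using hvS, by simp⟩
    · obtain ⟨d, hd, -⟩ := M.avail u (hT u hu)
      refine ⟨d, hd, fun w hw huw => ?_⟩
      rw [List.mem_singleton.1 hw] at huw
      rcases h with h | h
      · exact absurd huw (M.indep u v (hT u hu) h)
      · exact absurd (hT u hu) (h u)
  obtain ⟨ψ, h1, h2, h3⟩ := hext
  refine M.not_extends ⟨ψ, by simp, fun u hu _ => ?_, h3⟩
  by_cases huv : u = v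
  · rw [huv, h1 v (by simp)]
    exact hc
  · exact h2 u hu (by simpa using huv)

theorem MinCE.false (M : MinCE Γ z S B L p φ) : False := by
  obtain rfl := M.eq_nil
  by_cases hB : B = ∅
  · subst hB
    have hL : ∀ v ∈ S, 3 ≤ (L v).card := fun v hv => M.three_le v hv (by simp)
    rcases S.eq_empty_or_nonempty with rfl | ⟨v, hv⟩
    · exact M.not_extends ⟨φ, by simp, by simp, by simp⟩
    obtain ⟨c, hc⟩ := Finset.card_pos.1 ((by omega : 0 < 3).trans_le (hL v hv))
    refine M.not_extends (.of_puncture (t := v) (p := []) (fun _ _ _ _ h => h) hc (by simp)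
      (M.smaller _ _ _ _ [] φ (Finset.card_erase_lt_of_mem hv) (.of_puncture hv
        (M.disc.planar.mono fun a b h => Or.inl h) (fun _ _ h => h) hL (by simp) (by simp)
        (by simp) (by simp) (by simp)
        fun u w _ vu vw uw => M.girth.no_three _ _ _ vu uw vw.symm)))
  · by_cases h : ∃ u, Two S L [] u
    · obtain ⟨u, hu⟩ := h
      exact M.false_of_nonempty (hu.mem_boundary M) (Or.inl hu)
    · obtain ⟨v, hv⟩ := Finset.nonempty_iff_ne_empty.2 hB
      exact M.false_of_nonempty hv (Or.inr (by simpa using h))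

/-- In a plane graph of girth at least five, the colouring of a short boundary path extends. -/
theorem Cfg.extends (hΓ : GirthFive Γ) (C : Cfg Γ z S B L p φ) : Extends Γ S L p φ := by
  induction hn : S.card using Nat.strong_induction_on generalizing z S B L p φ with
  | _ n ih =>
  induction hk : (S.filter (· ∉ B)).card + (S.filter (· ∉ p)).card using Nat.strong_induction_on
    generalizing B p φ with
  | _ k ih' =>
  by_contra hne
  exact MinCE.false ⟨C, hΓ, fun z' S' B' L' p' φ' hlt C' => ih _ (hn ▸ hlt) C' rfl,
    fun B' p' φ' hlt C' => ih' _ (hk ▸ hlt) C' rfl, hne⟩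

end Configurations

section Short

variable {V : Type} [DecidableEq V] {G : SimpleGraph V}

/-- `E` is the edge set of a cycle of length at most four. -/
def ShortCycle (G : SimpleGraph V) (E : Finset (Sym2 V)) : Prop :=
  ∃ (a : V) (c : G.Walk a a), c.IsCycle ∧ c.length ≤ 4 ∧ c.edges.toFinset = E

theorem ShortCycle.of_three {a b c : V} (hab : G.Adj a b) (hbc : G.Adj b c) (hca : G.Adj c a) :
    ShortCycle G {s(a, b), s(b, c), s(c, a)} := by
  refine ⟨a, .cons hab (.cons hbc (.cons hca .nil)), ?_, by simp, by ext; simp⟩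
  have := hab.ne
  have := hbc.ne
  have := hca.ne
  simp [Walk.cons_isCycle_iff, Walk.cons_isPath_iff]
  grind

theorem ShortCycle.of_four {a b c d : V} (hab : G.Adj a b) (hbc : G.Adj b c) (hcd : G.Adj c d)
    (hda : G.Adj d a) (hac : a ≠ c) (hbd : b ≠ d) :
    ShortCycle G {s(a, b), s(b, c), s(c, d), s(d, a)} := by
  refine ⟨a, .cons hab (.cons hbc (.cons hcd (.cons hda .nil))), ?_, by simp, by ext; simp⟩
  have := hab.ne
  have := hbc.ne
  have := hcd.ne
  have := hda.ne
  simp [Walk.cons_isCycle_iff, Walk.cons_isPath_iff]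
  grind

theorem GirthFive.deleteIncidenceSet {t : V}
    (h : ∀ E, ShortCycle G E → ∃ e ∈ E, t ∈ e) : GirthFive (G.deleteIncidenceSet t) := by
  refine ⟨fun a b c hab hbc hca => ?_, fun a b c d hab hbc hcd hda => ?_⟩
  · rw [deleteIncidenceSet_adj] at hab hbc hca
    obtain ⟨e, he, hte⟩ := h _ (.of_three hab.1 hbc.1 hca.1)
    simp only [Finset.mem_insert, Finset.mem_singleton] at he
    rcases he with rfl | rfl | rfl <;> simp at hte <;> grind
  · by_contra! hcon
    rw [deleteIncidenceSet_adj] at hab hbc hcd hda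
    obtain ⟨e, he, hte⟩ := h _ (.of_four hab.1 hbc.1 hcd.1 hda.1 hcon.1 hcon.2)
    simp only [Finset.mem_insert, Finset.mem_singleton] at he
    rcases he with rfl | rfl | rfl | rfl <;> simp at hte <;> grind

theorem lColorable_of_deleteIncidenceSet [Fintype V] {L : V → Finset ℕ} {t : V} {c : ℕ}
    {p : List V} {φ : V → ℕ} (hG : Planar G.Adj) (hL : ∀ v, 3 ≤ (L v).card)
    (hE : ∀ E, ShortCycle G E → ∃ e ∈ E, t ∈ e) (hc : c ∈ L t)
    (nd : p.Nodup) (hch : p.IsChain G.Adj) (hlen : p.length ≤ 4) (hp : ∀ v ∈ p, G.Adj t v)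
    (proper : ∀ u ∈ p, ∀ v ∈ p, G.Adj u v → φ u ≠ φ v) (hφ : ∀ v ∈ p, φ v ∈ L v ∧ φ v ≠ c)
    (htri : ∀ u v, u ∉ p → G.Adj t u → G.Adj t v → ¬ G.Adj u v) : LColorable G L := by
  have hle : ∀ a b, (G.deleteIncidenceSet t).Adj a b → G.Adj a b :=
    fun a b h => (deleteIncidenceSet_adj.1 h).1
  have hch' : p.IsChain (G.deleteIncidenceSet t).Adj := by
    refine hch.imp_of_mem_imp fun a b ha hb hab => ?_
    exact deleteIncidenceSet_adj.2 ⟨hab, (hp a ha).ne', (hp b hb).ne'⟩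
  have C : Cfg (G.deleteIncidenceSet t) t _ _ (puncture G t c L) p φ :=
    .of_puncture (S := Finset.univ) (by simp) (hG.mono fun a b h => h.2.2) hle (fun v _ => hL v) nd
      hch' hlen (fun v hv => ⟨by simp, hp v hv⟩)
      (fun u hu v hv h => proper u hu v hv (hle _ _ h))
      fun u v hu tu tv h => htri u v hu tu tv (hle _ _ h)
  obtain ⟨ψ, -, h2, h3⟩ := Extends.of_puncture (G := G)
    (fun a b ha hb h => deleteIncidenceSet_adj.2 ⟨h, ha, hb⟩) hc hφ
    (C.extends (GirthFive.deleteIncidenceSet hE))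
  exact ⟨ψ, fun v => h2 v (by simp) (by simp), fun u v => h3 u (by simp) v (by simp)⟩

theorem choosable_of_shortCycle_eq [Fintype V] (hG : Planar G.Adj)
    (hone : ∀ E E', ShortCycle G E → ShortCycle G E' → E = E') : Choosable G 3 := by
  intro L hL
  have hcol : ∀ v, ∃ c, c ∈ L v := fun v => Finset.card_pos.1 (by have := hL v; omega)
  by_cases h3 : ∃ a b c, G.Adj a b ∧ G.Adj b c ∧ G.Adj c a
  · obtain ⟨a, b, c, hab, hbc, hca⟩ := h3
    have hE := fun E hE => hone E _ hE (.of_three hab hbc hca)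
    obtain ⟨ca, hcaL⟩ := hcol a
    obtain ⟨cb, hcb, hcb'⟩ := Finset.exists_mem_ne (s := L b) (by have := hL b; omega) ca
    obtain ⟨cc, hcc, hcc'⟩ := Finset.exists_mem_notMem_of_card_lt_card (s := {ca, cb}) (t := L c)
      (by have := hL c; have := Finset.card_le_two (a := ca) (b := cb); omega)
    simp only [Finset.mem_insert, Finset.mem_singleton, not_or] at hcc'
    have hcb_ne : c ≠ b := hbc.ne'
    refine lColorable_of_deleteIncidenceSet (t := a) (c := ca) (p := [b, c])
      (φ := fun v => if v = b then cb else cc) hG hL ?_ hcaL (by simp [hbc.ne]) (by simpa using hbc)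
      (by simp) (by simp [hab, hca.symm])
      (by simp [hcb_ne, hcc'.2, Ne.symm hcc'.2]) (by simp [hcb_ne, hcb, hcb', hcc, hcc'.1]) ?_
    · intro E hE'
      exact ⟨s(a, b), by rw [hE E hE']; simp, by simp⟩
    · intro u v hu au av uv
      have : s(a, u) ∈ ({s(a, u), s(u, v), s(v, a)} : Finset (Sym2 V)) := by simp
      rw [hE _ (.of_three au uv av.symm)] at this
      have := hab.ne
      have := hca.ne
      simp at *
      grind
  push Not at h3
  suffices h : ∀ t, (∀ E, ShortCycle G E → ∃ e ∈ E, t ∈ e) → LColorable G L by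
    by_cases hex : ∃ E, ShortCycle G E
    · obtain ⟨E, hE⟩ := hex
      obtain ⟨a, c, hc, -, hcE⟩ := id hE
      refine h a fun E' hE' => ?_
      obtain rfl := hone E' E hE' hE
      obtain ⟨e, he, hae⟩ := (Walk.mem_support_iff_exists_mem_edges_of_not_nil hc.not_nil).1
        c.start_mem_support
      exact ⟨e, by simpa [← hcE] using he, hae⟩
    · rcases isEmpty_or_nonempty V with hV | ⟨⟨t⟩⟩
      · exact ⟨fun _ => 0, fun v => isEmptyElim v, fun v => isEmptyElim v⟩
      · exact h t fun E hE => absurd ⟨E, hE⟩ hex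
  intro t ht
  obtain ⟨c, hc⟩ := hcol t
  exact lColorable_of_deleteIncidenceSet (p := []) (φ := fun _ => 0) hG hL ht hc (by simp)
    (by simp) (by simp) (by simp) (by simp) (by simp)
    fun u v _ tu tv uv => h3 t u v tu uv tv.symm

end Short

/-- Every planar (simple, finite) graph containing at most one cycle of length at
most `4` (i.e. any two such cycles coincide as subgraphs, having equal edge sets)
is `3`-choosable. -/
theorem planar_at_most_one_short_cycle_three_choosable
    {V : Type} [Fintype V] [DecidableEq V] (G : SimpleGraph V)
    (hplanar : Nonempty (PlaneEmbedding G))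
    (hone : ∀ ⦃a b : V⦄ (c₁ : G.Walk a a) (c₂ : G.Walk b b),
      c₁.IsCycle → c₂.IsCycle → c₁.length ≤ 4 → c₂.length ≤ 4 →
      c₁.edges.toFinset = c₂.edges.toFinset) :
    Choosable G 3 := by
  obtain ⟨emb⟩ := hplanar
  refine choosable_of_shortCycle_eq emb.planar ?_
  rintro E E' ⟨a, c, hc, hc', rfl⟩ ⟨b, d, hd, hd', rfl⟩
  exact hone c d hc hd hc' hd'
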